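/- arXiv:1010.1961 — 4 statements merged into one kernel-verified Lean document; each statement's English description precedes it below -/
import Mathlib

section
/- Almost surely, the time at which M attains its overall maximum is unique: for P-almost every ω, the set {t ≥ 0 : M_t(ω) = sup_{s ≥ 0} M_s(ω)} contains exactly one element. In particular, with ρ' := inf{t ≥ 0 : M_t = M*_∞} and ρ'' := sup{t ≥ 0 : M_t = M*_∞}, one has P[ρ' = ρ''] = 1. -/
open MeasureTheory Filter Set
open scoped NNReal ENNReal

theorem NNReal.monotone_natCast_div (n : ℕ) : Monotone fun k : ℕ => (k : ℝ≥0) / n := fun i j h => by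
  simp only
  gcongr

theorem NNReal.tendsto_natFloor_mul_div (t : ℝ≥0) :
    Tendsto (fun n : ℕ => ((⌊t * n⌋₊ : ℕ) : ℝ≥0) / n) atTop (nhds t) := by
  rw [← NNReal.tendsto_coe]
  refine ((tendsto_nat_floor_mul_div_atTop t.2).comp tendsto_natCast_atTop_atTop).congr fun n => ?_
  have : ⌊(t : ℝ) * n⌋₊ = ⌊t * n⌋₊ := by
    refine eq_of_forall_le_iff fun k => ?_
    rw [Nat.le_floor_iff (by positivity), Nat.le_floor_iff (by positivity)]
    exact_mod_cast Iff.rfl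
  simp [this]

namespace MeasureTheory.Martingale

variable {Ω : Type*} {m : MeasurableSpace Ω} {P : Measure Ω}

theorem comp_monotone {ι κ : Type*} [Preorder ι] [Preorder κ] {ℱ : Filtration ι m}
    {M : ι → Ω → ℝ} (hM : Martingale M ℱ P) {t : κ → ι} (ht : Monotone t) :
    Martingale (fun k => M (t k))
      ⟨fun k => ℱ (t k), fun _ _ h => ℱ.mono (ht h), fun k => ℱ.le (t k)⟩ P :=
  ⟨fun k => hM.1 (t k), fun _ _ h => hM.2 _ _ (ht h)⟩

variable {𝒢 : Filtration ℝ≥0 m} {N : ℝ≥0 → Ω → ℝ}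

theorem measurableSet_exists_lt (hN : Martingale N 𝒢 P) (hcont : ∀ ω, Continuous fun t => N t ω)
    (c : ℝ) : MeasurableSet {ω | ∃ t, c < N t ω} := by
  have : {ω | ∃ t, c < N t ω} =
      ⋃ i : ℕ, {ω | c < N (TopologicalSpace.denseSeq ℝ≥0 i) ω} := by
    ext ω
    simp only [mem_ofPred_eq, mem_iUnion]
    constructor
    · rintro ⟨t, ht⟩
      obtain ⟨i, hi⟩ := (TopologicalSpace.denseRange_denseSeq ℝ≥0).exists_mem_open
        (isOpen_lt continuous_const (hcont ω)) ⟨t, ht⟩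
      exact ⟨i, hi⟩
    · rintro ⟨i, hi⟩
      exact ⟨_, hi⟩
  rw [this]
  exact MeasurableSet.iUnion fun i => measurableSet_lt measurable_const
    ((hN.1 _).mono (𝒢.le _)).measurable

variable [IsProbabilityMeasure P]

theorem integral_eq {ι : Type*} [Preorder ι] {ℱ : Filtration ι m}
    {M : ι → Ω → ℝ} (hM : Martingale M ℱ P) {i j : ι} (hij : i ≤ j) :
    ∫ ω, M i ω ∂P = ∫ ω, M j ω ∂P := by
  simpa using hM.setIntegral_eq hij MeasurableSet.univ

/-- Doob's maximal inequality for a nonnegative discrete-time martingale. -/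
theorem mul_measureReal_exists_lt_le {ℱ : Filtration ℕ m} {X : ℕ → Ω → ℝ}
    (hX : Martingale X ℱ P) (hnn : ∀ k ω, 0 ≤ X k ω) (c : ℝ≥0) (n : ℕ) :
    c * P.real {ω | ∃ k ≤ n, c < X k ω} ≤ ∫ ω, X 0 ω ∂P := by
  have h := maximal_ineq hX.submartingale hnn (ε := c) n
  set S := {ω | (c : ℝ) ≤ (Finset.range (n + 1)).sup' Finset.nonempty_range_add_one
    fun k => X k ω}
  have h2 : {ω | ∃ k ≤ n, c < X k ω} ⊆ S := by
    rintro ω ⟨k, hk, hlt⟩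
    exact hlt.le.trans (Finset.le_sup' (fun k => X k ω) (Finset.mem_range.2 (by omega)))
  have h3 : ∫ ω in S, X n ω ∂P ≤ ∫ ω, X n ω ∂P :=
    setIntegral_le_integral (hX.integrable n) (ae_of_all _ (hnn n))
  have h4 : c * P.real S ≤ ∫ ω in S, X n ω ∂P := by
    have := ENNReal.toReal_mono ENNReal.ofReal_ne_top h
    rwa [ENNReal.toReal_mul, ENNReal.toReal_ofReal (integral_nonneg (hnn n))] at this
  calc c * P.real {ω | ∃ k ≤ n, c < X k ω} ≤ c * P.real S := by
        have := measureReal_mono (μ := P) h2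
        gcongr
    _ ≤ ∫ ω, X 0 ω ∂P := by
        rw [hX.integral_eq (Nat.zero_le n)]
        exact h4.trans h3

/-- On the event that a martingale first exceeds level `1` with a value at most `b`, its
expectation is at most `b` times the probability of the event. -/
theorem setIntegral_firstPassage_le {ℱ : Filtration ℕ m} {X : ℕ → Ω → ℝ}
    (hX : Martingale X ℱ P) (b : ℝ) (n : ℕ) :
    ∫ ω in {ω | ∃ k ≤ n, 1 < X k ω ∧ X k ω ≤ b ∧ ∀ i < k, X i ω ≤ 1}, X n ω ∂P ≤
      b * P.real {ω | ∃ k ≤ n, 1 < X k ω ∧ X k ω ≤ b ∧ ∀ i < k, X i ω ≤ 1} := by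
  set Q : ℕ → Set Ω := fun k => {ω | 1 < X k ω ∧ X k ω ≤ b ∧ ∀ i < k, X i ω ≤ 1} with hQ
  set R : ℕ → Set Ω := fun n => {ω | ∃ k ≤ n, ω ∈ Q k} with hR
  have hmeas : ∀ i k, i ≤ k → Measurable[ℱ k] (X i) := fun i k h =>
    ((hX.1 i).mono (ℱ.mono h)).measurable
  have hQm : ∀ k, MeasurableSet[ℱ k] (Q k) := by
    intro k
    have : Q k = {ω | 1 < X k ω} ∩ ({ω | X k ω ≤ b} ∩ ⋂ i, ⋂ (_ : i < k), {ω | X i ω ≤ 1}) := by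
      ext ω; simp [hQ]
    rw [this]
    refine (measurableSet_lt measurable_const (hmeas k k le_rfl)).inter
      ((measurableSet_le (hmeas k k le_rfl) measurable_const).inter
      (MeasurableSet.iInter fun i => MeasurableSet.iInter fun hi =>
        measurableSet_le (hmeas i k hi.le) measurable_const))
  have hRm : ∀ n, MeasurableSet[ℱ n] (R n) := by
    intro n
    have : R n = ⋃ k, ⋃ (_ : k ≤ n), Q k := by ext ω; simp [hR]
    rw [this]
    exact MeasurableSet.iUnion fun k => MeasurableSet.iUnion fun hk => ℱ.mono hk _ (hQm k)
  have hQle : ∀ k, ∫ ω in Q k, X k ω ∂P ≤ b * P.real (Q k) := by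
    intro k
    calc ∫ ω in Q k, X k ω ∂P ≤ ∫ ω in Q k, b ∂P :=
          setIntegral_mono_on (hX.integrable k).integrableOn
            (integrable_const b).integrableOn (ℱ.le k _ (hQm k)) fun ω hω => hω.2.1
      _ = b * P.real (Q k) := by simp [mul_comm]
  change ∫ ω in R n, X n ω ∂P ≤ b * P.real (R n)
  induction n with
  | zero =>
    have : R 0 = Q 0 := by ext ω; simp [hR]
    rw [this]; exact hQle 0
  | succ n ih =>
    have hunion : R (n + 1) = R n ∪ Q (n + 1) := by
      ext ω
      simp only [hR, mem_ofPred_eq, mem_union]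
      constructor
      · rintro ⟨k, hk, h⟩
        rcases Nat.le_succ_iff.1 hk with hk | rfl
        · exact Or.inl ⟨k, hk, h⟩
        · exact Or.inr h
      · rintro (⟨k, hk, h⟩ | h)
        · exact ⟨k, by omega, h⟩
        · exact ⟨n + 1, le_rfl, h⟩
    have hdisj : Disjoint (R n) (Q (n + 1)) := by
      rw [Set.disjoint_left]
      rintro ω ⟨k, hk, h⟩ h'
      exact absurd (h'.2.2 k (by omega)) (not_le.2 h.1)
    have hQm' := ℱ.le _ _ (hQm (n + 1))
    rw [hunion, setIntegral_union hdisj hQm' (hX.integrable _).integrableOn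
      (hX.integrable _).integrableOn, measureReal_union hdisj hQm',
      ← hX.setIntegral_eq n.le_succ (hRm n), mul_add]
    exact add_le_add ih (hQle _)

/-- Control of the mean of a nonnegative martingale started below `1` by the probability of
exceeding `1`, up to errors from jumps larger than `ε` and from the truncated terminal value. -/
theorem integral_le_of_firstPassage {ℱ : Filtration ℕ m} {X : ℕ → Ω → ℝ}
    (hX : Martingale X ℱ P) (hnn : ∀ k ω, 0 ≤ X k ω) (h0 : ∀ ω, X 0 ω ≤ 1) {ε : ℝ}
    (hε : 0 ≤ ε) (n : ℕ) :
    ∫ ω, X 0 ω ∂P ≤ (1 + ε) * P.real {ω | ∃ k ≤ n, 1 < X k ω} + ∫ ω, min (X n ω) 1 ∂P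
      + ∫ ω in {ω | ∃ k < n, X k ω + ε < X (k + 1) ω}, X n ω ∂P := by
  have hmeas : ∀ k, Measurable (X k) := fun k => ((hX.1 k).mono (ℱ.le k)).measurable
  set R := {ω | ∃ k ≤ n, 1 < X k ω ∧ X k ω ≤ 1 + ε ∧ ∀ i < k, X i ω ≤ 1} with hR
  set O := {ω | ∃ k < n, X k ω + ε < X (k + 1) ω} with hO
  have hRm : MeasurableSet R := by
    have : R = ⋃ k, ⋃ (_ : k ≤ n), ({ω | 1 < X k ω} ∩ ({ω | X k ω ≤ 1 + ε} ∩
        ⋂ i, ⋂ (_ : i < k), {ω | X i ω ≤ 1})) := by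
      ext ω
      simp only [hR, mem_ofPred_eq, mem_iUnion, mem_inter_iff, mem_iInter, exists_prop]
    rw [this]
    exact MeasurableSet.iUnion fun k => MeasurableSet.iUnion fun _ =>
      (measurableSet_lt measurable_const (hmeas k)).inter
      ((measurableSet_le (hmeas k) measurable_const).inter
      (MeasurableSet.iInter fun i => MeasurableSet.iInter fun _ =>
        measurableSet_le (hmeas i) measurable_const))
  have hOm : MeasurableSet O := by
    have : O = ⋃ k, ⋃ (_ : k < n), {ω | X k ω + ε < X (k + 1) ω} := by ext ω; simp [hO]
    rw [this]
    exact MeasurableSet.iUnion fun k => MeasurableSet.iUnion fun _ =>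
      measurableSet_lt ((hmeas k).add_const ε) (hmeas _)
  have hint := hX.integrable n
  have hmin : Integrable (fun ω => min (X n ω) 1) P := hint.inf (integrable_const 1)
  have hpt : ∀ ω, X n ω ≤ R.indicator (X n) ω + min (X n ω) 1 + O.indicator (X n) ω := by
    intro ω
    have hR0 : 0 ≤ R.indicator (X n) ω := indicator_nonneg (fun ω _ => hnn n ω) ω
    have hO0 : 0 ≤ O.indicator (X n) ω := indicator_nonneg (fun ω _ => hnn n ω) ω
    have hm0 : 0 ≤ min (X n ω) 1 := le_min (hnn n ω) zero_le_one
    by_cases hle : X n ω ≤ 1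
    · rw [min_eq_left hle]; linarith
    · classical
      have hex : ∃ k, 1 < X k ω := ⟨n, not_le.1 hle⟩
      have hk := Nat.find_spec hex
      have hkn : Nat.find hex ≤ n := Nat.find_min' hex (not_le.1 hle)
      have hlt : ∀ i < Nat.find hex, X i ω ≤ 1 := fun i hi => not_lt.1 (Nat.find_min hex hi)
      generalize Nat.find hex = k at hk hkn hlt
      by_cases hb : X k ω ≤ 1 + ε
      · rw [indicator_of_mem (show ω ∈ R from ⟨k, hkn, hk, hb, hlt⟩)]; linarith
      · have : ω ∈ O := by
          rcases k with _ | k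
          · exact absurd (h0 ω) (not_le.2 hk)
          · exact ⟨k, by omega, by linarith [hlt k k.lt_succ_self]⟩
        rw [indicator_of_mem this]; linarith
  have hI := integral_mono hint
    (((hint.indicator hRm).add hmin).add (hint.indicator hOm)) hpt
  rw [integral_add' ((hint.indicator hRm).add hmin) (hint.indicator hOm),
    integral_add' (hint.indicator hRm) hmin, integral_indicator hRm, integral_indicator hOm,
    ← hX.integral_eq n.zero_le] at hI
  have h1 := hX.setIntegral_firstPassage_le (1 + ε) n
  have h2 : P.real R ≤ P.real {ω | ∃ k ≤ n, 1 < X k ω} :=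
    measureReal_mono fun ω ⟨k, hk, h, _⟩ => ⟨k, hk, h⟩
  have h3 : (1 + ε) * P.real R ≤ (1 + ε) * P.real {ω | ∃ k ≤ n, 1 < X k ω} := by gcongr
  linarith

/-- Doob's maximal inequality for a nonnegative martingale with continuous paths. -/
theorem mul_measureReal_exists_lt_le_of_continuous (hN : Martingale N 𝒢 P)
    (hnn : ∀ t ω, 0 ≤ N t ω) (hcont : ∀ ω, Continuous fun t => N t ω) (c : ℝ≥0) :
    c * P.real {ω | ∃ t, c < N t ω} ≤ ∫ ω, N 0 ω ∂P := by
  set A : ℕ → Set Ω := fun n => {ω | ∃ k ≤ n ^ 2, c < N ((k : ℝ≥0) / n) ω} with hA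
  have hAm : ∀ n, MeasurableSet (A n) := by
    intro n
    have : A n = ⋃ k, ⋃ (_ : k ≤ n ^ 2), {ω | c < N ((k : ℝ≥0) / n) ω} := by ext ω; simp [hA]
    rw [this]
    exact MeasurableSet.iUnion fun k => MeasurableSet.iUnion fun _ =>
      measurableSet_lt measurable_const ((hN.1 _).mono (𝒢.le _)).measurable
  have hlim : Tendsto (fun n => P (A n)) atTop (nhds (P {ω | ∃ t, c < N t ω})) := by
    refine tendsto_measure_of_ae_tendsto_indicator_of_isFiniteMeasure _
      (hN.measurableSet_exists_lt hcont c) hAm (ae_of_all _ fun ω => ?_)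
    by_cases hω : ∃ t, c < N t ω
    · obtain ⟨t, ht⟩ := hω
      have h1 := (((hcont ω).tendsto t).comp (NNReal.tendsto_natFloor_mul_div t)).eventually
        (lt_mem_nhds ht)
      filter_upwards [h1, eventually_ge_atTop ⌈t⌉₊] with n hn hle
      refine iff_of_true ⟨_, ?_, hn⟩ ⟨t, ht⟩
      refine Nat.floor_le_of_le ?_
      have : t ≤ n := (Nat.le_ceil t).trans (by exact_mod_cast hle)
      push_cast
      rw [sq]
      gcongr
    · refine Eventually.of_forall fun n => iff_of_false ?_ hω
      rintro ⟨k, -, hk⟩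
      exact hω ⟨_, hk⟩
  have hlim' := ((ENNReal.tendsto_toReal (measure_ne_top P _)).comp hlim).const_mul (c : ℝ)
  refine le_of_tendsto' hlim' fun n => ?_
  have := (hN.comp_monotone (NNReal.monotone_natCast_div n)).mul_measureReal_exists_lt_le
    (fun k ω => hnn _ ω) c (n ^ 2)
  simp only [Nat.cast_zero, zero_div] at this
  exact this

/-- A nonnegative continuous martingale started at or below `1` and tending to `0` exceeds `1`
with probability at least its mean. -/
theorem integral_le_measureReal_exists_lt (hN : Martingale N 𝒢 P)
    (hnn : ∀ t ω, 0 ≤ N t ω) (hcont : ∀ ω, Continuous fun t => N t ω) (h0 : ∀ ω, N 0 ω ≤ 1)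
    (hlim : ∀ᵐ ω ∂P, Tendsto (fun t => N t ω) atTop (nhds 0)) :
    ∫ ω, N 0 ω ∂P ≤ P.real {ω | ∃ t, 1 < N t ω} := by
  set p := P.real {ω | ∃ t, 1 < N t ω}
  have hmeas : ∀ t, Measurable (N t) := fun t => ((hN.1 t).mono (𝒢.le t)).measurable
  have step : ∀ ε : ℝ, 0 < ε → ∀ T : ℕ,
      ∫ ω, N 0 ω ∂P ≤ (1 + ε) * p + ∫ ω, min (N T ω) 1 ∂P := by
    intro ε hε T
    set O : ℕ → Set Ω := fun n =>
      {ω | ∃ k < T * n, N ((k : ℝ≥0) / n) ω + ε < N (((k + 1 : ℕ) : ℝ≥0) / n) ω} with hO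
    have hOm : ∀ n, MeasurableSet (O n) := by
      intro n
      have : O n = ⋃ k, ⋃ (_ : k < T * n),
          {ω | N ((k : ℝ≥0) / n) ω + ε < N (((k + 1 : ℕ) : ℝ≥0) / n) ω} := by
        ext ω; simp [hO]
      rw [this]
      exact MeasurableSet.iUnion fun k => MeasurableSet.iUnion fun _ =>
        measurableSet_lt ((hmeas _).add_const ε) (hmeas _)
    have hOev : ∀ ω, ∀ᶠ n in atTop, ω ∉ O n := by
      intro ω
      have huc := (isCompact_Icc (a := (0 : ℝ≥0)) (b := T)).uniformContinuousOn_of_continuous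
        (hcont ω).continuousOn
      obtain ⟨δ, hδ, hd⟩ := Metric.uniformContinuousOn_iff.1 huc ε hε
      obtain ⟨n₀, hn₀⟩ := exists_nat_gt δ⁻¹
      filter_upwards [eventually_ge_atTop n₀] with n hn
      rintro ⟨k, hk, hlt⟩
      have hδn : δ⁻¹ < n := hn₀.trans_le (by exact_mod_cast hn)
      have hnpos : (0 : ℝ) < n := (inv_pos.2 hδ).trans hδn
      have hnpos' : (0 : ℝ≥0) < n := by exact_mod_cast hnpos
      have hmem : ∀ j : ℕ, j ≤ T * n → (j : ℝ≥0) / n ∈ Icc (0 : ℝ≥0) T := fun j hj =>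
        ⟨zero_le, by rw [div_le_iff₀ hnpos']; exact_mod_cast hj⟩
      have := hd _ (hmem (k + 1) hk) _ (hmem k hk.le) (by
        rw [NNReal.dist_eq]
        push_cast
        rw [← sub_div, add_sub_cancel_left, abs_of_pos (by positivity), one_div]
        exact inv_lt_of_inv_lt₀ hδ hδn)
      rw [Real.dist_eq] at this
      linarith [le_abs_self (N (((k + 1 : ℕ) : ℝ≥0) / n) ω - N ((k : ℝ≥0) / n) ω)]
    have hOlim : Tendsto (fun n => ∫ ω in O n, N T ω ∂P) atTop (nhds 0) := by
      have h1 : ∀ n, ∫ ω in O n, N T ω ∂P = ∫ ω, (O n).indicator (N T) ω ∂P :=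
        fun n => (integral_indicator (hOm n)).symm
      simp_rw [h1]
      rw [← integral_zero Ω ℝ (μ := P)]
      refine tendsto_integral_of_dominated_convergence (N T)
        (fun n => ((hmeas T).indicator (hOm n)).aestronglyMeasurable) (hN.integrable T)
        (fun n => ae_of_all _ fun ω => ?_) (ae_of_all _ fun ω => ?_)
      · rw [Real.norm_of_nonneg (indicator_nonneg (fun ω _ => hnn T ω) ω)]
        exact indicator_le_self' (fun ω _ => hnn T ω) ω
      · refine tendsto_const_nhds.congr' ?_
        filter_upwards [hOev ω] with n hn
        rw [indicator_of_notMem hn]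
    have hbd := hOlim.const_add ((1 + ε) * p + ∫ ω, min (N T ω) 1 ∂P)
    rw [add_zero] at hbd
    refine ge_of_tendsto hbd ?_
    filter_upwards [eventually_gt_atTop 0] with n hn
    have hX := (hN.comp_monotone (NNReal.monotone_natCast_div n)).integral_le_of_firstPassage
      (fun k ω => hnn _ ω) (by simpa using h0) hε.le (T * n)
    have hT : ((T * n : ℕ) : ℝ≥0) / n = T := by
      have : (n : ℝ≥0) ≠ 0 := by exact_mod_cast hn.ne'
      push_cast
      field_simp
    simp only [hT, Nat.cast_zero, zero_div] at hX
    refine hX.trans ?_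
    have : P.real {ω | ∃ k ≤ T * n, 1 < N ((k : ℝ≥0) / n) ω} ≤ p :=
      measureReal_mono fun ω ⟨k, _, h⟩ => ⟨_, h⟩
    gcongr
  have hmin : Tendsto (fun T : ℕ => ∫ ω, min (N T ω) 1 ∂P) atTop (nhds 0) := by
    rw [← integral_zero Ω ℝ (μ := P)]
    refine tendsto_integral_of_dominated_convergence (fun _ => 1)
      (fun T => ((hmeas T).min measurable_const).aestronglyMeasurable) (integrable_const 1)
      (fun T => ae_of_all _ fun ω => ?_) ?_
    · rw [Real.norm_of_nonneg (le_min (hnn _ ω) zero_le_one)]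
      exact min_le_right _ _
    · filter_upwards [hlim] with ω hω
      have := (hω.comp (tendsto_natCast_atTop_atTop (R := ℝ≥0))).min
        (tendsto_const_nhds (x := (1 : ℝ)))
      simpa using this
  have step2 : ∀ ε : ℝ, 0 < ε → ∫ ω, N 0 ω ∂P ≤ p + ε := by
    intro ε hε
    have h1 := hmin.const_add ((1 + ε) * p)
    rw [add_zero] at h1
    have h2 := ge_of_tendsto' h1 (step ε hε)
    have hp : p ≤ 1 := measureReal_le_one
    nlinarith
  exact le_of_forall_pos_le_add step2

/-- A nonnegative continuous martingale started at or below `1` and tending to `0` almost surely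
does not have overall maximum exactly `1`. -/
theorem measure_max_eq_one (hN : Martingale N 𝒢 P)
    (hnn : ∀ t ω, 0 ≤ N t ω) (hcont : ∀ ω, Continuous fun t => N t ω) (h0 : ∀ ω, N 0 ω ≤ 1)
    (hlim : ∀ᵐ ω ∂P, Tendsto (fun t => N t ω) atTop (nhds 0)) :
    P {ω | (∃ t, N t ω = 1) ∧ ∀ t, N t ω ≤ 1} = 0 := by
  set B := {ω | (∃ t, N t ω = 1) ∧ ∀ t, N t ω ≤ 1}
  set E := {ω | ∃ t, 1 < N t ω}
  have hE : MeasurableSet E := hN.measurableSet_exists_lt hcont 1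
  have hdisj : Disjoint B E := by
    rw [Set.disjoint_left]
    rintro ω ⟨-, h⟩ ⟨t, ht⟩
    exact absurd (h t) (not_le.2 ht)
  have hlow : ∫ ω, N 0 ω ∂P ≤ P.real E :=
    hN.integral_le_measureReal_exists_lt hnn hcont h0 hlim
  have key : ∀ c : ℝ≥0, c < 1 → c * (P.real B + P.real E) ≤ P.real E := by
    intro c hc
    rw [← measureReal_union hdisj hE]
    refine le_trans ?_ ((hN.mul_measureReal_exists_lt_le_of_continuous hnn hcont c).trans hlow)
    have : P.real (B ∪ E) ≤ P.real {ω | ∃ t, c < N t ω} := by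
      refine measureReal_mono ?_
      have hc' : (c : ℝ) < 1 := by exact_mod_cast hc
      rintro ω (⟨⟨t, ht⟩, -⟩ | ⟨t, ht⟩)
      · exact ⟨t, ht ▸ hc'⟩
      · exact ⟨t, hc'.trans ht⟩
    gcongr
  have hlimc : Tendsto (fun n : ℕ => (((n : ℝ) / (n + 1))) * (P.real B + P.real E)) atTop
      (nhds (1 * (P.real B + P.real E))) :=
    (tendsto_natCast_div_add_atTop (1 : ℝ)).mul_const _
  have hle : 1 * (P.real B + P.real E) ≤ P.real E := by
    refine le_of_tendsto' hlimc fun n => ?_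
    have := key ((n : ℝ≥0) / (n + 1)) (by rw [div_lt_one (by positivity)]; exact lt_add_one _)
    simpa using this
  have : P.real B = 0 := le_antisymm (by linarith) measureReal_nonneg
  exact (measureReal_eq_zero_iff).1 this

/-- A nonnegative continuous martingale tending to `0` almost surely does not attain its overall
maximum, if that is at least `1`, both before and after a fixed time `q`. -/
theorem measure_max_before_and_after (hN : Martingale N 𝒢 P)
    (hnn : ∀ t ω, 0 ≤ N t ω) (hcont : ∀ ω, Continuous fun t => N t ω)
    (hlim : ∀ᵐ ω ∂P, Tendsto (fun t => N t ω) atTop (nhds 0)) (q : ℝ≥0) :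
    P {ω | ∃ s ≤ q, ∃ t ≥ q, 1 ≤ N s ω ∧ N t ω = N s ω ∧ ∀ r, N r ω ≤ N s ω} = 0 := by
  set u : ℕ → ℝ≥0 := fun i => min (TopologicalSpace.denseSeq ℝ≥0 i) q with hu
  set Y : Ω → ℝ := fun ω => max 1 (⨆ i, N (u i) ω) with hY
  have hY1 : ∀ ω, 1 ≤ Y ω := fun ω => le_max_left _ _
  have hYpos : ∀ ω, 0 < Y ω := fun ω => zero_lt_one.trans_le (hY1 ω)
  have hYm : Measurable[𝒢 q] Y := by
    refine Measurable.max measurable_const (Measurable.iSup fun i => ?_)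
    exact ((hN.1 (u i)).mono (𝒢.mono (min_le_right _ _))).measurable
  have hbdd : ∀ ω, BddAbove (range fun i => N (u i) ω) := by
    intro ω
    refine ((isCompact_Icc (a := (0 : ℝ≥0)) (b := q)).image (hcont ω)).bddAbove.mono ?_
    rintro _ ⟨i, rfl⟩
    exact ⟨u i, ⟨zero_le, min_le_right _ _⟩, rfl⟩
  have hNY : ∀ ω, ∀ r ≤ q, N r ω ≤ Y ω := by
    intro ω r hr
    have hcl : IsClosed {r | N (min r q) ω ≤ Y ω} :=
      isClosed_le ((hcont ω).comp (continuous_id.min continuous_const)) continuous_const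
    have hall := (TopologicalSpace.denseRange_denseSeq ℝ≥0).induction_on
      (p := fun r => N (min r q) ω ≤ Y ω) r hcl
      fun i => (le_ciSup (hbdd ω) i).trans (le_max_right _ _)
    rwa [min_eq_left hr] at hall
  have hmono : Monotone fun t : ℝ≥0 => q + t := fun _ _ h => by simp only; gcongr
  have hYinv : StronglyMeasurable[𝒢 q] Y⁻¹ := hYm.inv.stronglyMeasurable
  have hYinv1 : ∀ ω, ‖Y⁻¹ ω‖ ≤ 1 := fun ω => by
    rw [Pi.inv_apply, norm_inv, Real.norm_of_nonneg (hYpos ω).le]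
    exact inv_le_one_of_one_le₀ (hY1 ω)
  have hshift := hN.comp_monotone hmono
  have hZ : Martingale (fun t => Y⁻¹ * N (q + t))
      ⟨fun t => 𝒢 (q + t), fun _ _ h => 𝒢.mono (hmono h), fun t => 𝒢.le (q + t)⟩ P := by
    have hYt : ∀ t, StronglyMeasurable[𝒢 (q + t)] Y⁻¹ := fun t =>
      hYinv.mono (𝒢.mono le_self_add)
    refine ⟨fun t => (hYt t).mul (hshift.1 t), fun s t hst => ?_⟩
    refine (condExp_stronglyMeasurable_mul_of_bound (𝒢.le (q + s)) (hYt s)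
      (hN.integrable (q + t)) 1 (ae_of_all _ hYinv1)).trans ?_
    exact EventuallyEq.rfl.mul (hshift.2 s t hst)
  refine measure_mono_null ?_ (hZ.measure_max_eq_one
    (fun t ω => mul_nonneg (inv_nonneg.2 (hYpos ω).le) (hnn _ ω))
    (fun ω => continuous_const.mul ((hcont ω).comp (continuous_const.add continuous_id)))
    (fun ω => ?_) ?_)
  · rintro ω ⟨s, hs, t, ht, h1, hts, hmax⟩
    have hYs : Y ω = N s ω :=
      le_antisymm (max_le h1 (ciSup_le fun i => hmax _)) (hNY ω s hs)
    refine ⟨⟨t - q, ?_⟩, fun r => ?_⟩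
    · rw [Pi.mul_apply, Pi.inv_apply, add_tsub_cancel_of_le ht, hts, ← hYs,
        inv_mul_cancel₀ (hYpos ω).ne']
    · rw [Pi.mul_apply, Pi.inv_apply, inv_mul_le_one₀ (hYpos ω), hYs]
      exact hmax _
  · rw [Pi.mul_apply, Pi.inv_apply, inv_mul_le_one₀ (hYpos ω)]
    exact hNY ω _ (by simp)
  · filter_upwards [hlim] with ω hω
    have hadd : Tendsto (fun t : ℝ≥0 => q + t) atTop atTop :=
      tendsto_atTop_mono (fun t => le_add_self) tendsto_id
    simpa using (hω.comp hadd).const_mul (Y ω)⁻¹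

end MeasureTheory.Martingale

/-- A continuous function on `ℝ≥0` that is positive at `0` and tends to `0` at infinity
attains its supremum. -/
theorem Continuous.exists_eq_iSup_of_tendsto_zero {f : ℝ≥0 → ℝ} (hf : Continuous f)
    (h0 : 0 < f 0) (hlim : Tendsto f atTop (nhds 0)) :
    (∃ t, f t = ⨆ s, f s) ∧ ∀ t, f t ≤ ⨆ s, f s := by
  obtain ⟨T, hT⟩ := eventually_atTop.1 (hlim.eventually (gt_mem_nhds h0))
  obtain ⟨t, -, htm⟩ := (isCompact_Icc (a := (0 : ℝ≥0)) (b := T)).exists_isMaxOn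
    ⟨0, le_rfl, zero_le⟩ hf.continuousOn
  have ht : ∀ s, f s ≤ f t := by
    intro s
    rcases le_total s T with hs | hs
    · exact htm ⟨zero_le, hs⟩
    · exact (hT s hs).le.trans (htm ⟨le_rfl, zero_le⟩)
  exact ⟨⟨t, le_antisymm (le_ciSup ⟨f t, by rintro _ ⟨s, rfl⟩; exact ht s⟩ t) (ciSup_le ht)⟩,
    fun s => le_ciSup ⟨f t, by rintro _ ⟨s, rfl⟩; exact ht s⟩ s⟩

/-- Let `M` be a nonnegative continuous martingale with `M 0 = 1` a.s. and
`M t → 0` a.s. as `t → ∞`. Then, almost surely, the time at which `M` attains its overall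
maximum `M*_∞ = ⨆ s, M s` is unique: a.s. there is exactly one `t` with `M t = M*_∞`.
In particular, with `ρ' := inf {t | M t = M*_∞}` and `ρ'' := sup {t | M t = M*_∞}`,
one has `P[ρ' = ρ''] = 1`. -/
theorem time_of_overall_maximum_is_as_unique
    {Ω : Type*} {m : MeasurableSpace Ω} {P : Measure Ω} [IsProbabilityMeasure P]
    (ℱ : Filtration ℝ≥0 m) (M : ℝ≥0 → Ω → ℝ)
    (hMmart : Martingale M ℱ P)
    (hMnonneg : ∀ t ω, 0 ≤ M t ω)
    (hMcont : ∀ ω, Continuous fun t => M t ω)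
    (hM0 : ∀ᵐ ω ∂P, M 0 ω = 1)
    (hMlim : ∀ᵐ ω ∂P, Tendsto (fun t => M t ω) atTop (nhds (0 : ℝ))) :
    (∀ᵐ ω ∂P, ∃! t : ℝ≥0, M t ω = ⨆ s, M s ω) ∧
      P {ω | sInf {t : ℝ≥0 | M t ω = ⨆ s, M s ω} = sSup {t : ℝ≥0 | M t ω = ⨆ s, M s ω}}
        = 1 := by
  have huniq : ∀ᵐ ω ∂P, ∃! t : ℝ≥0, M t ω = ⨆ s, M s ω := by
    have hnull : ∀ᵐ ω ∂P, ∀ i : ℕ, ¬ ∃ s ≤ TopologicalSpace.denseSeq ℝ≥0 i,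
        ∃ t ≥ TopologicalSpace.denseSeq ℝ≥0 i,
          1 ≤ M s ω ∧ M t ω = M s ω ∧ ∀ r, M r ω ≤ M s ω :=
      ae_all_iff.2 fun i => measure_eq_zero_iff_ae_notMem.1
        (hMmart.measure_max_before_and_after hMnonneg hMcont hMlim _)
    filter_upwards [hnull, hM0, hMlim] with ω hω h0 hlim
    obtain ⟨⟨t, ht⟩, hle⟩ := (hMcont ω).exists_eq_iSup_of_tendsto_zero
      (by rw [h0]; exact zero_lt_one) hlim
    have hno : ∀ a b : ℝ≥0, M a ω = ⨆ s, M s ω → M b ω = ⨆ s, M s ω → ¬ a < b := by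
      intro a b ha hb hab
      obtain ⟨i, hi⟩ := (TopologicalSpace.denseRange_denseSeq ℝ≥0).exists_mem_open
        isOpen_Ioo (nonempty_Ioo.2 hab)
      refine hω i ⟨a, hi.1.le, b, hi.2.le, ?_, hb.trans ha.symm, fun r => ha ▸ hle r⟩
      rw [ha, ← h0]
      exact hle 0
    exact ⟨t, ht, fun s hs => le_antisymm (not_lt.1 (hno t s ht hs)) (not_lt.1 (hno s t hs ht))⟩
  refine ⟨huniq, ?_⟩
  have hae : ∀ᵐ ω ∂P,
      sInf {t : ℝ≥0 | M t ω = ⨆ s, M s ω} = sSup {t : ℝ≥0 | M t ω = ⨆ s, M s ω} := by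
    filter_upwards [huniq] with ω ⟨t, ht, hu⟩
    have : {t : ℝ≥0 | M t ω = ⨆ s, M s ω} = {t} := by
      ext s
      exact ⟨fun hs => hu s hs, fun hs => hs ▸ ht⟩
    rw [this, csInf_singleton, csSup_singleton]
  exact (measure_congr (eventuallyEq_univ.2 hae)).trans measure_univ
end

section
/- Let ρ := inf{t ≥ 0 : M_t = M*_∞} be the (a.s. unique and a.s. finite) time at which M attains its overall maximum. Then for all 0 ≤ s ≤ t, almost surely, P[s < ρ ≤ t | 𝓕_s] = E[log M*_t − log M*_s | 𝓕_s]. (In the language of the paper: the nondecreasing continuous adapted process log M* coincides with the optional compensator, i.e. the dual optional projection, of the indicator process 1_{[ρ, ∞)}.) -/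
open MeasureTheory Filter Set
open scoped NNReal ENNReal

/-- The running maximum over `[0, t]` of a nonnegative real-valued process. -/
noncomputable def runningMax {Ω : Type*} (X : ℝ≥0 → Ω → ℝ) (t : ℝ≥0) (ω : Ω) : ℝ :=
  ⨆ u ∈ Set.Icc 0 t, X u ω

section RunningMax

variable {Ω : Type*} {X : ℝ≥0 → Ω → ℝ} {t : ℝ≥0} {ω : Ω}

lemma bddAbove_range_iSup_Icc (hcont : Continuous fun u => X u ω) (t : ℝ≥0) :
    BddAbove (range fun u : ℝ≥0 => ⨆ _ : u ∈ Set.Icc 0 t, X u ω) := by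
  obtain ⟨C, hC⟩ := (isCompact_Icc (a := (0 : ℝ≥0)) (b := t)).bddAbove_image hcont.continuousOn
  refine ⟨max C 0, ?_⟩
  rintro _ ⟨u, rfl⟩
  by_cases hu : u ∈ Set.Icc 0 t
  · simp only [ciSup_pos hu]
    exact (hC (mem_image_of_mem _ hu)).trans (le_max_left _ _)
  · have : IsEmpty (u ∈ Set.Icc 0 t) := ⟨hu⟩
    simp only [Real.iSup_of_isEmpty]
    exact le_max_right _ _

lemma le_runningMax (hcont : Continuous fun u => X u ω) {u : ℝ≥0} (hu : u ≤ t) :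
    X u ω ≤ runningMax X t ω := by
  have h := le_ciSup (bddAbove_range_iSup_Icc hcont t) u
  rwa [ciSup_pos (show u ∈ Set.Icc 0 t from ⟨zero_le, hu⟩)] at h

lemma exists_eq_runningMax (hnonneg : ∀ u, 0 ≤ X u ω) (hcont : Continuous fun u => X u ω)
    (t : ℝ≥0) : ∃ u ≤ t, X u ω = runningMax X t ω := by
  obtain ⟨u, hu, hmax⟩ := (isCompact_Icc (a := (0 : ℝ≥0)) (b := t)).exists_isMaxOn
    ⟨0, left_mem_Icc.2 zero_le⟩ hcont.continuousOn
  refine ⟨u, hu.2, (le_runningMax hcont hu.2).antisymm (ciSup_le fun v => ?_)⟩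
  by_cases hv : v ∈ Set.Icc 0 t
  · rw [ciSup_pos hv]
    exact hmax hv
  · have : IsEmpty (v ∈ Set.Icc 0 t) := ⟨hv⟩
    rw [Real.iSup_of_isEmpty]
    exact hnonneg u

lemma lt_runningMax_iff (hnonneg : ∀ u, 0 ≤ X u ω) (hcont : Continuous fun u => X u ω) {y : ℝ} :
    y < runningMax X t ω ↔ ∃ u ≤ t, y < X u ω := by
  constructor
  · intro h
    obtain ⟨u, hu, hu'⟩ := exists_eq_runningMax hnonneg hcont t
    exact ⟨u, hu, hu' ▸ h⟩
  · rintro ⟨u, hu, h⟩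
    exact h.trans_le (le_runningMax hcont hu)

lemma runningMax_mono (hnonneg : ∀ u, 0 ≤ X u ω) (hcont : Continuous fun u => X u ω)
    {s t : ℝ≥0} (hst : s ≤ t) : runningMax X s ω ≤ runningMax X t ω := by
  obtain ⟨u, hu, hu'⟩ := exists_eq_runningMax hnonneg hcont s
  exact hu' ▸ le_runningMax hcont (hu.trans hst)

lemma lt_runningMax_iff_denseSeq (hnonneg : ∀ u, 0 ≤ X u ω) (hcont : Continuous fun u => X u ω)
    {y : ℝ} :
    y < runningMax X t ω ↔ ∃ k : ℕ, y < X (min (TopologicalSpace.denseSeq ℝ≥0 k) t) ω := by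
  rw [lt_runningMax_iff hnonneg hcont]
  constructor
  · rintro ⟨u, hu, h⟩
    have hopen : IsOpen {v : ℝ≥0 | y < X (min v t) ω} :=
      isOpen_lt continuous_const (hcont.comp (continuous_id.min continuous_const))
    obtain ⟨_, hv, k, rfl⟩ := (TopologicalSpace.denseRange_denseSeq ℝ≥0).inter_open_nonempty _
      hopen ⟨u, by simpa [min_eq_left hu] using h⟩
    exact ⟨k, hv⟩
  · rintro ⟨k, h⟩
    exact ⟨_, min_le_right _ _, h⟩

lemma measurable_runningMax {m : MeasurableSpace Ω} (ℱ : Filtration ℝ≥0 m)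
    (hX : StronglyAdapted ℱ X) (hnonneg : ∀ u ω, 0 ≤ X u ω)
    (hcont : ∀ ω, Continuous fun u => X u ω) (t : ℝ≥0) : Measurable[ℱ t] (runningMax X t) := by
  refine measurable_of_Ioi fun y => ?_
  have : runningMax X t ⁻¹' Ioi y
      = ⋃ k : ℕ, X (min (TopologicalSpace.denseSeq ℝ≥0 k) t) ⁻¹' Ioi y := by
    ext ω
    simpa using lt_runningMax_iff_denseSeq (hnonneg · ω) (hcont ω)
  rw [this]
  exact MeasurableSet.iUnion fun k =>
    (((hX _).mono (ℱ.mono (min_le_right _ _))).measurable measurableSet_Ioi)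

end RunningMax

section MaximalIdentity

variable {Ω : Type*} {m : MeasurableSpace Ω} {P : Measure Ω} {ℱ : Filtration ℝ≥0 m}
  {X : ℝ≥0 → Ω → ℝ}

/-- The restriction of a filtration indexed by `ℝ≥0` to the grid of mesh `h`. -/
def gridFiltration (ℱ : Filtration ℝ≥0 m) (h : ℝ≥0) : Filtration ℕ m where
  seq i := ℱ (i * h)
  mono' i j hij := ℱ.mono (by gcongr)
  le' i := ℱ.le _

lemma martingale_grid (hX : Martingale X ℱ P) (h : ℝ≥0) :
    Martingale (fun (i : ℕ) => X (i * h)) (gridFiltration ℱ h) P :=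
  ⟨fun _ => hX.1 _, fun i j hij => hX.2 _ _ (by gcongr)⟩

/-- The first index at which the process, sampled on the grid of `n + 1` steps in `[0, t]`,
exceeds the level `y` (or `n + 1` if this does not happen). -/
noncomputable def gridHitting (X : ℝ≥0 → Ω → ℝ) (t : ℝ≥0) (y : ℝ) (n : ℕ) : Ω → ℕ :=
  hittingBtwn (fun (i : ℕ) => X (i * (t / (n + 1)))) (Ioi y) 0 (n + 1)

lemma isStoppingTime_gridHitting (hX : Martingale X ℱ P) (t : ℝ≥0) (y : ℝ) (n : ℕ) :
    IsStoppingTime (gridFiltration ℱ (t / (n + 1))) fun ω => (gridHitting X t y n ω : WithTop ℕ) :=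
  (martingale_grid hX _).1.adapted.isStoppingTime_hittingBtwn measurableSet_Ioi

lemma gridHitting_stopped_ae_eq_condExp [IsFiniteMeasure P] (hX : Martingale X ℱ P) (t : ℝ≥0)
    (y : ℝ) (n : ℕ) :
    (fun ω => X (gridHitting X t y n ω * (t / (n + 1))) ω)
      =ᵐ[P] P[X t | (isStoppingTime_gridHitting hX t y n).measurableSpace] := by
  have h := (martingale_grid hX (t / (n + 1))).stoppedValue_ae_eq_condExp_of_le_const
    (isStoppingTime_gridHitting hX t y n) (n := n + 1)
    (fun ω => WithTop.coe_le_coe.2 (hittingBtwn_le ω))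
  have ht : ((n + 1 : ℕ) : ℝ≥0) * (t / (n + 1)) = t := by
    push_cast
    field_simp
  simp only [ht] at h
  exact h

lemma setIntegral_gridHitting_stopped [IsFiniteMeasure P] (hX : Martingale X ℱ P) (t : ℝ≥0)
    (y : ℝ) (n : ℕ) {A : Set Ω} (hA : MeasurableSet[ℱ 0] A) :
    ∫ ω in A, X (gridHitting X t y n ω * (t / (n + 1))) ω ∂P = ∫ ω in A, X 0 ω ∂P := by
  have hτ := isStoppingTime_gridHitting hX t y n
  have hA' : MeasurableSet[hτ.measurableSpace] A := by
    refine hτ.le_measurableSpace_of_const_le (i := 0) (fun ω => zero_le) _ ?_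
    change MeasurableSet[ℱ ((0 : ℕ) * (t / (n + 1)))] A
    rwa [Nat.cast_zero, zero_mul]
  rw [setIntegral_congr_ae (ℱ.le 0 A hA)
    ((gridHitting_stopped_ae_eq_condExp hX t y n).mono fun _ h _ => h),
    setIntegral_condExp hτ.measurableSpace_le (hX.integrable t) hA',
    hX.setIntegral_eq zero_le hA]

open Classical in
lemma tendsto_gridHitting_stopped (hnonneg : ∀ u ω, 0 ≤ X u ω)
    (hcont : ∀ ω, Continuous fun u => X u ω) (t : ℝ≥0) (y : ℝ) (ω : Ω) :
    Tendsto (fun n : ℕ => X (gridHitting X t y n ω * (t / (n + 1))) ω) atTop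
      (nhds (if X 0 ω ≤ y then (if y < runningMax X t ω then y else X t ω) else X 0 ω)) := by
  have hend : ∀ n : ℕ, ((n + 1 : ℕ) : ℝ≥0) * (t / (n + 1)) = t := fun n => by
    push_cast
    field_simp
  have hgrid : ∀ (n i : ℕ), i ≤ n + 1 → (i : ℝ≥0) * (t / (n + 1)) ≤ t := fun n i hi =>
    (hend n).le.trans' (by gcongr)
  split_ifs with h0 hy
  · have huc : ∀ ε > 0, ∀ᶠ n : ℕ in atTop, ∀ u ≤ t, ∀ v ≤ t, dist u v ≤ t / (n + 1) →
        dist (X u ω) (X v ω) < ε := by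
      intro ε hε
      obtain ⟨δ, hδ, H⟩ := Metric.uniformContinuousOn_iff.1
        ((isCompact_Icc (a := (0 : ℝ≥0)) (b := t)).uniformContinuousOn_of_continuous
          (hcont ω).continuousOn) ε hε
      have hlim : Tendsto (fun n : ℕ => (t : ℝ) / ((n : ℝ) + 1)) atTop (nhds 0) :=
        tendsto_const_div_atTop_nhds_zero_nat (t : ℝ) |>.comp (tendsto_add_atTop_nat 1) |>.congr
          fun n => by simp
      filter_upwards [hlim.eventually_lt_const hδ] with n hn u hu v hv huv
      exact H u ⟨zero_le, hu⟩ v ⟨zero_le, hv⟩ (huv.trans_lt hn)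
    obtain ⟨u, hu, hyu⟩ := (lt_runningMax_iff (hnonneg · ω) (hcont ω)).1 hy
    have htpos : 0 < t := by
      rcases eq_or_ne t 0 with rfl | h
      · rw [nonpos_iff_eq_zero.1 hu] at hyu
        exact absurd hyu h0.not_gt
      · exact pos_iff_ne_zero.2 h
    rw [Metric.tendsto_nhds]
    intro ε hε
    filter_upwards [huc ε hε, huc (X u ω - y) (sub_pos.2 hyu)] with n hn hn'
    have hh : 0 < t / ((n : ℝ≥0) + 1) := by positivity
    have hex : ∃ j ∈ Set.Icc 0 (n + 1), X ((j : ℝ≥0) * (t / (n + 1))) ω ∈ Ioi y := by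
      have hfl : (⌊u / (t / (n + 1))⌋₊ : ℝ≥0) * (t / (n + 1)) ≤ u :=
        (le_div_iff₀ hh).1 (Nat.floor_le zero_le)
      have hfl' : u ≤ (⌊u / (t / (n + 1))⌋₊ : ℝ≥0) * (t / (n + 1)) + t / (n + 1) := by
        have := (div_lt_iff₀ hh).1 (Nat.lt_floor_add_one (u / (t / (n + 1))))
        rw [add_mul, one_mul] at this
        exact this.le
      refine ⟨⌊u / (t / (n + 1))⌋₊, ⟨zero_le, ?_⟩, ?_⟩
      · have : (⌊u / (t / (n + 1))⌋₊ : ℝ≥0) * (t / (n + 1)) ≤ (n + 1 : ℕ) * (t / (n + 1)) :=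
          (hfl.trans hu).trans (hend n).ge
        exact_mod_cast le_of_mul_le_mul_right this hh
      · have hd := hn' u hu _ (hfl.trans hu) (by
          rw [NNReal.dist_eq, abs_of_nonneg (sub_nonneg.2 (by exact_mod_cast hfl))]
          rw [sub_le_iff_le_add']
          exact_mod_cast hfl')
        rw [Real.dist_eq] at hd
        have := (abs_lt.1 hd).2
        simp only [mem_Ioi]
        linarith
    have hmem : y < X (gridHitting X t y n ω * (t / (n + 1))) ω :=
      hittingBtwn_mem_set (u := fun (i : ℕ) => X (i * (t / (n + 1)))) hex
    have hle : gridHitting X t y n ω ≤ n + 1 := hittingBtwn_le ω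
    obtain ⟨k, hk⟩ : ∃ k, gridHitting X t y n ω = k + 1 := by
      refine Nat.exists_eq_succ_of_ne_zero fun h => ?_
      rw [h] at hmem
      simp only [Nat.cast_zero, zero_mul] at hmem
      exact absurd hmem h0.not_gt
    have hk' : X (k * (t / (n + 1))) ω ≤ y := by
      have := notMem_of_lt_hittingBtwn (u := fun (i : ℕ) => X (i * (t / (n + 1))))
        (s := Ioi y) (n := 0) (m := n + 1) (ω := ω) (k := k)
        (show k < gridHitting X t y n ω by omega) zero_le
      simpa using this
    rw [hk] at hmem hle ⊢
    have hd := hn _ (hgrid n (k + 1) hle) _ (hgrid n k (by omega)) (by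
      rw [NNReal.dist_eq]
      push_cast
      rw [add_mul, one_mul, add_sub_cancel_left, abs_of_nonneg (by positivity)])
    rw [Real.dist_eq] at hd ⊢
    have := (abs_lt.1 hd).2
    rw [abs_of_pos (by linarith)]
    linarith
  · refine tendsto_const_nhds.congr fun n => ?_
    have : gridHitting X t y n ω = n + 1 := by
      refine if_neg ?_
      rintro ⟨j, hj, hj'⟩
      exact hy (lt_of_lt_of_le hj' (le_runningMax (hcont ω) (hgrid n j hj.2)))
    rw [this, hend]
  · refine tendsto_const_nhds.congr fun n => ?_
    have : gridHitting X t y n ω = 0 :=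
      Nat.le_zero.1 (hittingBtwn_le_of_mem le_rfl zero_le (by simpa using h0))
    rw [this]
    simp

open Classical in
/-- Optional stopping for a nonnegative continuous martingale at the first time it exceeds a level
above its starting point. -/
theorem setIntegral_ite_lt_runningMax [IsFiniteMeasure P] (hX : Martingale X ℱ P)
    (hnonneg : ∀ u ω, 0 ≤ X u ω) (hcont : ∀ ω, Continuous fun u => X u ω) (t : ℝ≥0) {y : ℝ}
    {A : Set Ω} (hA : MeasurableSet[ℱ 0] A) (hAy : ∀ ω ∈ A, X 0 ω ≤ y) :
    ∫ ω in A, (if y < runningMax X t ω then y else X t ω) ∂P = ∫ ω in A, X 0 ω ∂P := by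
  set g : Ω → ℝ := fun ω =>
    if X 0 ω ≤ y then (if y < runningMax X t ω then y else X t ω) else X 0 ω with hg
  have hmX : ∀ u, Measurable (X u) := fun u => ((hX.1 u).mono (ℱ.le u)).measurable
  have hmS : Measurable (runningMax X t) :=
    (measurable_runningMax ℱ hX.1 hnonneg hcont t).mono (ℱ.le t) le_rfl
  have hgm : Measurable g :=
    Measurable.ite (measurableSet_le (hmX 0) measurable_const)
      (Measurable.ite (measurableSet_lt measurable_const hmS) measurable_const (hmX t)) (hmX 0)
  have hgi : Integrable g P := by
    refine (((integrable_const |y|).add (hX.integrable t)).add (hX.integrable 0)).mono'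
      hgm.aestronglyMeasurable (ae_of_all _ fun ω => ?_)
    have h1 := hnonneg t ω
    have h2 := hnonneg 0 ω
    have h3 := abs_nonneg y
    simp only [hg, Pi.add_apply, Real.norm_eq_abs]
    split_ifs
    · linarith
    · rw [abs_of_nonneg h1]; linarith
    · rw [abs_of_nonneg h2]; linarith
  have hui : UnifIntegrable
      (fun (n : ℕ) ω => X (gridHitting X t y n ω * (t / (n + 1))) ω) 1 P :=
    ((hX.integrable t).uniformIntegrable_condExp
      (fun n => (isStoppingTime_gridHitting hX t y n).measurableSpace_le)).2.1.ae_eq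
      fun n => (gridHitting_stopped_ae_eq_condExp hX t y n).symm
  have hint : ∀ n : ℕ, Integrable (fun ω => X (gridHitting X t y n ω * (t / (n + 1))) ω) P :=
    fun n => integrable_condExp.congr (gridHitting_stopped_ae_eq_condExp hX t y n).symm
  have hL1 := tendsto_Lp_finite_of_tendsto_ae le_rfl ENNReal.one_ne_top
    (fun n => (hint n).aestronglyMeasurable) (memLp_one_iff_integrable.2 hgi) hui
    (ae_of_all _ fun ω => tendsto_gridHitting_stopped hnonneg hcont t y ω)
  have hlim := tendsto_setIntegral_of_L1' g hgi.aestronglyMeasurable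
    (Eventually.of_forall hint) hL1 A
  simp only [setIntegral_gridHitting_stopped hX t y _ hA] at hlim
  rw [tendsto_nhds_unique tendsto_const_nhds hlim]
  exact setIntegral_congr_fun (ℱ.le 0 A hA) fun ω hω => by simp [hg, hAy ω hω]

end MaximalIdentity

section Doob

variable {Ω : Type*} {m : MeasurableSpace Ω} {P : Measure Ω} {ℱ : Filtration ℝ≥0 m}
  {X : ℝ≥0 → Ω → ℝ}

lemma measurableSet_exists_lt (hX : StronglyAdapted ℱ X) (hcont : ∀ ω, Continuous fun u => X u ω)
    (y : ℝ) : MeasurableSet {ω | ∃ u, y < X u ω} := by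
  have : {ω | ∃ u, y < X u ω} = ⋃ k : ℕ, X (TopologicalSpace.denseSeq ℝ≥0 k) ⁻¹' Ioi y := by
    ext ω
    simp only [mem_ofPred_eq, mem_iUnion, mem_preimage, mem_Ioi]
    constructor
    · rintro ⟨u, h⟩
      obtain ⟨_, hv, k, rfl⟩ := (TopologicalSpace.denseRange_denseSeq ℝ≥0).inter_open_nonempty _
        (isOpen_lt continuous_const (hcont ω)) ⟨u, h⟩
      exact ⟨k, hv⟩
    · rintro ⟨k, h⟩
      exact ⟨_, h⟩
  rw [this]
  exact MeasurableSet.iUnion fun k => ((hX _).mono (ℱ.le _)).measurable measurableSet_Ioi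

open Classical in
/-- **Doob's maximal identity** for a nonnegative continuous martingale vanishing at infinity. -/
theorem setIntegral_ite_exists_lt [IsFiniteMeasure P] (hX : Martingale X ℱ P)
    (hnonneg : ∀ u ω, 0 ≤ X u ω) (hcont : ∀ ω, Continuous fun u => X u ω)
    (hlim : ∀ᵐ ω ∂P, Tendsto (fun t => X t ω) atTop (nhds (0 : ℝ))) {y : ℝ} (hy : 0 ≤ y)
    {A : Set Ω} (hA : MeasurableSet[ℱ 0] A) (hAy : ∀ ω ∈ A, X 0 ω ≤ y) :
    ∫ ω in A, (if ∃ u, y < X u ω then y else 0) ∂P = ∫ ω in A, X 0 ω ∂P := by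
  have hmX : ∀ u, Measurable (X u) := fun u => ((hX.1 u).mono (ℱ.le u)).measurable
  have hmS : ∀ t, Measurable (runningMax X t) := fun t =>
    (measurable_runningMax ℱ hX.1 hnonneg hcont t).mono (ℱ.le t) le_rfl
  have hdom := tendsto_integral_of_dominated_convergence (μ := P.restrict A)
    (F := fun (n : ℕ) ω => if y < runningMax X n ω then y else X n ω)
    (f := fun ω => if ∃ u, y < X u ω then y else 0) (fun _ => y)
    (fun n => (Measurable.ite (measurableSet_lt measurable_const (hmS n)) measurable_const
      (hmX n)).aestronglyMeasurable) (integrable_const y)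
    (fun n => ae_of_all _ fun ω => by
      split_ifs with h
      · rw [Real.norm_eq_abs, abs_of_nonneg hy]
      · rw [Real.norm_eq_abs, abs_of_nonneg (hnonneg _ _)]
        exact (le_runningMax (hcont ω) le_rfl).trans (not_lt.1 h))
    (by
      filter_upwards [ae_restrict_of_ae hlim] with ω hω
      split_ifs with h
      · obtain ⟨u, hu⟩ := h
        obtain ⟨k, hk⟩ := exists_nat_ge u
        refine tendsto_const_nhds.congr' ?_
        filter_upwards [eventually_ge_atTop k] with n hn
        rw [if_pos]
        exact (lt_runningMax_iff (hnonneg · ω) (hcont ω)).2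
          ⟨u, hk.trans (by exact_mod_cast hn), hu⟩
      · refine (hω.comp (tendsto_natCast_atTop_atTop (R := ℝ≥0))).congr fun n => ?_
        rw [if_neg]
        · rfl
        · rw [lt_runningMax_iff (hnonneg · ω) (hcont ω)]
          exact fun ⟨u, _, hu⟩ => h ⟨u, hu⟩)
  simp only [setIntegral_ite_lt_runningMax hX hnonneg hcont _ hA hAy] at hdom
  exact tendsto_nhds_unique hdom tendsto_const_nhds

end Doob

section Shift

variable {Ω : Type*} {m : MeasurableSpace Ω} {P : Measure Ω} {ℱ : Filtration ℝ≥0 m}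
  {M : ℝ≥0 → Ω → ℝ}

/-- The filtration `ℱ` started at time `s`. -/
def shiftFiltration (ℱ : Filtration ℝ≥0 m) (s : ℝ≥0) : Filtration ℝ≥0 m where
  seq u := ℱ (s + u)
  mono' u v huv := ℱ.mono (by gcongr)
  le' u := ℱ.le _

lemma shiftFiltration_zero (ℱ : Filtration ℝ≥0 m) (s : ℝ≥0) : shiftFiltration ℱ s 0 = ℱ s := by
  change ℱ (s + 0) = ℱ s
  rw [add_zero]

lemma martingale_shift (hM : Martingale M ℱ P) (s : ℝ≥0) :
    Martingale (fun u => M (s + u)) (shiftFiltration ℱ s) P :=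
  ⟨fun _ => hM.1 _, fun u v huv => hM.2 _ _ (by gcongr)⟩

lemma martingale_shift_mul [IsFiniteMeasure P] (hM : Martingale M ℱ P) (s : ℝ≥0) {g : Ω → ℝ}
    (hg : Measurable[ℱ s] g) {C : ℝ} (hgC : ∀ ω, |g ω| ≤ C) :
    Martingale (fun u ω => M (s + u) ω * g ω) (shiftFiltration ℱ s) P := by
  have hgu : ∀ u, StronglyMeasurable[ℱ (s + u)] g := fun u =>
    (hg.stronglyMeasurable).mono (ℱ.mono le_self_add)
  refine ⟨fun u => (hM.1 _).mul (hgu u), fun u v huv => ?_⟩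
  have hint : Integrable (M (s + v) * g) P :=
    (hM.integrable _).mul_bdd (c := C) ((hgu 0).mono (ℱ.le _)).aestronglyMeasurable (ae_of_all _ hgC)
  have h1 := condExp_mul_of_stronglyMeasurable_right (hgu u) hint (hM.integrable _)
  have h2 := hM.2 (s + u) (s + v) (by gcongr)
  exact h1.trans (h2.mul EventuallyEq.rfl)

lemma lt_runningMax_shift_iff {ω : Ω} (hnonneg : ∀ u, 0 ≤ M u ω)
    (hcont : Continuous fun u => M u ω) {s t : ℝ≥0} (hst : s ≤ t) {y : ℝ}
    (hy : runningMax M s ω ≤ y) :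
    y < runningMax (fun u => M (s + u)) (t - s) ω ↔ y < runningMax M t ω := by
  rw [lt_runningMax_iff hnonneg hcont, lt_runningMax_iff (fun u => hnonneg (s + u))
    (hcont.comp (continuous_const.add continuous_id))]
  constructor
  · rintro ⟨u, hu, h⟩
    exact ⟨s + u, (le_tsub_iff_left hst).1 hu, h⟩
  · rintro ⟨u, hu, h⟩
    have hsu : s ≤ u := by
      by_contra! hus
      exact absurd (le_runningMax hcont hus.le) (not_le.2 (hy.trans_lt h))
    exact ⟨u - s, tsub_le_tsub_right hu s, by rwa [add_tsub_cancel_of_le hsu]⟩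

open Classical in
lemma setIntegral_ite_lt_runningMax_of_le [IsFiniteMeasure P] (hM : Martingale M ℱ P)
    (hnonneg : ∀ u ω, 0 ≤ M u ω) (hcont : ∀ ω, Continuous fun u => M u ω) {s t : ℝ≥0}
    (hst : s ≤ t) {y : ℝ} {A : Set Ω} (hA : MeasurableSet[ℱ s] A)
    (hAy : ∀ ω ∈ A, runningMax M s ω ≤ y) :
    ∫ ω in A, (if y < runningMax M t ω then y else M t ω) ∂P = ∫ ω in A, M s ω ∂P := by
  have h := setIntegral_ite_lt_runningMax (martingale_shift hM s) (fun u ω => hnonneg (s + u) ω)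
    (fun ω => (hcont ω).comp (continuous_const.add continuous_id)) (t - s) (y := y) (A := A)
    (by rwa [shiftFiltration_zero])
    (fun ω hω => (le_runningMax (hcont ω) (by simp)).trans (hAy ω hω))
  simp only [add_zero] at h
  rw [← h]
  refine setIntegral_congr_fun (ℱ.le s A hA) fun ω hω => ?_
  simp only [lt_runningMax_shift_iff (hnonneg · ω) (hcont ω) hst (hAy ω hω),
    add_tsub_cancel_of_le hst]

open Classical in
/-- The conditional probability, given the information at time `s`, that the running maximum still
increases after time `s` is the ratio of the martingale to its running maximum. -/
lemma setIntegral_ite_exists_runningMax_lt [IsFiniteMeasure P] (hM : Martingale M ℱ P)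
    (hnonneg : ∀ u ω, 0 ≤ M u ω) (hcont : ∀ ω, Continuous fun u => M u ω)
    (hM0 : ∀ᵐ ω ∂P, M 0 ω = 1)
    (hlim : ∀ᵐ ω ∂P, Tendsto (fun t => M t ω) atTop (nhds (0 : ℝ))) (s : ℝ≥0)
    {A : Set Ω} (hA : MeasurableSet[ℱ s] A) :
    ∫ ω in A, (if ∃ u, runningMax M s ω < M u ω then (1 : ℝ) else 0) ∂P
      = ∫ ω in A, M s ω / runningMax M s ω ∂P := by
  have hS := measurable_runningMax ℱ hM.1 hnonneg hcont s
  set g : Ω → ℝ := fun ω => (max (runningMax M s ω) 1)⁻¹ with hg_def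
  have hpos : ∀ ω, 0 < max (runningMax M s ω) 1 := fun ω => lt_max_of_lt_right one_pos
  have hg : Measurable[ℱ s] g := (hS.max measurable_const).inv
  have hg0 : ∀ ω, 0 ≤ g ω := fun ω => (inv_pos.2 (hpos ω)).le
  have hg1 : ∀ ω, |g ω| ≤ 1 := fun ω => by
    rw [abs_of_nonneg (hg0 ω)]
    exact inv_le_one_of_one_le₀ (le_max_right _ _)
  have h := setIntegral_ite_exists_lt (martingale_shift_mul hM s hg hg1)
    (fun u ω => mul_nonneg (hnonneg _ _) (hg0 ω))
    (fun ω => ((hcont ω).comp (continuous_const.add continuous_id)).mul continuous_const)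
    (by
      filter_upwards [hlim] with ω hω
      simpa using (hω.comp (tendsto_atTop_mono (fun u => le_add_self (a := u) (b := s))
        tendsto_id)).mul_const (g ω))
    zero_le_one (A := A) (by rwa [shiftFiltration_zero])
    (fun ω _ => by
      rw [hg_def, ← div_eq_mul_inv, div_le_one (hpos ω)]
      exact (le_runningMax (hcont ω) (by simp)).trans (le_max_left _ _))
  have hmax : ∀ᵐ ω ∂P, g ω = (runningMax M s ω)⁻¹ := by
    filter_upwards [hM0] with ω h0
    rw [hg_def]
    dsimp only
    rw [max_eq_left]
    exact h0 ▸ le_runningMax (hcont ω) zero_le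
  simp only [add_zero] at h
  refine (setIntegral_congr_ae (ℱ.le s A hA) ?_).trans
    (h.trans (setIntegral_congr_ae (ℱ.le s A hA) ?_))
  · filter_upwards [hM0, hmax] with ω h0 hω _
    have hSpos : 0 < runningMax M s ω :=
      one_pos.trans_le (h0 ▸ le_runningMax (hcont ω) zero_le)
    refine if_congr ?_ rfl rfl
    rw [hω]
    simp only [← div_eq_mul_inv, one_lt_div hSpos]
    constructor
    · rintro ⟨u, hu⟩
      have hsu : s ≤ u := by
        by_contra! hus
        exact absurd (le_runningMax (hcont ω) hus.le) (not_le.2 hu)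
      exact ⟨u - s, by rwa [add_tsub_cancel_of_le hsu]⟩
    · rintro ⟨u, hu⟩
      exact ⟨s + u, hu⟩
  · filter_upwards [hmax] with ω hω _
    rw [hω, div_eq_mul_inv]

end Shift

section LogRunningMax

open Classical in
/-- The value `y` or `c` of a process stopped upon exceeding the level `y`, weighted by `y⁻²`, for
levels `y` above `a`; `b` is the running maximum and `c` the terminal value. -/
noncomputable def levelWeight (a b c y : ℝ) : ℝ :=
  if a ≤ y then (if y < b then y else c) * (y ^ 2)⁻¹ else 0

lemma levelWeight_nonneg {a b c y : ℝ} (ha : 0 ≤ a) (hc : 0 ≤ c) : 0 ≤ levelWeight a b c y := by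
  unfold levelWeight
  split_ifs with h1 h2
  · have := ha.trans h1
    positivity
  · positivity
  · exact le_rfl

lemma measurable_levelWeight {α : Type*} [MeasurableSpace α] {a b c y : α → ℝ}
    (ha : Measurable a) (hb : Measurable b) (hc : Measurable c) (hy : Measurable y) :
    Measurable fun x => levelWeight (a x) (b x) (c x) (y x) :=
  Measurable.ite (measurableSet_le ha hy)
    ((Measurable.ite (measurableSet_lt hy hb) hy hc).mul (hy.pow_const 2).inv) measurable_const

lemma lintegral_levelWeight {a b c : ℝ} (ha : 0 < a) (hab : a ≤ b) (hc : 0 ≤ c) :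
    ∫⁻ y, ENNReal.ofReal (levelWeight a b c y)
      = ENNReal.ofReal (Real.log b - Real.log a + c / b) := by
  have hb : 0 < b := ha.trans_le hab
  have hsplit : ∀ y, ENNReal.ofReal (levelWeight a b c y)
      = (Ico a b).indicator (fun y => ENNReal.ofReal y⁻¹) y
        + (Ici b).indicator (fun y => ENNReal.ofReal (c * y ^ (-2 : ℝ))) y := by
    intro y
    unfold levelWeight
    by_cases h1 : a ≤ y
    · have hy : 0 < y := ha.trans_le h1
      by_cases h2 : y < b
      · have : y * (y ^ 2)⁻¹ = y⁻¹ := by field_simp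
        simp [h1, h2, this]
      · simp [h1, h2, not_lt.1 h2]
    · have : ¬ b ≤ y := fun h => h1 (hab.trans h)
      simp [h1, this]
  have hlog : ∫⁻ y in Ico a b, ENNReal.ofReal y⁻¹ = ENNReal.ofReal (Real.log b - Real.log a) := by
    rw [← ofReal_integral_eq_lintegral_ofReal, integral_Ico_eq_integral_Ioc,
      ← intervalIntegral.integral_of_le hab, integral_inv_of_pos ha hb,
      Real.log_div hb.ne' ha.ne']
    · exact ((continuousOn_inv₀.mono fun y hy => (ha.trans_le hy.1).ne').integrableOn_Icc).mono_set
        Ico_subset_Icc_self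
    · exact (ae_restrict_mem measurableSet_Ico).mono fun y hy =>
        inv_nonneg.2 (ha.le.trans hy.1)
  have htail : ∫⁻ y in Ici b, ENNReal.ofReal (c * y ^ (-2 : ℝ)) = ENNReal.ofReal (c / b) := by
    rw [← ofReal_integral_eq_lintegral_ofReal, integral_Ici_eq_integral_Ioi, integral_const_mul,
      integral_Ioi_rpow_of_lt (by norm_num) hb]
    · have : b ^ ((-2 : ℝ) + 1) = b⁻¹ := by
        rw [← Real.rpow_neg_one]
        norm_num
      rw [this]
      congr 1
      ring
    · exact (Iff.mpr integrableOn_Ici_iff_integrableOn_Ioi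
        (integrableOn_Ioi_rpow_of_lt (by norm_num) hb)).const_mul c
    · exact (ae_restrict_mem measurableSet_Ici).mono fun y hy =>
        mul_nonneg hc (Real.rpow_nonneg (hb.le.trans hy) _)
  simp only [hsplit]
  rw [lintegral_add_left (Measurable.indicator (by fun_prop) measurableSet_Ico),
    lintegral_indicator measurableSet_Ico, lintegral_indicator measurableSet_Ici, hlog, htail,
    ← ENNReal.ofReal_add (sub_nonneg.2 (Real.log_le_log ha hab)) (by positivity)]

variable {Ω : Type*} {m : MeasurableSpace Ω} {P : Measure Ω} {ℱ : Filtration ℝ≥0 m}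
  {M : ℝ≥0 → Ω → ℝ}

lemma one_le_runningMax {ω : Ω} (hcont : Continuous fun u => M u ω) (h0 : M 0 ω = 1) (t : ℝ≥0) :
    1 ≤ runningMax M t ω :=
  h0 ▸ le_runningMax hcont zero_le

lemma lintegral_levelWeight_runningMax [IsFiniteMeasure P] (hM : Martingale M ℱ P)
    (hnonneg : ∀ u ω, 0 ≤ M u ω) (hcont : ∀ ω, Continuous fun u => M u ω) {s t : ℝ≥0}
    (hst : s ≤ t) {A : Set Ω} (hA : MeasurableSet[ℱ s] A) (y : ℝ) :
    ∫⁻ ω in A, ENNReal.ofReal (levelWeight (runningMax M s ω) (runningMax M t ω) (M t ω) y) ∂P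
      = ∫⁻ ω in A, ENNReal.ofReal
          (levelWeight (runningMax M s ω) (runningMax M s ω) (M s ω) y) ∂P := by
  classical
  have hS : ∀ u, Measurable (runningMax M u) := fun u =>
    (measurable_runningMax ℱ hM.1 hnonneg hcont u).mono (ℱ.le u) le_rfl
  have hmM : ∀ u, Measurable (M u) := fun u => ((hM.1 u).mono (ℱ.le u)).measurable
  have hS0 : ∀ u ω, 0 ≤ runningMax M u ω := fun u ω =>
    (hnonneg 0 ω).trans (le_runningMax (hcont ω) zero_le)
  have hB : MeasurableSet[ℱ s] {ω | runningMax M s ω ≤ y} :=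
    measurable_runningMax ℱ hM.1 hnonneg hcont s measurableSet_Iic
  have hint : ∀ u, Integrable (fun ω => if y < runningMax M u ω then y else M u ω) P := by
    intro u
    refine ((integrable_const |y|).add (hM.integrable u)).mono'
      (Measurable.ite (measurableSet_lt measurable_const (hS u)) measurable_const
        (hmM u)).aestronglyMeasurable (ae_of_all _ fun ω => ?_)
    have h1 := hnonneg u ω
    have h2 := abs_nonneg y
    simp only [Pi.add_apply, Real.norm_eq_abs]
    split_ifs
    · linarith
    · rw [abs_of_nonneg h1]; linarith
  have hind : ∀ u, (fun ω => levelWeight (runningMax M s ω) (runningMax M u ω) (M u ω) y)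
      = {ω | runningMax M s ω ≤ y}.indicator
          (fun ω => (if y < runningMax M u ω then y else M u ω) * (y ^ 2)⁻¹) := by
    intro u
    ext ω
    simp only [levelWeight, indicator, mem_ofPred_eq]
  have hreal : ∀ u, s ≤ u →
      ∫⁻ ω in A, ENNReal.ofReal (levelWeight (runningMax M s ω) (runningMax M u ω) (M u ω) y) ∂P
        = ENNReal.ofReal ((∫ ω in A ∩ {ω | runningMax M s ω ≤ y}, M s ω ∂P) * (y ^ 2)⁻¹) := by
    intro u hsu
    rw [← ofReal_integral_eq_lintegral_ofReal, hind, setIntegral_indicator (ℱ.le s _ hB),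
      integral_mul_const, setIntegral_ite_lt_runningMax_of_le hM hnonneg hcont hsu (hA.inter hB)
        fun ω hω => hω.2]
    · rw [hind]
      exact (((hint u).mul_const _).indicator (ℱ.le s _ hB)).integrableOn
    · exact ae_of_all _ fun ω => levelWeight_nonneg (hS0 s ω) (hnonneg u ω)
  rw [hreal t hst, hreal s le_rfl]

lemma lintegral_log_runningMax [IsFiniteMeasure P] (hM : Martingale M ℱ P)
    (hnonneg : ∀ u ω, 0 ≤ M u ω) (hcont : ∀ ω, Continuous fun u => M u ω)
    (hM0 : ∀ᵐ ω ∂P, M 0 ω = 1) {s t : ℝ≥0} (hst : s ≤ t) {A : Set Ω}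
    (hA : MeasurableSet[ℱ s] A) :
    ∫⁻ ω in A, ENNReal.ofReal (Real.log (runningMax M t ω) - Real.log (runningMax M s ω)
        + M t ω / runningMax M t ω) ∂P
      = ∫⁻ ω in A, ENNReal.ofReal (M s ω / runningMax M s ω) ∂P := by
  have hS : ∀ u, Measurable (runningMax M u) := fun u =>
    (measurable_runningMax ℱ hM.1 hnonneg hcont u).mono (ℱ.le u) le_rfl
  have hmM : ∀ u, Measurable (M u) := fun u => ((hM.1 u).mono (ℱ.le u)).measurable
  have hswap : ∀ u, s ≤ u →
      ∫⁻ ω in A, ENNReal.ofReal (Real.log (runningMax M u ω) - Real.log (runningMax M s ω)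
        + M u ω / runningMax M u ω) ∂P
      = ∫⁻ y, ∫⁻ ω in A, ENNReal.ofReal
          (levelWeight (runningMax M s ω) (runningMax M u ω) (M u ω) y) ∂P := by
    intro u hsu
    rw [← lintegral_lintegral_swap]
    · refine setLIntegral_congr_fun_ae (ℱ.le s A hA) ?_
      filter_upwards [hM0] with ω h0 _
      exact (lintegral_levelWeight (one_pos.trans_le (one_le_runningMax (hcont ω) h0 s))
        (runningMax_mono (hnonneg · ω) (hcont ω) hsu) (hnonneg u ω)).symm
    · exact (measurable_levelWeight ((hS s).comp measurable_fst) ((hS u).comp measurable_fst)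
        ((hmM u).comp measurable_fst) measurable_snd).ennreal_ofReal.aemeasurable
  rw [hswap t hst]
  simp only [lintegral_levelWeight_runningMax hM hnonneg hcont hst hA]
  rw [← hswap s le_rfl]
  simp

lemma integrable_div_runningMax [IsFiniteMeasure P] (hM : Martingale M ℱ P)
    (hnonneg : ∀ u ω, 0 ≤ M u ω) (hcont : ∀ ω, Continuous fun u => M u ω) (t : ℝ≥0) :
    Integrable (fun ω => M t ω / runningMax M t ω) P := by
  have hS : Measurable (runningMax M t) :=
    (measurable_runningMax ℱ hM.1 hnonneg hcont t).mono (ℱ.le t) le_rfl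
  refine (integrable_const (1 : ℝ)).mono'
    (((hM.1 t).mono (ℱ.le t)).measurable.div hS).aestronglyMeasurable (ae_of_all _ fun ω => ?_)
  have hle := le_runningMax (hcont ω) (le_refl t)
  rw [Real.norm_eq_abs, abs_of_nonneg (div_nonneg (hnonneg t ω) ((hnonneg t ω).trans hle))]
  exact div_le_one_of_le₀ hle ((hnonneg t ω).trans hle)

/-- Increments of the logarithm of the running maximum are integrable. -/
lemma integrable_log_runningMax_sub [IsFiniteMeasure P] (hM : Martingale M ℱ P)
    (hnonneg : ∀ u ω, 0 ≤ M u ω) (hcont : ∀ ω, Continuous fun u => M u ω)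
    (hM0 : ∀ᵐ ω ∂P, M 0 ω = 1) {s t : ℝ≥0} (hst : s ≤ t) :
    Integrable (fun ω => Real.log (runningMax M t ω) - Real.log (runningMax M s ω)) P := by
  have hS : ∀ u, Measurable (runningMax M u) := fun u =>
    (measurable_runningMax ℱ hM.1 hnonneg hcont u).mono (ℱ.le u) le_rfl
  refine ⟨((hS t).log.sub (hS s).log).aestronglyMeasurable, ?_⟩
  have h := lintegral_log_runningMax hM hnonneg hcont hM0 hst MeasurableSet.univ
  simp only [Measure.restrict_univ] at h
  have hfin := (integrable_div_runningMax hM hnonneg hcont s).lintegral_lt_top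
  rw [← h] at hfin
  refine lt_of_le_of_lt (lintegral_mono_ae ?_) hfin
  filter_upwards [hM0] with ω h0
  have h1 := one_le_runningMax (hcont ω) h0 s
  have h2 := runningMax_mono (hnonneg · ω) (hcont ω) hst
  have h3 := Real.log_le_log (one_pos.trans_le h1) h2
  have h4 : 0 ≤ M t ω / runningMax M t ω :=
    div_nonneg (hnonneg t ω) ((zero_le_one.trans h1).trans h2)
  rw [Real.enorm_eq_ofReal (sub_nonneg.2 h3)]
  exact ENNReal.ofReal_le_ofReal (by linarith)

/-- The process `log M* + M / M*` has constant integrals over past events. -/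
lemma setIntegral_log_runningMax_sub [IsFiniteMeasure P] (hM : Martingale M ℱ P)
    (hnonneg : ∀ u ω, 0 ≤ M u ω) (hcont : ∀ ω, Continuous fun u => M u ω)
    (hM0 : ∀ᵐ ω ∂P, M 0 ω = 1) {s t : ℝ≥0} (hst : s ≤ t) {A : Set Ω}
    (hA : MeasurableSet[ℱ s] A) :
    ∫ ω in A, (Real.log (runningMax M t ω) - Real.log (runningMax M s ω)) ∂P
      = ∫ ω in A, M s ω / runningMax M s ω ∂P - ∫ ω in A, M t ω / runningMax M t ω ∂P := by
  have hlog := integrable_log_runningMax_sub hM hnonneg hcont hM0 hst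
  have hdiv := fun u => integrable_div_runningMax hM hnonneg hcont u
  have hdiv0 : ∀ u ω, 0 ≤ M u ω / runningMax M u ω := fun u ω =>
    div_nonneg (hnonneg u ω) ((hnonneg u ω).trans (le_runningMax (hcont ω) le_rfl))
  rw [eq_sub_iff_add_eq, ← integral_add hlog.integrableOn (hdiv t).integrableOn,
    integral_eq_lintegral_of_nonneg_ae ?_
      (f := fun ω => Real.log (runningMax M t ω) - Real.log (runningMax M s ω)
        + M t ω / runningMax M t ω) (hlog.add (hdiv t)).integrableOn.aestronglyMeasurable,
    integral_eq_lintegral_of_nonneg_ae (ae_of_all _ (hdiv0 s))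
      (hdiv s).integrableOn.aestronglyMeasurable,
    lintegral_log_runningMax hM hnonneg hcont hM0 hst hA]
  refine ae_restrict_of_ae ?_
  filter_upwards [hM0] with ω h0
  have h1 := one_le_runningMax (hcont ω) h0 s
  have h2 := Real.log_le_log (one_pos.trans_le h1)
    (runningMax_mono (hnonneg · ω) (hcont ω) hst)
  exact add_nonneg (sub_nonneg.2 h2) (hdiv0 t ω)

end LogRunningMax

lemma exists_forall_le_of_tendsto_zero {x : ℝ≥0 → ℝ} (hcont : Continuous x) (hx0 : 0 < x 0)
    (hlim : Tendsto x atTop (nhds 0)) : ∃ u, ∀ v, x v ≤ x u :=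
  hcont.exists_forall_ge' 0 (by rw [cocompact_eq_atTop]; exact hlim.eventually_le_const hx0)

lemma lt_sInf_argmax_iff {Ω : Type*} {M : ℝ≥0 → Ω → ℝ} {ω : Ω} (hnonneg : ∀ u, 0 ≤ M u ω)
    (hcont : Continuous fun u => M u ω) (h0 : M 0 ω = 1)
    (hlim : Tendsto (fun t => M t ω) atTop (nhds (0 : ℝ))) (s : ℝ≥0) :
    s < sInf {u : ℝ≥0 | M u ω = ⨆ v, M v ω} ↔ ∃ u, runningMax M s ω < M u ω := by
  obtain ⟨w, hw⟩ := exists_forall_le_of_tendsto_zero hcont (h0 ▸ one_pos) hlim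
  have hbdd : BddAbove (range fun v => M v ω) := ⟨M w ω, by rintro _ ⟨v, rfl⟩; exact hw v⟩
  have hclosed : IsClosed {u : ℝ≥0 | M u ω = ⨆ v, M v ω} := isClosed_eq hcont continuous_const
  have hmem : M (sInf {u : ℝ≥0 | M u ω = ⨆ v, M v ω}) ω = ⨆ v, M v ω :=
    hclosed.csInf_mem ⟨w, (le_ciSup hbdd w).antisymm (ciSup_le hw)⟩ (OrderBot.bddBelow _)
  rw [← not_iff_not]
  push Not
  constructor
  · intro h u
    exact (le_ciSup hbdd u).trans (hmem ▸ le_runningMax hcont h)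
  · intro h
    obtain ⟨v, hv, hv'⟩ := exists_eq_runningMax hnonneg hcont s
    have hmax : M v ω = ⨆ v, M v ω :=
      (le_ciSup hbdd v).antisymm (ciSup_le fun u => (h u).trans hv'.ge)
    exact (csInf_le (OrderBot.bddBelow {u : ℝ≥0 | M u ω = ⨆ v, M v ω}) hmax).trans hv

/-- Let `M` be a nonnegative continuous martingale with `M 0 = 1` a.s. and
`M t → 0` a.s. as `t → ∞`, and let `ρ := inf {t | M t = M*_∞}` be the (a.s. unique and a.s.
finite) time of the overall maximum of `M`. Then for all `0 ≤ s ≤ t`, almost surely,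
`P[s < ρ ≤ t | 𝓕_s] = E[log M*_t − log M*_s | 𝓕_s]`, i.e. the process `log M*` is the
optional compensator (dual optional projection) of `1_{[ρ, ∞)}`. -/
theorem log_running_max_is_compensator
    {Ω : Type*} {m : MeasurableSpace Ω} {P : Measure Ω} [IsProbabilityMeasure P]
    (ℱ : Filtration ℝ≥0 m) (M : ℝ≥0 → Ω → ℝ)
    (hMmart : Martingale M ℱ P)
    (hMnonneg : ∀ t ω, 0 ≤ M t ω)
    (hMcont : ∀ ω, Continuous fun t => M t ω)
    (hM0 : ∀ᵐ ω ∂P, M 0 ω = 1)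
    (hMlim : ∀ᵐ ω ∂P, Tendsto (fun t => M t ω) atTop (nhds (0 : ℝ)))
    (ρ : Ω → ℝ≥0) (hρ : ∀ ω, ρ ω = sInf {u : ℝ≥0 | M u ω = ⨆ v, M v ω}) :
    ∀ s t : ℝ≥0, s ≤ t →
      P[Set.indicator {ω | s < ρ ω ∧ ρ ω ≤ t} (fun _ => (1 : ℝ)) | ℱ s]
        =ᵐ[P]
      P[(fun ω =>
          Real.log (⨆ u ∈ Set.Icc 0 t, M u ω) - Real.log (⨆ u ∈ Set.Icc 0 s, M u ω)) |
          ℱ s] := by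
  intro s t hst
  classical
  let G : ℝ≥0 → Ω → ℝ := fun r ω => if ∃ u, runningMax M r ω < M u ω then 1 else 0
  have hGint : ∀ r, Integrable (G r) P := by
    intro r
    have hS : Measurable (runningMax M r) :=
      (measurable_runningMax ℱ hMmart.1 hMnonneg hMcont r).mono (ℱ.le r) le_rfl
    have hmeas : MeasurableSet {ω | ∃ u, runningMax M r ω < M u ω} := by
      have : {ω | ∃ u, runningMax M r ω < M u ω}
          = ⋃ n : ℕ, {ω | runningMax M r ω < runningMax M n ω} := by
        ext ω
        simp only [mem_ofPred_eq, mem_iUnion, lt_runningMax_iff (hMnonneg · ω) (hMcont ω)]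
        constructor
        · rintro ⟨u, hu⟩
          obtain ⟨n, hn⟩ := exists_nat_ge u
          exact ⟨n, u, hn, hu⟩
        · rintro ⟨_, u, _, hu⟩
          exact ⟨u, hu⟩
      rw [this]
      exact MeasurableSet.iUnion fun n => measurableSet_lt hS
        ((measurable_runningMax ℱ hMmart.1 hMnonneg hMcont n).mono (ℱ.le n) le_rfl)
    refine (integrable_const (1 : ℝ)).mono'
      (Measurable.ite hmeas measurable_const measurable_const).aestronglyMeasurable
      (ae_of_all _ fun ω => ?_)
    simp only [G]
    split_ifs <;> simp
  have hind : Set.indicator {ω | s < ρ ω ∧ ρ ω ≤ t} (fun _ => (1 : ℝ)) =ᵐ[P] G s - G t := by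
    filter_upwards [hM0, hMlim] with ω h0 hlim
    have hiff := lt_sInf_argmax_iff (hMnonneg · ω) (hMcont ω) h0 hlim
    simp only [← hρ] at hiff
    simp only [indicator, mem_ofPred_eq, Pi.sub_apply, G, ← hiff]
    by_cases h1 : s < ρ ω
    · by_cases h2 : t < ρ ω
      · simp [h1, h2]
      · simp [h1, h2, not_lt.1 h2]
    · have h2 : ¬ t < ρ ω := fun h => h1 (hst.trans_lt h)
      simp [h1, h2]
  refine (condExp_congr_ae hind).trans ?_
  refine ae_eq_condExp_of_forall_setIntegral_eq (ℱ.le s)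
    (integrable_log_runningMax_sub hMmart hMnonneg hMcont hM0 hst)
    (fun _ _ _ => integrable_condExp.integrableOn) (fun A hA _ => ?_)
    stronglyMeasurable_condExp.aestronglyMeasurable
  rw [setIntegral_condExp (ℱ.le s) ((hGint s).sub (hGint t)) hA]
  refine (integral_sub (hGint s).integrableOn (hGint t).integrableOn).trans ?_
  rw [setIntegral_ite_exists_runningMax_lt hMmart hMnonneg hMcont hM0 hMlim s hA,
    setIntegral_ite_exists_runningMax_lt hMmart hMnonneg hMcont hM0 hMlim t (ℱ.mono hst A hA)]
  exact (setIntegral_log_runningMax_sub hMmart hMnonneg hMcont hM0 hst hA).symm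
end

section
/- Let ρ := inf{t ≥ 0 : M_t = M*_∞} be the (a.s. unique and a.s. finite) time at which M attains its overall maximum. Let V = (V_t)_{t ≥ 0} be a bounded real-valued process that is adapted to (𝓕_t) and has left-continuous sample paths. Then E[V_ρ] = E[∫_{(0, ∞)} V_t dΛ_t], where Λ_t := log M*_t and the inner integral is the pathwise Lebesgue–Stieltjes integral of t ↦ V_t(ω) against the continuous nondecreasing function t ↦ log M*_t(ω). -/
open MeasureTheory Filter Set
open scoped NNReal ENNReal

section Path

/-- The running maximum of a path, in the form used for `log M*`. -/
noncomputable def runMax (f : ℝ≥0 → ℝ) (t : ℝ≥0) : ℝ := ⨆ u ∈ Icc 0 t, f u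

lemma exists_forall_iSup_mem_Icc_le {f : ℝ≥0 → ℝ} (hf : Continuous f) (t : ℝ≥0) :
    ∃ B, ∀ u, (⨆ (_ : u ∈ Icc 0 t), f u) ≤ B := by
  obtain ⟨B, hB⟩ := (isCompact_Icc (a := (0 : ℝ≥0)) (b := t)).bddAbove_image hf.continuousOn
  refine ⟨max B 0, fun u => ?_⟩
  by_cases hu : u ∈ Icc 0 t
  · simpa [hu] using Or.inl (hB (mem_image_of_mem f hu))
  · simp [hu]

lemma le_runMax {f : ℝ≥0 → ℝ} (hf : Continuous f) {u t : ℝ≥0} (hu : u ≤ t) :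
    f u ≤ runMax f t := by
  obtain ⟨B, hB⟩ := exists_forall_iSup_mem_Icc_le hf t
  refine le_ciSup_of_le ⟨B, forall_mem_range.2 hB⟩ u ?_
  simp [hu]

lemma runMax_le {f : ℝ≥0 → ℝ} {t : ℝ≥0} {x : ℝ} (hx : 0 ≤ x) (h : ∀ u ≤ t, f u ≤ x) :
    runMax f t ≤ x := by
  refine ciSup_le fun u => ?_
  by_cases hu : u ∈ Icc 0 t
  · simpa [hu] using h u hu.2
  · simp [hu, hx]

lemma lt_runMax_iff {f : ℝ≥0 → ℝ} (hf : Continuous f) {t : ℝ≥0} {x : ℝ} (hx : 0 ≤ x) :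
    x < runMax f t ↔ ∃ u ∈ Iic t, x < f u := by
  constructor
  · intro h
    by_contra! h'
    exact absurd (runMax_le hx h') (not_le.2 h)
  · rintro ⟨u, hu, h⟩
    exact h.trans_le (le_runMax hf hu)

/-- Up to time `T`, the first time after `s` at which `f` exceeds the level `y`. -/
noncomputable def exitTime (f : ℝ≥0 → ℝ) (y : ℝ) (s T : ℝ≥0) : ℝ≥0 :=
  sInf {u | s ≤ u ∧ (y < f u ∨ T ≤ u)}

variable {f : ℝ≥0 → ℝ} {y : ℝ} {s T : ℝ≥0}

lemma exitTime_le (hsT : s ≤ T) : exitTime f y s T ≤ T :=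
  csInf_le (OrderBot.bddBelow _) ⟨hsT, Or.inr le_rfl⟩

lemma le_exitTime (hsT : s ≤ T) : s ≤ exitTime f y s T :=
  le_csInf ⟨T, hsT, Or.inr le_rfl⟩ fun _ hu => hu.1

lemma exitTime_lt_iff (hsT : s ≤ T) {t : ℝ≥0} (ht : t ≤ T) :
    exitTime f y s T < t ↔ ∃ u ∈ Ico s t, y < f u := by
  have hne : {u | s ≤ u ∧ (y < f u ∨ T ≤ u)}.Nonempty := ⟨T, hsT, Or.inr le_rfl⟩
  rw [exitTime, csInf_lt_iff (OrderBot.bddBelow _) hne]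
  constructor
  · rintro ⟨u, ⟨h1, h2⟩, h3⟩
    exact ⟨u, ⟨h1, h3⟩, h2.resolve_right (not_le.2 (h3.trans_le ht))⟩
  · rintro ⟨u, hu, h⟩
    exact ⟨u, ⟨hu.1, Or.inl h⟩, hu.2⟩

lemma apply_exitTime_le (hf : Continuous f) (hsT : s ≤ T) (hs : f s ≤ y) :
    f (exitTime f y s T) ≤ y := by
  rcases (le_exitTime (f := f) (y := y) hsT).eq_or_lt with h | h
  · rwa [← h]
  · have hcl : exitTime f y s T ∈ closure (Ico s (exitTime f y s T)) := by
      rw [closure_Ico h.ne]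
      exact right_mem_Icc.2 h.le
    refine closure_minimal ?_ (isClosed_le hf continuous_const) hcl
    intro u hu
    by_contra hy
    exact absurd ((exitTime_lt_iff hsT (exitTime_le hsT)).2 ⟨u, hu, not_le.1 hy⟩) (lt_irrefl _)

lemma apply_exitTime_eq (hf : Continuous f) (hsT : s ≤ T) (hs : f s ≤ y)
    (h : exitTime f y s T < T) : f (exitTime f y s T) = y := by
  refine le_antisymm (apply_exitTime_le hf hsT hs) ?_
  have hcl : exitTime f y s T ∈ closure {u | s ≤ u ∧ (y < f u ∨ T ≤ u)} :=
    csInf_mem_closure ⟨T, hsT, Or.inr le_rfl⟩ (OrderBot.bddBelow _)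
  have hsub : {u | s ≤ u ∧ (y < f u ∨ T ≤ u)} ⊆ {u | y ≤ f u} ∪ Ici T := by
    rintro u ⟨-, hu | hu⟩
    · exact Or.inl hu.le
    · exact Or.inr hu
  exact (closure_minimal hsub ((isClosed_le continuous_const hf).union isClosed_Ici) hcl).resolve_right
    (not_le.2 h)

/-- The least multiple of `1 / (n + 1)` that is strictly larger than `x`. -/
noncomputable def gridSucc (n : ℕ) (x : ℝ≥0) : ℝ≥0 := (⌊x * (n + 1)⌋₊ + 1) / (n + 1)

lemma lt_gridSucc (n : ℕ) (x : ℝ≥0) : x < gridSucc n x := by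
  rw [gridSucc, lt_div_iff₀ (by positivity)]
  exact Nat.lt_floor_add_one _

lemma gridSucc_le (n : ℕ) (x : ℝ≥0) : gridSucc n x ≤ x + 1 / (n + 1) := by
  rw [gridSucc, add_div]
  gcongr
  rw [div_le_iff₀ (by positivity)]
  exact Nat.floor_le zero_le

lemma gridSucc_le_iff (n : ℕ) (x i : ℝ≥0) :
    gridSucc n x ≤ i ↔ x < ⌊i * (n + 1)⌋₊ / (n + 1) := by
  rw [gridSucc, div_le_iff₀ (by positivity), lt_div_iff₀ (by positivity),
    ← Nat.floor_lt zero_le, Nat.lt_iff_add_one_le, Nat.le_floor_iff zero_le]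
  push_cast
  rfl

lemma tendsto_one_div_nnreal : Tendsto (fun n : ℕ => 1 / ((n : ℝ≥0) + 1)) atTop (nhds 0) :=
  tendsto_one_div_add_atTop_nhds_zero_nat

lemma tendsto_gridSucc (x : ℝ≥0) : Tendsto (fun n => gridSucc n x) atTop (nhds x) := by
  refine tendsto_of_tendsto_of_tendsto_of_le_of_le tendsto_const_nhds ?_
    (fun n => (lt_gridSucc n x).le) (fun n => gridSucc_le n x)
  simpa using tendsto_one_div_nnreal.const_add x

end Path

section Doob

variable {Ω : Type*} {m : MeasurableSpace Ω} {P : Measure Ω}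

lemma measurableSet_exists_lt_s7 {m' : MeasurableSpace Ω} {M : ℝ≥0 → Ω → ℝ} {Y : Ω → ℝ}
    (J : Set ℝ≥0) (hM : ∀ u ∈ J, Measurable[m'] (M u)) (hY : Measurable[m'] Y)
    (hMcont : ∀ ω, Continuous fun t => M t ω) :
    MeasurableSet[m'] {ω | ∃ u ∈ J, Y ω < M u ω} := by
  obtain ⟨c, hcJ, hc, hJc⟩ :=
    (TopologicalSpace.IsSeparable.of_separableSpace J).exists_countable_dense_subset
  have : {ω | ∃ u ∈ J, Y ω < M u ω} = ⋃ u ∈ c, {ω | Y ω < M u ω} := by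
    ext ω
    simp only [mem_ofPred_eq, mem_iUnion, exists_prop]
    constructor
    · rintro ⟨u, hu, h⟩
      obtain ⟨v, hv, hvc⟩ := mem_closure_iff.1 (hJc hu) _
        (isOpen_lt continuous_const (hMcont ω)) h
      exact ⟨v, hvc, hv⟩
    · rintro ⟨u, hu, h⟩
      exact ⟨u, hcJ hu, h⟩
  rw [this]
  exact MeasurableSet.biUnion hc fun u hu => measurableSet_lt hY (hM u (hcJ hu))

lemma integral_mul_condExp_of_bounded [IsFiniteMeasure P] {m' : MeasurableSpace Ω} (hm : m' ≤ m)
    {Z g : Ω → ℝ} (hZ : StronglyMeasurable[m'] Z) {c : ℝ} (hZc : ∀ ω, ‖Z ω‖ ≤ c)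
    (hg : Integrable g P) : ∫ ω, Z ω * (P[g | m']) ω ∂P = ∫ ω, Z ω * g ω ∂P := by
  have hint : Integrable (Z * g) P :=
    hg.bdd_mul (hZ.mono hm).aestronglyMeasurable (Eventually.of_forall hZc)
  calc _ = ∫ ω, (P[Z * g | m']) ω ∂P :=
        integral_congr_ae (condExp_mul_of_stronglyMeasurable_left hZ hint hg).symm
    _ = _ := integral_condExp hm

variable [IsProbabilityMeasure P] {ℱ : Filtration ℝ≥0 m} {M : ℝ≥0 → Ω → ℝ}

/-- Optional stopping at the first time after `s` at which `M` exceeds an `ℱ s`-measurable level. -/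
lemma integral_mul_exitTime (hMmart : Martingale M ℱ P)
    (hMcont : ∀ ω, Continuous fun t => M t ω) {Y Z : Ω → ℝ} {s T : ℝ≥0} (hsT : s ≤ T)
    (hY : Measurable[ℱ s] Y) (hZ : StronglyMeasurable[ℱ s] Z) {c : ℝ} (hZc : ∀ ω, ‖Z ω‖ ≤ c) :
    Integrable (fun ω => M (exitTime (fun t => M t ω) (Y ω) s T) ω) P ∧
      ∫ ω, Z ω * M (exitTime (fun t => M t ω) (Y ω) s T) ω ∂P = ∫ ω, Z ω * M s ω ∂P := by
  set τ : Ω → ℝ≥0 := fun ω => exitTime (fun t => M t ω) (Y ω) s T with hτdef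
  let τn : ℕ → Ω → WithTop ℝ≥0 := fun n ω => ((min T (gridSucc n (τ ω)) : ℝ≥0) : WithTop ℝ≥0)
  have hτs : ∀ ω, s ≤ τ ω := fun ω => le_exitTime hsT
  have hτT : ∀ ω, τ ω ≤ T := fun ω => exitTime_le hsT
  have hst : ∀ n, IsStoppingTime ℱ (τn n) := by
    intro n i
    rcases le_or_gt T i with hi | hi
    · have : {ω | τn n ω ≤ i} = univ := by
        ext ω
        simp only [τn, mem_ofPred_eq, mem_univ, iff_true]
        exact WithTop.coe_le_coe.2 ((min_le_left _ _).trans hi)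
      rw [this]
      exact MeasurableSet.univ
    · set k : ℝ≥0 := ⌊i * (n + 1)⌋₊ / (n + 1) with hk
      have hki : k ≤ i := by
        rw [hk, div_le_iff₀ (by positivity)]
        exact Nat.floor_le zero_le
      have : {ω | τn n ω ≤ i} = {ω | ∃ u ∈ Ico s k, Y ω < M u ω} := by
        ext ω
        simp only [τn, mem_ofPred_eq, WithTop.coe_le_coe, min_le_iff, not_le.2 hi, false_or]
        rw [gridSucc_le_iff, ← hk, exitTime_lt_iff hsT (hki.trans hi.le)]
      rw [this]
      rcases le_or_gt s k with hsk | hsk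
      · exact measurableSet_exists_lt_s7 _
          (fun u hu => (hMmart.1 u).measurable.mono (ℱ.mono (hu.2.le.trans hki)) le_rfl)
          (hY.mono (ℱ.mono (hsk.trans hki)) le_rfl) hMcont
      · simp [Ico_eq_empty (not_lt.2 hsk.le)]
  have hsτ : ∀ n ω, (s : WithTop ℝ≥0) ≤ τn n ω := fun n ω =>
    WithTop.coe_le_coe.2 (le_min hsT ((hτs ω).trans (lt_gridSucc n _).le))
  have hτle : ∀ n ω, τn n ω ≤ T := fun n ω => WithTop.coe_le_coe.2 (min_le_left _ _)
  have hcount : ∀ n, (range (τn n)).Countable := by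
    intro n
    refine (countable_range fun k : ℕ =>
      ((min T ((k + 1) / (n + 1)) : ℝ≥0) : WithTop ℝ≥0)).mono ?_
    rintro _ ⟨ω, rfl⟩
    exact ⟨⌊τ ω * (n + 1)⌋₊, rfl⟩
  have hce : ∀ n, stoppedValue M (τn n) =ᵐ[P] P[M T | (hst n).measurableSpace] := fun n =>
    hMmart.stoppedValue_ae_eq_condExp_of_le_const_of_countable_range (hst n) (hτle n) (hcount n)
  have hint : ∀ n, ∫ ω, Z ω * (P[M T | (hst n).measurableSpace]) ω ∂P = ∫ ω, Z ω * M s ω ∂P := by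
    intro n
    rw [integral_mul_condExp_of_bounded (hst n).measurableSpace_le
      (hZ.mono ((hst n).le_measurableSpace_of_const_le (hsτ n))) hZc (hMmart.integrable T),
      ← integral_mul_condExp_of_bounded (ℱ.le s) hZ hZc (hMmart.integrable T)]
    refine integral_congr_ae ?_
    filter_upwards [hMmart.2 s T hsT] with ω h using by rw [h]
  have hlim : ∀ᵐ ω ∂P, Tendsto (fun n => (P[M T | (hst n).measurableSpace]) ω) atTop
      (nhds (M (τ ω) ω)) := by
    filter_upwards [ae_all_iff.2 hce] with ω h
    have h1 : Tendsto (fun n => min T (gridSucc n (τ ω))) atTop (nhds (τ ω)) := by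
      simpa [hτT ω] using (tendsto_const_nhds (x := T)).min (tendsto_gridSucc (τ ω))
    refine (((hMcont ω).tendsto _).comp h1).congr fun n => ?_
    rw [← h n]
    rfl
  have hUI := (hMmart.integrable T).uniformIntegrable_condExp fun n => (hst n).measurableSpace_le
  have hMτ : MemLp (fun ω => M (τ ω) ω) 1 P := hUI.memLp_of_ae_tendsto hlim
  have hL1 := tendsto_Lp_finite_of_tendsto_ae le_rfl ENNReal.one_ne_top
    (fun n => hUI.1 n) hMτ hUI.2.1 hlim
  have hZm : AEStronglyMeasurable Z P := (hZ.mono (ℱ.le s)).aestronglyMeasurable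
  have hZi : ∀ {g : Ω → ℝ}, Integrable g P → Integrable (fun ω => Z ω * g ω) P :=
    fun hg => hg.bdd_mul hZm (Eventually.of_forall hZc)
  refine ⟨memLp_one_iff_integrable.1 hMτ, ?_⟩
  have hzero := ENNReal.Tendsto.const_mul hL1 (Or.inr (ENNReal.ofReal_ne_top (r := c)))
  rw [mul_zero] at hzero
  refine (tendsto_nhds_unique (tendsto_const_nhds.congr fun n => (hint n).symm)
    (tendsto_integral_of_L1' (l := atTop) _ (hZi (memLp_one_iff_integrable.1 hMτ)).1
      (Eventually.of_forall fun n => hZi integrable_condExp) ?_)).symm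
  refine tendsto_of_tendsto_of_tendsto_of_le_of_le tendsto_const_nhds hzero
    (fun _ => zero_le) fun n => ?_
  refine eLpNorm_le_mul_eLpNorm_of_ae_le_mul (Eventually.of_forall fun ω => ?_) 1
  simp only [Pi.sub_apply, ← mul_sub, norm_mul]
  exact mul_le_mul_of_nonneg_right (hZc ω) (norm_nonneg _)

/-- Doob's maximal equality for a random level `Y ≥ 1` known at time `s`. -/
lemma measureReal_inter_exists_lt (hMmart : Martingale M ℱ P) (hMnonneg : ∀ t ω, 0 ≤ M t ω)
    (hMcont : ∀ ω, Continuous fun t => M t ω)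
    (hMlim : ∀ᵐ ω ∂P, Tendsto (fun t => M t ω) atTop (nhds (0 : ℝ)))
    {Y : Ω → ℝ} {s : ℝ≥0} (hY : Measurable[ℱ s] Y) (hY1 : ∀ ω, 1 ≤ Y ω)
    (hsY : ∀ ω, M s ω ≤ Y ω) {A : Set Ω} (hA : MeasurableSet[ℱ s] A) :
    P.real (A ∩ {ω | ∃ u ∈ Ici s, Y ω < M u ω}) = ∫ ω in A, M s ω / Y ω ∂P := by
  have hA' := ℱ.le s _ hA
  have hE : MeasurableSet {ω | ∃ u ∈ Ici s, Y ω < M u ω} :=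
    measurableSet_exists_lt_s7 _ (fun u _ => (hMmart.1 u).measurable.mono (ℱ.le u) le_rfl)
      (hY.mono (ℱ.le s) le_rfl) hMcont
  set E := {ω | ∃ u ∈ Ici s, Y ω < M u ω} with hEdef
  set Z : Ω → ℝ := A.indicator fun ω => (Y ω)⁻¹ with hZdef
  have hZ : StronglyMeasurable[ℱ s] Z := (hY.inv.indicator hA).stronglyMeasurable
  have hZ0 : ∀ ω, 0 ≤ Z ω := fun ω =>
    indicator_nonneg (fun ω _ => inv_nonneg.2 (zero_le_one.trans (hY1 ω))) ω
  have hZY : ∀ ω, Z ω * Y ω ≤ 1 := by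
    intro ω
    by_cases h : ω ∈ A
    · simp [hZdef, h, inv_mul_cancel₀ (zero_lt_one.trans_le (hY1 ω)).ne']
    · simp [hZdef, h]
  have hZ1 : ∀ ω, ‖Z ω‖ ≤ 1 := fun ω => by
    rw [Real.norm_of_nonneg (hZ0 ω)]
    exact (le_mul_of_one_le_right (hZ0 ω) (hY1 ω)).trans (hZY ω)
  obtain ⟨τ, hτ⟩ : ∃ τ : ℕ → Ω → ℝ≥0,
      ∀ n ω, τ n ω = exitTime (fun t => M t ω) (Y ω) s (s + n) := ⟨_, fun _ _ => rfl⟩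
  have hsn : ∀ n : ℕ, s ≤ s + n := fun n => le_self_add
  have hsampling : ∀ n, Integrable (fun ω => M (τ n ω) ω) P ∧
      ∫ ω, Z ω * M (τ n ω) ω ∂P = ∫ ω, Z ω * M s ω ∂P := fun n => by
    simp only [hτ]
    exact integral_mul_exitTime hMmart hMcont (hsn n) hY hZ hZ1
  have hTn : Tendsto (fun n : ℕ => s + (n : ℝ≥0)) atTop atTop :=
    tendsto_atTop_mono (fun _ => le_add_self) tendsto_natCast_atTop_atTop
  have hlim : ∀ᵐ ω ∂P, Tendsto (fun n => Z ω * M (τ n ω) ω) atTop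
      (nhds ((A ∩ E).indicator (fun _ => (1 : ℝ)) ω)) := by
    filter_upwards [hMlim] with ω hω
    by_cases hAω : ω ∈ A
    swap
    · simp [hZdef, hAω]
    by_cases hEω : ω ∈ E
    · obtain ⟨u, hu, huY⟩ := hEω
      refine tendsto_const_nhds.congr' ?_
      filter_upwards [hTn.eventually_gt_atTop u] with n hn
      have hlt : τ n ω < s + n :=
        (hτ n ω).trans_lt ((exitTime_lt_iff (hsn n) le_rfl).2 ⟨u, ⟨hu, hn⟩, huY⟩)
      have heq : M (τ n ω) ω = Y ω := by
        rw [hτ] at hlt ⊢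
        exact apply_exitTime_eq (hMcont ω) (hsn n) (hsY ω) hlt
      have hmem : ω ∈ A ∩ E := ⟨hAω, u, hu, huY⟩
      simp [heq, hZdef, hAω, hmem, inv_mul_cancel₀ (zero_lt_one.trans_le (hY1 ω)).ne']
    · have heq : ∀ n, τ n ω = s + n := by
        intro n
        rw [hτ]
        refine (exitTime_le (hsn n)).eq_of_not_lt fun hlt => hEω ?_
        obtain ⟨u, hu, h⟩ := (exitTime_lt_iff (hsn n) le_rfl).1 hlt
        exact ⟨u, hu.1, h⟩
      have hnot : ω ∉ A ∩ E := fun h => hEω h.2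
      simpa [heq, hnot] using (hω.comp hTn).const_mul (Z ω)
  have hbound : ∀ n, ∀ᵐ ω ∂P, ‖Z ω * M (τ n ω) ω‖ ≤ 1 := fun n =>
    Eventually.of_forall fun ω => by
      rw [Real.norm_of_nonneg (mul_nonneg (hZ0 ω) (hMnonneg _ ω))]
      rw [hτ]
      exact (mul_le_mul_of_nonneg_left
        (apply_exitTime_le (hMcont ω) (hsn n) (hsY ω)) (hZ0 ω)).trans (hZY ω)
  have hmeas : ∀ n, AEStronglyMeasurable (fun ω => Z ω * M (τ n ω) ω) P := fun n =>
    (hZ.mono (ℱ.le s)).aestronglyMeasurable.mul (hsampling n).1.1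
  have hconv := tendsto_integral_of_dominated_convergence (fun _ => (1 : ℝ)) hmeas
    (integrable_const 1) hbound hlim
  simp only [(hsampling _).2] at hconv
  have h1 : ∫ ω, Z ω * M s ω ∂P = P.real (A ∩ E) := by
    rw [tendsto_nhds_unique tendsto_const_nhds hconv]
    exact integral_indicator_one (hA'.inter hE)
  rw [← h1, ← integral_indicator hA']
  refine integral_congr_ae (Eventually.of_forall fun ω => ?_)
  by_cases h : ω ∈ A
  · simp [hZdef, h, div_eq_inv_mul]
  · simp [hZdef, h]

lemma measurable_runMax {m' : MeasurableSpace Ω} {t : ℝ≥0}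
    (hM : ∀ u ≤ t, Measurable[m'] (M u)) (hMcont : ∀ ω, Continuous fun t => M t ω)
    (hMnonneg : ∀ t ω, 0 ≤ M t ω) : Measurable[m'] fun ω => runMax (fun u => M u ω) t := by
  refine measurable_of_Ioi fun x => ?_
  rcases le_or_gt 0 x with hx | hx
  · have : (fun ω => runMax (fun u => M u ω) t) ⁻¹' Ioi x = {ω | ∃ u ∈ Iic t, x < M u ω} := by
      ext ω
      exact lt_runMax_iff (hMcont ω) hx
    rw [this]
    exact measurableSet_exists_lt_s7 _ hM measurable_const hMcont
  · have : (fun ω => runMax (fun u => M u ω) t) ⁻¹' Ioi x = univ := by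
      ext ω
      simp only [mem_preimage, mem_Ioi, mem_univ, iff_true]
      exact hx.trans_le ((hMnonneg 0 ω).trans (le_runMax (hMcont ω) zero_le))
    rw [this]
    exact MeasurableSet.univ

/-- Given the past up to time `s`, the logarithm of the overall maximum over the running maximum
has an exponential tail. -/
lemma measureReal_inter_exists_exp_mul_lt (hMmart : Martingale M ℱ P)
    (hMnonneg : ∀ t ω, 0 ≤ M t ω) (hMcont : ∀ ω, Continuous fun t => M t ω)
    (hMlim : ∀ᵐ ω ∂P, Tendsto (fun t => M t ω) atTop (nhds (0 : ℝ)))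
    {s : ℝ≥0} {A : Set Ω} (hA : MeasurableSet[ℱ s] A) {r : ℝ} (hr : 0 ≤ r) :
    P.real (A ∩ {ω | ∃ u ∈ Ici s, Real.exp r * max 1 (runMax (fun t => M t ω) s) < M u ω})
      = Real.exp (-r) * ∫ ω in A, M s ω / max 1 (runMax (fun t => M t ω) s) ∂P := by
  have hR : Measurable[ℱ s] fun ω => max 1 (runMax (fun t => M t ω) s) :=
    measurable_const.max (measurable_runMax
      (fun u hu => (hMmart.1 u).measurable.mono (ℱ.mono hu) le_rfl) hMcont hMnonneg)
  have hr1 : 1 ≤ Real.exp r := Real.one_le_exp hr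
  have hle : ∀ ω, max 1 (runMax (fun t => M t ω) s) ≤
      Real.exp r * max 1 (runMax (fun t => M t ω) s) := fun ω =>
    le_mul_of_one_le_left (zero_le_one.trans (le_max_left _ _)) hr1
  rw [measureReal_inter_exists_lt hMmart hMnonneg hMcont hMlim (hR.const_mul (Real.exp r))
    (fun ω => (le_max_left _ _).trans (hle ω))
    (fun ω => ((le_runMax (hMcont ω) le_rfl).trans (le_max_right _ _)).trans (hle ω)) hA,
    ← integral_const_mul]
  congr 1 with ω
  rw [Real.exp_neg]
  field_simp

end Doob

section MaximumTime

variable {f : ℝ≥0 → ℝ}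

lemma exists_isMax_of_tendsto_zero (hf : Continuous f) (h0 : f 0 = 1)
    (hlim : Tendsto f atTop (nhds 0)) : ∃ u, ∀ v, f v ≤ f u := by
  obtain ⟨T, hT⟩ := eventually_atTop.1 (hlim.eventually_lt_const zero_lt_one)
  obtain ⟨u, hu, hmax⟩ := (isCompact_Icc (a := (0 : ℝ≥0)) (b := T)).exists_isMaxOn
    ⟨0, left_mem_Icc.2 zero_le⟩ hf.continuousOn
  refine ⟨u, fun v => ?_⟩
  rcases le_total v T with hv | hv
  · exact hmax ⟨zero_le, hv⟩
  · exact (hT v hv).le.trans (h0 ▸ hmax ⟨le_rfl, zero_le⟩)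

lemma bddAbove_range_of_tendsto_zero (hf : Continuous f) (h0 : f 0 = 1)
    (hlim : Tendsto f atTop (nhds 0)) : BddAbove (range f) := by
  obtain ⟨u, hu⟩ := exists_isMax_of_tendsto_zero hf h0 hlim
  exact ⟨f u, forall_mem_range.2 hu⟩

lemma one_le_runMax (hf : Continuous f) (h0 : f 0 = 1) (s : ℝ≥0) : 1 ≤ runMax f s :=
  h0 ▸ le_runMax hf zero_le

lemma runMax_le_iSup (hf : Continuous f) (h0 : f 0 = 1) (hlim : Tendsto f atTop (nhds 0))
    (s : ℝ≥0) : runMax f s ≤ ⨆ v, f v := by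
  have hb := bddAbove_range_of_tendsto_zero hf h0 hlim
  exact runMax_le (zero_le_one.trans (h0 ▸ le_ciSup hb 0)) fun u _ => le_ciSup hb u

lemma runMax_zero (hf : Continuous f) (h0 : f 0 = 1) : runMax f 0 = 1 :=
  le_antisymm (runMax_le zero_le_one fun u hu => by rw [nonpos_iff_eq_zero.1 hu, h0])
    (one_le_runMax hf h0 0)

lemma runMax_mono (hf : Continuous f) (h0 : f 0 = 1) : Monotone (runMax f) := fun _ t hst =>
  runMax_le (zero_le_one.trans (one_le_runMax hf h0 t)) fun _ hu => le_runMax hf (hu.trans hst)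

lemma tendsto_runMax (hf : Continuous f) (h0 : f 0 = 1) (hlim : Tendsto f atTop (nhds 0)) :
    Tendsto (fun n : ℕ => runMax f n) atTop (nhds (⨆ v, f v)) := by
  obtain ⟨u, hu⟩ := exists_isMax_of_tendsto_zero hf h0 hlim
  refine tendsto_const_nhds.congr' ?_
  filter_upwards [tendsto_natCast_atTop_atTop.eventually_ge_atTop u] with n hn
  exact le_antisymm ((ciSup_le hu).trans (le_runMax hf hn)) (runMax_le_iSup hf h0 hlim n)

lemma exists_exp_mul_lt_iff (hf : Continuous f) (h0 : f 0 = 1) (hlim : Tendsto f atTop (nhds 0))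
    (s : ℝ≥0) {r : ℝ} (hr : 0 ≤ r) :
    (∃ u ∈ Ici s, Real.exp r * max 1 (runMax f s) < f u) ↔
      r < Real.log (⨆ v, f v) - Real.log (runMax f s) := by
  have h1 := one_le_runMax hf h0 s
  have hR : 0 < runMax f s := zero_lt_one.trans_le h1
  have hN := hR.trans_le (runMax_le_iSup hf h0 hlim s)
  have hb := bddAbove_range_of_tendsto_zero hf h0 hlim
  rw [max_eq_right h1, ← Real.log_div hN.ne' hR.ne', Real.lt_log_iff_exp_lt (div_pos hN hR),
    lt_div_iff₀ hR, lt_ciSup_iff hb]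
  refine ⟨fun ⟨u, _, h⟩ => ⟨u, h⟩, fun ⟨u, h⟩ => ⟨u, ?_, h⟩⟩
  by_contra hu
  exact absurd ((le_mul_of_one_le_left hR.le (Real.one_le_exp hr)).trans_lt h)
    (not_lt.2 (le_runMax hf (not_le.1 hu).le))

lemma lt_sInf_isMax_iff (hf : Continuous f) (h0 : f 0 = 1) (hlim : Tendsto f atTop (nhds 0))
    (s : ℝ≥0) : s < sInf {u | f u = ⨆ v, f v} ↔
      0 < Real.log (⨆ v, f v) - Real.log (runMax f s) := by
  have hR : 0 < runMax f s := zero_lt_one.trans_le (one_le_runMax hf h0 s)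
  have hb := bddAbove_range_of_tendsto_zero hf h0 hlim
  rw [sub_pos, Real.log_lt_log_iff hR (hR.trans_le (runMax_le_iSup hf h0 hlim s))]
  constructor
  · intro h
    by_contra! hle
    obtain ⟨u, hu, hmax⟩ := (isCompact_Icc (a := (0 : ℝ≥0)) (b := s)).exists_isMaxOn
      ⟨0, left_mem_Icc.2 zero_le⟩ hf.continuousOn
    have hfu : runMax f s ≤ f u := runMax_le
      (zero_le_one.trans (h0 ▸ hmax ⟨le_rfl, zero_le⟩)) fun v hv => hmax ⟨zero_le, hv⟩
    have : sInf {u | f u = ⨆ v, f v} ≤ u :=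
      csInf_le (OrderBot.bddBelow _) (le_antisymm (le_ciSup hb u) (hle.trans hfu))
    exact absurd h (not_lt.2 (this.trans hu.2))
  · intro h
    obtain ⟨u, hu⟩ := exists_isMax_of_tendsto_zero hf h0 hlim
    have hne : {u | f u = ⨆ v, f v}.Nonempty := ⟨u, le_antisymm (le_ciSup hb u) (ciSup_le hu)⟩
    have hmem : f (sInf {u | f u = ⨆ v, f v}) = ⨆ v, f v :=
      (isClosed_eq hf continuous_const).csInf_mem hne (OrderBot.bddBelow _)
    by_contra! hle
    exact absurd h (not_lt.2 (hmem ▸ le_runMax hf hle))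

end MaximumTime

section Stieltjes

/-- The largest multiple of `1 / (n + 1)` that is strictly smaller than `x`, for `x > 0`. -/
noncomputable def gridPred (n : ℕ) (x : ℝ≥0) : ℝ≥0 := ((⌈x * (n + 1)⌉₊ - 1 : ℕ) : ℝ≥0) / (n + 1)

/-- The cells of the grid of mesh `1 / (n + 1)`. -/
def gridCell (n k : ℕ) : Set ℝ≥0 := Ioc ((k : ℝ≥0) / (n + 1)) ((k + 1 : ℕ) / (n + 1))

lemma mem_gridCell_iff {n k : ℕ} {x : ℝ≥0} : x ∈ gridCell n k ↔ ⌈x * (n + 1)⌉₊ = k + 1 := by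
  rw [gridCell, mem_Ioc, div_lt_iff₀ (by positivity), le_div_iff₀ (by positivity),
    Nat.ceil_eq_iff (by simp)]
  simp

lemma gridPred_of_mem {n k : ℕ} {x : ℝ≥0} (hx : x ∈ gridCell n k) :
    gridPred n x = (k : ℝ≥0) / (n + 1) := by
  simp [gridPred, mem_gridCell_iff.1 hx]

lemma iUnion_gridCell (n : ℕ) : ⋃ k, gridCell n k = Ioi 0 := by
  ext x
  simp only [mem_iUnion, mem_gridCell_iff, mem_Ioi]
  constructor
  · rintro ⟨k, hk⟩
    have : 0 < ⌈x * (n + 1)⌉₊ := by omega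
    rw [Nat.ceil_pos] at this
    exact pos_of_mul_pos_left this (by positivity)
  · intro hx
    have : 0 < ⌈x * (n + 1)⌉₊ := Nat.ceil_pos.2 (by positivity)
    exact ⟨⌈x * (n + 1)⌉₊ - 1, by omega⟩

lemma measurableSet_gridCell (n k : ℕ) : MeasurableSet (gridCell n k) := measurableSet_Ioc

lemma pairwise_disjoint_gridCell (n : ℕ) : Pairwise (Function.onFun Disjoint (gridCell n)) := by
  intro i j hij
  refine disjoint_left.2 fun x hi hj => hij ?_
  have := (mem_gridCell_iff.1 hi).symm.trans (mem_gridCell_iff.1 hj)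
  omega

lemma tendsto_gridPred {x : ℝ≥0} (hx : 0 < x) :
    Tendsto (fun n => gridPred n x) atTop (nhdsWithin x (Iic x)) := by
  have hmem : ∀ n, x ∈ gridCell n (⌈x * (n + 1)⌉₊ - 1) := fun n => by
    have : 0 < ⌈x * (n + 1)⌉₊ := Nat.ceil_pos.2 (by positivity)
    exact mem_gridCell_iff.2 (by omega)
  have hle : ∀ n, gridPred n x ≤ x := fun n => by
    rw [gridPred_of_mem (hmem n)]
    exact (hmem n).1.le
  have hge : ∀ n, x ≤ gridPred n x + 1 / (n + 1) := fun n => by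
    rw [gridPred_of_mem (hmem n), ← add_div]
    exact_mod_cast (hmem n).2
  refine tendsto_nhdsWithin_iff.2 ⟨?_, Eventually.of_forall hle⟩
  have hlow : Tendsto (fun n : ℕ => x - 1 / ((n : ℝ≥0) + 1)) atTop (nhds x) := by
    simpa using (tendsto_const_nhds (x := x)).sub tendsto_one_div_nnreal
  exact tendsto_of_tendsto_of_tendsto_of_le_of_le hlow tendsto_const_nhds
    (fun n => tsub_le_iff_right.2 (hge n)) hle

variable {Ω : Type*} {m : MeasurableSpace Ω} {P : Measure Ω} {V : ℝ≥0 → Ω → ℝ} {C : ℝ}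

lemma measurable_comp_gridPred (v : ℝ≥0 → ℝ) (n : ℕ) : Measurable fun t => v (gridPred n t) :=
  (measurable_from_nat (f := fun k : ℕ => v (((k - 1 : ℕ) : ℝ≥0) / (n + 1)))).comp
    (Nat.measurable_ceil.comp (measurable_id.mul_const _))

/-- Left Riemann–Stieltjes sums of a bounded left-continuous function converge. -/
lemma tendsto_setIntegral_gridPred {κ : Measure ℝ≥0} (hκ : κ (Ioi 0) ≠ ∞) {v : ℝ≥0 → ℝ}
    (hv : ∀ t, |v t| ≤ C) (hcont : ∀ t, ContinuousWithinAt v (Iic t) t) :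
    Tendsto (fun n => ∫ t in Ioi 0, v (gridPred n t) ∂κ) atTop (nhds (∫ t in Ioi 0, v t ∂κ)) := by
  refine tendsto_integral_of_dominated_convergence (fun _ => C)
    (fun n => (measurable_comp_gridPred v n).aestronglyMeasurable)
    (integrableOn_const hκ) (fun n => Eventually.of_forall fun t => hv _) ?_
  filter_upwards [ae_restrict_mem measurableSet_Ioi] with t ht
  exact (hcont t).tendsto.comp (tendsto_gridPred ht)

lemma hasSum_setIntegral_gridPred {κ : Measure ℝ≥0} (hκ : κ (Ioi 0) ≠ ∞) {v : ℝ≥0 → ℝ}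
    (hv : ∀ t, |v t| ≤ C) (n : ℕ) :
    HasSum (fun k : ℕ => v (k / (n + 1)) * κ.real (gridCell n k))
      (∫ t in Ioi 0, v (gridPred n t) ∂κ) := by
  have hint : IntegrableOn (fun t => v (gridPred n t)) (⋃ k, gridCell n k) κ := by
    rw [iUnion_gridCell]
    exact (integrableOn_const hκ (C := C)).mono'
      (measurable_comp_gridPred v n).aestronglyMeasurable (Eventually.of_forall fun t => hv _)
  have h := hasSum_integral_iUnion (measurableSet_gridCell n) (pairwise_disjoint_gridCell n) hint
  rw [iUnion_gridCell] at h
  have hcell : ∀ k : ℕ, ∫ t in gridCell n k, v (gridPred n t) ∂κ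
      = v (k / (n + 1)) * κ.real (gridCell n k) := fun k => by
    rw [setIntegral_congr_fun (g := fun _ => v (k / (n + 1))) (measurableSet_gridCell n k)
      fun t ht => by simp only [gridPred_of_mem ht], setIntegral_const, smul_eq_mul, mul_comm]
  simpa only [hcell] using h

lemma abs_setIntegral_le {κ : Measure ℝ≥0} {b : ℝ} (hb : 0 ≤ b)
    (hκ : κ (Ioi 0) ≤ ENNReal.ofReal b) {v : ℝ≥0 → ℝ} (hv : ∀ t, |v t| ≤ C) :
    |∫ t in Ioi 0, v t ∂κ| ≤ C * b := by
  refine (norm_setIntegral_le_of_norm_le_const (f := v) (hκ.trans_lt ENNReal.ofReal_lt_top)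
    fun t _ => hv t).trans ?_
  exact mul_le_mul_of_nonneg_left (ENNReal.toReal_le_of_le_ofReal hb hκ)
    ((abs_nonneg _).trans (hv 0))

lemma aestronglyMeasurable_of_hasSum {F : ℕ → Ω → ℝ} {G : Ω → ℝ}
    (hF : ∀ k, AEStronglyMeasurable (F k) P) (h : ∀ᵐ ω ∂P, HasSum (fun k => F k ω) (G ω)) :
    AEStronglyMeasurable G P := by
  refine aestronglyMeasurable_of_tendsto_ae (f := fun n ω => ∑ k ∈ Finset.range n, F k ω) atTop
    (fun n => Finset.aestronglyMeasurable_fun_sum _ fun k _ => hF k) ?_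
  filter_upwards [h] with ω hω using hω.tendsto_sum_nat

/-- The averaged left Riemann–Stieltjes sums against a random measure converge to the averaged
integral. -/
lemma tendsto_tsum_integral_gridCell [IsFiniteMeasure P] (hV : ∀ t, Measurable (V t))
    (hVbdd : ∀ t ω, |V t ω| ≤ C)
    (hVleftcont : ∀ ω, ∀ t : ℝ≥0, ContinuousWithinAt (fun s => V s ω) (Iic t) t)
    {κ : Ω → Measure ℝ≥0} {B : Ω → ℝ} (hB : Integrable B P) (hB0 : ∀ᵐ ω ∂P, 0 ≤ B ω)
    (hκB : ∀ᵐ ω ∂P, κ ω (Ioi 0) ≤ ENNReal.ofReal (B ω))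
    (hκ : ∀ s t, s ≤ t → AEStronglyMeasurable (fun ω => (κ ω).real (Ioc s t)) P) :
    Tendsto (fun n : ℕ => ∑' k : ℕ, ∫ ω, V (k / (n + 1)) ω * (κ ω).real (gridCell n k) ∂P) atTop
      (nhds (∫ ω, ∫ t in Ioi 0, V t ω ∂(κ ω) ∂P)) := by
  have hcell : ∀ n k : ℕ, AEStronglyMeasurable (fun ω => (κ ω).real (gridCell n k)) P :=
    fun n k => hκ _ _ (by gcongr; simp)
  have hterm : ∀ n k : ℕ, AEStronglyMeasurable
      (fun ω => V (k / (n + 1)) ω * (κ ω).real (gridCell n k)) P := fun n k =>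
    (hV _).aestronglyMeasurable.mul (hcell n k)
  have hmass : ∀ n, ∀ᵐ ω ∂P, HasSum (fun k => (κ ω).real (gridCell n k)) ((κ ω).real (Ioi 0)) := by
    intro n
    filter_upwards [hκB] with ω hω
    simpa using hasSum_setIntegral_gridPred (ne_top_of_le_ne_top ENNReal.ofReal_ne_top hω)
      (v := fun _ => 1) (C := 1) (by simp) n
  have hsum : ∀ n : ℕ, ∀ᵐ ω ∂P, HasSum
      (fun k : ℕ => V (k / (n + 1)) ω * (κ ω).real (gridCell n k))
      (∫ t in Ioi 0, V (gridPred n t) ω ∂(κ ω)) := by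
    intro n
    filter_upwards [hκB] with ω hω
    exact hasSum_setIntegral_gridPred (ne_top_of_le_ne_top ENNReal.ofReal_ne_top hω)
      (fun t => hVbdd t ω) n
  have hswap : ∀ n : ℕ, HasSum
      (fun k : ℕ => ∫ ω, V (k / (n + 1)) ω * (κ ω).real (gridCell n k) ∂P)
      (∫ ω, ∫ t in Ioi 0, V (gridPred n t) ω ∂(κ ω) ∂P) := by
    intro n
    refine hasSum_integral_of_dominated_convergence
      (fun k ω => C * (κ ω).real (gridCell n k)) (hterm n) ?_ ?_ ?_ (hsum n)
    · refine fun k => Eventually.of_forall fun ω => ?_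
      rw [norm_mul, Real.norm_of_nonneg measureReal_nonneg]
      exact mul_le_mul_of_nonneg_right (hVbdd _ _) measureReal_nonneg
    · filter_upwards [hmass n] with ω hω using hω.summable.mul_left C
    · have htot : Integrable (fun ω => (κ ω).real (Ioi 0)) P := by
        refine hB.mono' (aestronglyMeasurable_of_hasSum (hcell n) (hmass n)) ?_
        filter_upwards [hκB, hB0] with ω h h0
        rw [Real.norm_of_nonneg measureReal_nonneg]
        exact ENNReal.toReal_le_of_le_ofReal h0 h
      refine (htot.const_mul C).congr ?_
      filter_upwards [hmass n] with ω hω using (hω.mul_left C).tsum_eq.symm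
  simp only [fun n => (hswap n).tsum_eq]
  refine tendsto_integral_of_dominated_convergence (fun ω => C * B ω) ?_ (hB.const_mul C) ?_ ?_
  · exact fun n => aestronglyMeasurable_of_hasSum (hterm n) (hsum n)
  · intro n
    filter_upwards [hκB, hB0] with ω h h0
    exact abs_setIntegral_le h0 h fun t => hVbdd _ ω
  · filter_upwards [hκB] with ω h
    exact tendsto_setIntegral_gridPred (ne_top_of_le_ne_top ENNReal.ofReal_ne_top h)
      (fun t => hVbdd t ω) (hVleftcont ω)

end Stieltjes

section TimeOfMaximum

variable {Ω : Type*} {m : MeasurableSpace Ω} {P : Measure Ω}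
  {ℱ : Filtration ℝ≥0 m} {M : ℝ≥0 → Ω → ℝ}

/-- The logarithmic increase of the running maximum of `f` after time `s`. -/
noncomputable def logIncrease (f : ℝ≥0 → ℝ) (s : ℝ≥0) : ℝ :=
  Real.log (⨆ v, f v) - Real.log (runMax f s)

lemma logIncrease_nonneg {f : ℝ≥0 → ℝ} (hf : Continuous f) (h0 : f 0 = 1)
    (hlim : Tendsto f atTop (nhds 0)) (s : ℝ≥0) : 0 ≤ logIncrease f s :=
  sub_nonneg.2 (Real.log_le_log (zero_lt_one.trans_le (one_le_runMax hf h0 s))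
    (runMax_le_iSup hf h0 hlim s))

lemma aemeasurable_logIncrease (hMmart : Martingale M ℱ P) (hMnonneg : ∀ t ω, 0 ≤ M t ω)
    (hMcont : ∀ ω, Continuous fun t => M t ω) (hM0 : ∀ᵐ ω ∂P, M 0 ω = 1)
    (hMlim : ∀ᵐ ω ∂P, Tendsto (fun t => M t ω) atTop (nhds (0 : ℝ))) (s : ℝ≥0) :
    AEMeasurable (fun ω => logIncrease (fun t => M t ω) s) P := by
  have hrun : ∀ t, Measurable fun ω => runMax (fun u => M u ω) t := fun t =>
    measurable_runMax (fun u _ => (hMmart.1 u).measurable.mono (ℱ.le u) le_rfl) hMcont hMnonneg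
  have hsup : AEMeasurable (fun ω => ⨆ v, M v ω) P := by
    refine aemeasurable_of_tendsto_metrizable_ae' (fun n : ℕ => (hrun n).aemeasurable) ?_
    filter_upwards [hM0, hMlim] with ω h0 hl using tendsto_runMax (hMcont ω) h0 hl
  exact (Real.measurable_log.comp_aemeasurable hsup).sub
    (Real.measurable_log.comp (hrun s)).aemeasurable

variable [IsProbabilityMeasure P]

lemma measure_inter_lt_logIncrease (hMmart : Martingale M ℱ P)
    (hMnonneg : ∀ t ω, 0 ≤ M t ω) (hMcont : ∀ ω, Continuous fun t => M t ω)
    (hM0 : ∀ᵐ ω ∂P, M 0 ω = 1)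
    (hMlim : ∀ᵐ ω ∂P, Tendsto (fun t => M t ω) atTop (nhds (0 : ℝ)))
    {s : ℝ≥0} {A : Set Ω} (hA : MeasurableSet[ℱ s] A) {r : ℝ} (hr : 0 ≤ r) :
    P (A ∩ {ω | r < logIncrease (fun t => M t ω) s})
      = ENNReal.ofReal (Real.exp (-r) *
        ∫ ω in A, M s ω / max 1 (runMax (fun t => M t ω) s) ∂P) := by
  rw [← measureReal_inter_exists_exp_mul_lt hMmart hMnonneg hMcont hMlim hA hr, ofReal_measureReal]
  refine measure_congr ?_
  filter_upwards [hM0, hMlim] with ω h0 hl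
  exact propext (and_congr_right fun _ => (exists_exp_mul_lt_iff (hMcont ω) h0 hl s hr).symm)

/-- On events known at time `s`, the mean logarithmic increase of the running maximum after `s`
is the probability that the maximum increases after `s`. -/
lemma setLIntegral_logIncrease (hMmart : Martingale M ℱ P)
    (hMnonneg : ∀ t ω, 0 ≤ M t ω) (hMcont : ∀ ω, Continuous fun t => M t ω)
    (hM0 : ∀ᵐ ω ∂P, M 0 ω = 1)
    (hMlim : ∀ᵐ ω ∂P, Tendsto (fun t => M t ω) atTop (nhds (0 : ℝ)))
    {s : ℝ≥0} {A : Set Ω} (hA : MeasurableSet[ℱ s] A) :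
    ∫⁻ ω in A, ENNReal.ofReal (logIncrease (fun t => M t ω) s) ∂P
      = P (A ∩ {ω | 0 < logIncrease (fun t => M t ω) s}) := by
  set c := ∫ ω in A, M s ω / max 1 (runMax (fun t => M t ω) s) ∂P
  have hc : 0 ≤ c := integral_nonneg fun ω =>
    div_nonneg (hMnonneg s ω) (zero_le_one.trans (le_max_left _ _))
  have hnn : 0 ≤ᵐ[P.restrict A] fun ω => logIncrease (fun t => M t ω) s := by
    refine ae_restrict_of_ae ?_
    filter_upwards [hM0, hMlim] with ω h0 hl using logIncrease_nonneg (hMcont ω) h0 hl s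
  have hmeas := aemeasurable_logIncrease hMmart hMnonneg hMcont hM0 hMlim s
  rw [lintegral_eq_lintegral_meas_lt _ hnn hmeas.restrict]
  have htail : ∀ r ∈ Ioi (0 : ℝ), P.restrict A {ω | r < logIncrease (fun t => M t ω) s}
      = ENNReal.ofReal (Real.exp (-r) * c) := fun r hr => by
    rw [Measure.restrict_apply' (ℱ.le s _ hA), inter_comm,
      measure_inter_lt_logIncrease hMmart hMnonneg hMcont hM0 hMlim hA (le_of_lt hr)]
  rw [setLIntegral_congr_fun measurableSet_Ioi htail,
    ← ofReal_integral_eq_lintegral_ofReal ((integrableOn_exp_neg_Ioi 0).mul_const c)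
      (Eventually.of_forall fun r => mul_nonneg (Real.exp_pos _).le hc),
    integral_mul_const, integral_exp_neg_Ioi_zero,
    measure_inter_lt_logIncrease hMmart hMnonneg hMcont hM0 hMlim hA le_rfl]
  simp [c]

lemma integrable_logIncrease (hMmart : Martingale M ℱ P)
    (hMnonneg : ∀ t ω, 0 ≤ M t ω) (hMcont : ∀ ω, Continuous fun t => M t ω)
    (hM0 : ∀ᵐ ω ∂P, M 0 ω = 1)
    (hMlim : ∀ᵐ ω ∂P, Tendsto (fun t => M t ω) atTop (nhds (0 : ℝ))) (s : ℝ≥0) :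
    Integrable (fun ω => logIncrease (fun t => M t ω) s) P := by
  refine ⟨(aemeasurable_logIncrease hMmart hMnonneg hMcont hM0 hMlim s).aestronglyMeasurable, ?_⟩
  rw [hasFiniteIntegral_iff_ofReal]
  · have h := setLIntegral_logIncrease hMmart hMnonneg hMcont hM0 hMlim (s := s) MeasurableSet.univ
    rw [setLIntegral_univ] at h
    rw [h]
    exact measure_lt_top _ _
  · filter_upwards [hM0, hMlim] with ω h0 hl using logIncrease_nonneg (hMcont ω) h0 hl s

lemma integral_mul_logIncrease (hMmart : Martingale M ℱ P)
    (hMnonneg : ∀ t ω, 0 ≤ M t ω) (hMcont : ∀ ω, Continuous fun t => M t ω)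
    (hM0 : ∀ᵐ ω ∂P, M 0 ω = 1)
    (hMlim : ∀ᵐ ω ∂P, Tendsto (fun t => M t ω) atTop (nhds (0 : ℝ)))
    {s : ℝ≥0} {W : Ω → ℝ} (hW : Measurable[ℱ s] W) :
    ∫ ω, W ω * logIncrease (fun t => M t ω) s ∂P
      = ∫ ω, W ω * {ω | 0 < logIncrease (fun t => M t ω) s}.indicator 1 ω ∂P := by
  have hL := aemeasurable_logIncrease hMmart hMnonneg hMcont hM0 hMlim s
  set S := {ω | 0 < logIncrease (fun t => M t ω) s} with hS
  have hSm : NullMeasurableSet S P := nullMeasurableSet_lt aemeasurable_const hL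
  set ν := P.withDensity fun ω => ENNReal.ofReal (logIncrease (fun t => M t ω) s)
  have htrim : ν.trim (ℱ.le s) = (P.restrict S).trim (ℱ.le s) := by
    refine @Measure.ext _ (ℱ s) _ _ fun A hA => ?_
    rw [trim_measurableSet_eq _ hA, trim_measurableSet_eq _ hA,
      withDensity_apply _ (ℱ.le s _ hA), Measure.restrict_apply (ℱ.le s _ hA),
      setLIntegral_logIncrease hMmart hMnonneg hMcont hM0 hMlim hA]
  have h1 : ∫ ω, W ω ∂ν = ∫ ω in S, W ω ∂P := by
    rw [integral_trim (ℱ.le s) hW.stronglyMeasurable, htrim,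
      ← integral_trim (ℱ.le s) hW.stronglyMeasurable]
  rw [integral_withDensity_eq_integral_toReal_smul₀ hL.ennreal_ofReal
    (Eventually.of_forall fun ω => ENNReal.ofReal_lt_top), ← integral_indicator₀ hSm] at h1
  convert h1 using 1
  · refine integral_congr_ae ?_
    filter_upwards [hM0, hMlim] with ω h0 hl
    rw [ENNReal.toReal_ofReal (logIncrease_nonneg (hMcont ω) h0 hl s), smul_eq_mul, mul_comm]
  · congr 1 with ω
    by_cases h : ω ∈ S <;> simp [h]

lemma ae_logIncrease_zero_pos (hMmart : Martingale M ℱ P)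
    (hMnonneg : ∀ t ω, 0 ≤ M t ω) (hMcont : ∀ ω, Continuous fun t => M t ω)
    (hM0 : ∀ᵐ ω ∂P, M 0 ω = 1)
    (hMlim : ∀ᵐ ω ∂P, Tendsto (fun t => M t ω) atTop (nhds (0 : ℝ))) :
    ∀ᵐ ω ∂P, 0 < logIncrease (fun t => M t ω) 0 := by
  have hL := aemeasurable_logIncrease hMmart hMnonneg hMcont hM0 hMlim 0
  have h := measure_inter_lt_logIncrease hMmart hMnonneg hMcont hM0 hMlim (s := 0)
    MeasurableSet.univ le_rfl
  have hone : ∫ ω, M 0 ω / max 1 (runMax (fun t => M t ω) 0) ∂P = 1 := by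
    rw [integral_congr_ae (g := fun _ => (1 : ℝ))]
    · simp
    · filter_upwards [hM0] with ω h0
      simp [runMax_zero (hMcont ω) h0, h0]
  rw [univ_inter, setIntegral_univ, hone] at h
  refine (mem_ae_iff_prob_eq_one₀ (nullMeasurableSet_lt aemeasurable_const hL)).2 ?_
  simpa using h

/-- Doob's identity: on increments of the logarithm of the running maximum, a weight known at the
left endpoint integrates as against the indicator that the maximum is attained in the interval. -/
lemma integral_mul_logIncrease_sub (hMmart : Martingale M ℱ P)
    (hMnonneg : ∀ t ω, 0 ≤ M t ω) (hMcont : ∀ ω, Continuous fun t => M t ω)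
    (hM0 : ∀ᵐ ω ∂P, M 0 ω = 1)
    (hMlim : ∀ᵐ ω ∂P, Tendsto (fun t => M t ω) atTop (nhds (0 : ℝ)))
    {s t : ℝ≥0} (hst : s ≤ t) {W : Ω → ℝ} (hW : Measurable[ℱ s] W) {C : ℝ}
    (hWC : ∀ ω, |W ω| ≤ C) :
    ∫ ω, W ω * (logIncrease (fun t => M t ω) s - logIncrease (fun t => M t ω) t) ∂P
      = ∫ ω, W ω * ({ω | 0 < logIncrease (fun t => M t ω) s}.indicator 1 ω -
          {ω | 0 < logIncrease (fun t => M t ω) t}.indicator 1 ω) ∂P := by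
  have hWi : ∀ {g : Ω → ℝ}, Integrable g P → Integrable (fun ω => W ω * g ω) P := fun hg =>
    hg.bdd_mul (hW.mono (ℱ.le s) le_rfl).aestronglyMeasurable (Eventually.of_forall hWC)
  have hI := integrable_logIncrease hMmart hMnonneg hMcont hM0 hMlim
  have hS : ∀ u, Integrable ({ω | 0 < logIncrease (fun t => M t ω) u}.indicator (1 : Ω → ℝ)) P :=
    fun u => (integrable_const (1 : ℝ)).indicator₀
      (nullMeasurableSet_lt aemeasurable_const (hI u).1.aemeasurable)
  simp only [mul_sub]
  rw [integral_sub (hWi (hI s)) (hWi (hI t)), integral_sub (hWi (hS s)) (hWi (hS t)),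
    integral_mul_logIncrease hMmart hMnonneg hMcont hM0 hMlim hW,
    integral_mul_logIncrease hMmart hMnonneg hMcont hM0 hMlim (hW.mono (ℱ.mono hst) le_rfl)]

end TimeOfMaximum

section StieltjesOfRunMax

variable {f : ℝ≥0 → ℝ} {κ : Measure ℝ≥0}

lemma measureReal_Ioc_of_runMax (hf : Continuous f) (h0 : f 0 = 1)
    (hκ : ∀ a b, a ≤ b → κ (Ioc a b)
      = ENNReal.ofReal (Real.log (runMax f b) - Real.log (runMax f a)))
    {s t : ℝ≥0} (hst : s ≤ t) : κ.real (Ioc s t) = logIncrease f s - logIncrease f t := by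
  rw [Measure.real, hκ s t hst, ENNReal.toReal_ofReal, logIncrease, logIncrease]
  · ring
  · exact sub_nonneg.2 (Real.log_le_log (zero_lt_one.trans_le (one_le_runMax hf h0 s))
      (runMax_mono hf h0 hst))

lemma measure_Ioi_zero_le_of_runMax (hf : Continuous f) (h0 : f 0 = 1)
    (hlim : Tendsto f atTop (nhds 0))
    (hκ : ∀ a b, a ≤ b → κ (Ioc a b)
      = ENNReal.ofReal (Real.log (runMax f b) - Real.log (runMax f a))) :
    κ (Ioi 0) ≤ ENNReal.ofReal (logIncrease f 0) := by
  have hU : Ioi (0 : ℝ≥0) = ⋃ n : ℕ, Ioc 0 (n : ℝ≥0) := by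
    ext x
    simp only [mem_Ioi, mem_iUnion, mem_Ioc, exists_and_left]
    exact ⟨fun h => ⟨h, exists_nat_ge x⟩, fun h => h.1⟩
  have hmono : Monotone fun n : ℕ => Ioc 0 (n : ℝ≥0) := fun i j hij =>
    Ioc_subset_Ioc_right (Nat.cast_le.2 hij)
  rw [hU, hmono.measure_iUnion]
  refine iSup_le fun n => ?_
  rw [hκ 0 n zero_le, logIncrease]
  exact ENNReal.ofReal_le_ofReal (sub_le_sub_right (Real.log_le_log
    (zero_lt_one.trans_le (one_le_runMax hf h0 n)) (runMax_le_iSup hf h0 hlim n)) _)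

end StieltjesOfRunMax

/-- **first identity of Lemma 3.1.** Let `M` be a nonnegative continuous
martingale with `M 0 = 1` a.s. and `M t → 0` a.s. as `t → ∞`, and let
`ρ := inf {t | M t = M*_∞}` be the (a.s. unique and a.s. finite) time of the overall maximum
of `M`. Let `V` be a bounded adapted process with left-continuous sample paths. Then
`E[V ρ] = E[∫_{(0,∞)} V t dΛ t]`, where `Λ t = log M*_t` and, for each `ω`, `μ ω` is the
Lebesgue–Stieltjes measure of the continuous nondecreasing function `t ↦ log M*_t (ω)`,
i.e. `μ ω (Ioc a b) = log M*_b (ω) − log M*_a (ω)` for `a ≤ b`. -/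
theorem expectation_at_time_of_maximum_via_stieltjes
    {Ω : Type*} {m : MeasurableSpace Ω} {P : Measure Ω} [IsProbabilityMeasure P]
    (ℱ : Filtration ℝ≥0 m) (M : ℝ≥0 → Ω → ℝ)
    (hMmart : Martingale M ℱ P)
    (hMnonneg : ∀ t ω, 0 ≤ M t ω)
    (hMcont : ∀ ω, Continuous fun t => M t ω)
    (hM0 : ∀ᵐ ω ∂P, M 0 ω = 1)
    (hMlim : ∀ᵐ ω ∂P, Tendsto (fun t => M t ω) atTop (nhds (0 : ℝ)))
    (ρ : Ω → ℝ≥0) (hρ : ∀ ω, ρ ω = sInf {u : ℝ≥0 | M u ω = ⨆ v, M v ω})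
    (V : ℝ≥0 → Ω → ℝ) (C : ℝ) (hVbdd : ∀ t ω, |V t ω| ≤ C)
    (hVadapted : Adapted ℱ V)
    (hVleftcont : ∀ ω, ∀ t : ℝ≥0, ContinuousWithinAt (fun s => V s ω) (Set.Iic t) t)
    (μ : Ω → Measure ℝ≥0)
    (hμ : ∀ ω, ∀ a b : ℝ≥0, a ≤ b →
      μ ω (Set.Ioc a b)
        = ENNReal.ofReal
            (Real.log (⨆ u ∈ Set.Icc 0 b, M u ω) - Real.log (⨆ u ∈ Set.Icc 0 a, M u ω))) :
    ∫ ω, V (ρ ω) ω ∂P = ∫ ω, (∫ t in Set.Ioi (0 : ℝ≥0), V t ω ∂(μ ω)) ∂P := by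
  have hcont : ∀ n k : ℕ, (k : ℝ≥0) / (n + 1) ≤ (k + 1 : ℕ) / (n + 1) := fun n k => by
    gcongr
    simp
  have hI := integrable_logIncrease hMmart hMnonneg hMcont hM0 hMlim
  have hVm : ∀ t, Measurable (V t) := fun t => (hVadapted t).mono (ℱ.le t) le_rfl
  let S : ℝ≥0 → Set Ω := fun s => {ω | 0 < logIncrease (fun t => M t ω) s}
  have hSm : ∀ s, NullMeasurableSet (S s) P := fun s =>
    nullMeasurableSet_lt aemeasurable_const (hI s).1.aemeasurable
  have hρS : ∀ᵐ ω ∂P, ∀ s, s < ρ ω ↔ ω ∈ S s := by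
    filter_upwards [hM0, hMlim] with ω h0 hl s
    rw [hρ ω]
    exact lt_sInf_isMax_iff (hMcont ω) h0 hl s
  have hμreal : ∀ᵐ ω ∂P, ∀ s t, s ≤ t → (μ ω).real (Ioc s t)
      = logIncrease (fun t => M t ω) s - logIncrease (fun t => M t ω) t := by
    filter_upwards [hM0] with ω h0 s t hst
    exact measureReal_Ioc_of_runMax (hMcont ω) h0 (hμ ω) hst
  have hδreal : ∀ᵐ ω ∂P, ∀ s t, s ≤ t → (Measure.dirac (ρ ω)).real (Ioc s t)
      = (S s).indicator 1 ω - (S t).indicator (1 : Ω → ℝ) ω := by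
    filter_upwards [hρS] with ω h s t hst
    have hsub : ω ∈ S t → ω ∈ S s := fun ht => (h s).1 (hst.trans_lt ((h t).2 ht))
    have hmem : ρ ω ∈ Ioc s t ↔ ω ∈ S s ∧ ω ∉ S t := by
      rw [mem_Ioc, ← not_lt, h, h]
    by_cases h1 : ω ∈ S s <;> by_cases h2 : ω ∈ S t <;>
      simp_all [Measure.real]
  have hμlim := tendsto_tsum_integral_gridCell (P := P) (κ := μ) hVm hVbdd hVleftcont (hI 0)
    (by filter_upwards [hM0, hMlim] with ω h0 hl using logIncrease_nonneg (hMcont ω) h0 hl 0)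
    (by
      filter_upwards [hM0, hMlim] with ω h0 hl
      exact measure_Ioi_zero_le_of_runMax (hMcont ω) h0 hl (hμ ω))
    (fun s t hst => ((hI s).1.sub (hI t).1).congr (by
      filter_upwards [hμreal] with ω h using (h s t hst).symm))
  have hδlim := tendsto_tsum_integral_gridCell (P := P) (κ := fun ω => Measure.dirac (ρ ω)) hVm
    hVbdd hVleftcont (integrable_const (1 : ℝ)) (Eventually.of_forall fun _ => zero_le_one)
    (Eventually.of_forall fun ω => by rw [ENNReal.ofReal_one]; exact prob_le_one)
    (fun s t hst => (((integrable_const (1 : ℝ)).indicator₀ (hSm s)).1.sub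
      ((integrable_const (1 : ℝ)).indicator₀ (hSm t)).1).congr (by
        filter_upwards [hδreal] with ω h using (h s t hst).symm))
  have hterm : ∀ n k : ℕ, ∫ ω, V (k / (n + 1)) ω * (μ ω).real (gridCell n k) ∂P
      = ∫ ω, V (k / (n + 1)) ω * (Measure.dirac (ρ ω)).real (gridCell n k) ∂P := by
    intro n k
    refine Eq.trans ?_ ((integral_mul_logIncrease_sub hMmart hMnonneg hMcont hM0 hMlim (hcont n k)
      (hVadapted _) (hVbdd _)).trans ?_)
    · refine integral_congr_ae ?_
      filter_upwards [hμreal] with ω h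
      rw [gridCell, h _ _ (hcont n k)]
    · refine integral_congr_ae ?_
      filter_upwards [hδreal] with ω h
      rw [gridCell, h _ _ (hcont n k)]
  simp only [hterm] at hμlim
  rw [tendsto_nhds_unique hμlim hδlim]
  refine integral_congr_ae ?_
  filter_upwards [hρS, ae_logIncrease_zero_pos hMmart hMnonneg hMcont hM0 hMlim] with ω h hpos
  classical
  rw [setIntegral_dirac, if_pos (mem_Ioi.2 ((h 0).2 hpos))]
end

section
/- Let ρ := inf{t ≥ 0 : M_t = M*_∞} be the (a.s. unique and a.s. finite) time at which M attains its overall maximum, and for u ∈ [0,1) let η_u := inf{t ≥ 0 : M_t = 1/(1−u)}. Let V = (V_t)_{t ≥ 0} be a bounded real-valued process that is adapted to (𝓕_t) and has left-continuous sample paths. Then E[V_ρ] = ∫_{[0,1)} (1/(1−u)) · E[V_{η_u} · 1_{{η_u < ∞}}] du, where the outer integral is with respect to Lebesgue measure on [0,1). -/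
open MeasureTheory Filter Set
open scoped NNReal ENNReal

/-- The event that an adapted continuous process reaches the level `y` during `[s, t]`. -/
lemma measurableSet_exists_mem_Icc_le {Ω : Type*} {m : MeasurableSpace Ω} {ℱ : Filtration ℝ≥0 m}
    {X : ℝ≥0 → Ω → ℝ} (hX : StronglyAdapted ℱ X) (hc : ∀ ω, Continuous fun t => X t ω)
    (s t : ℝ≥0) (y : ℝ) :
    MeasurableSet[ℱ t] {ω | ∃ r ∈ Icc s t, y ≤ X r ω} := by
  rcases lt_or_ge t s with hts | hst
  · simp [Icc_eq_empty_of_lt hts]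
  obtain ⟨D, hDc, hDd⟩ := TopologicalSpace.exists_countable_dense (Icc s t)
  have key : {ω | ∃ r ∈ Icc s t, y ≤ X r ω}
      = ⋂ n : ℕ, ⋃ q ∈ D, {ω | y - 1 / ((n : ℝ) + 1) < X (q : Icc s t) ω} := by
    ext ω
    simp only [mem_ofPred_eq, mem_iInter, mem_iUnion, exists_prop]
    constructor
    · rintro ⟨r, hr, hyr⟩ n
      have hopen : IsOpen {q : Icc s t | y - 1 / ((n : ℝ) + 1) < X q ω} :=
        isOpen_lt continuous_const ((hc ω).comp continuous_subtype_val)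
      obtain ⟨q, hq, hqD⟩ := hDd.exists_mem_open hopen
        ⟨⟨r, hr⟩, by
          have : (0 : ℝ) < 1 / ((n : ℝ) + 1) := by positivity
          simp only [mem_ofPred_eq]; linarith⟩
      exact ⟨q, hq, hqD⟩
    · intro h
      obtain ⟨r, hr, hmax⟩ := isCompact_Icc.exists_isMaxOn (nonempty_Icc.2 hst)
        (hc ω).continuousOn
      refine ⟨r, hr, ?_⟩
      have hlim : Tendsto (fun n : ℕ => y - 1 / ((n : ℝ) + 1)) atTop (nhds (y - 0)) :=
        tendsto_const_nhds.sub tendsto_one_div_add_atTop_nhds_zero_nat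
      rw [sub_zero] at hlim
      refine le_of_tendsto' hlim fun n => ?_
      obtain ⟨q, -, hq⟩ := h n
      exact hq.le.trans (hmax q.2)
  rw [key]
  refine MeasurableSet.iInter fun n => MeasurableSet.biUnion hDc fun q _ => ?_
  exact measurableSet_lt measurable_const ((hX q).measurable.mono (ℱ.mono q.2.2) le_rfl)

/-- Rounding a stopping time up to a grid gives a stopping time. -/
lemma measurableSet_ceil_div_min_le {Ω : Type*} {m : MeasurableSpace Ω} {ℱ : Filtration ℝ≥0 m}
    {τ : Ω → ℝ≥0} (hτ : ∀ t, MeasurableSet[ℱ t] {ω | τ ω ≤ t}) (T : ℝ≥0) (n : ℕ) (t : ℝ≥0) :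
    MeasurableSet[ℱ t] {ω | min ((⌈((n : ℝ≥0) + 1) * τ ω⌉₊ : ℝ≥0) / ((n : ℝ≥0) + 1)) T ≤ t} := by
  have hn : (0 : ℝ≥0) < (n : ℝ≥0) + 1 := by positivity
  rcases le_or_gt T t with hT | hT
  · convert MeasurableSet.univ
    ext ω
    simp [hT]
  · have : {ω | min ((⌈((n : ℝ≥0) + 1) * τ ω⌉₊ : ℝ≥0) / ((n : ℝ≥0) + 1)) T ≤ t}
        = {ω | τ ω ≤ (⌊t * ((n : ℝ≥0) + 1)⌋₊ : ℝ≥0) / ((n : ℝ≥0) + 1)} := by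
      ext ω
      simp only [mem_ofPred_eq, min_le_iff, hT.not_ge, or_false]
      rw [div_le_iff₀ hn, le_div_iff₀ hn, ← Nat.le_floor_iff (by positivity), Nat.ceil_le,
        mul_comm (τ ω)]
    rw [this]
    refine ℱ.mono ?_ _ (hτ _)
    rw [div_le_iff₀ hn]
    exact Nat.floor_le (by positivity)

lemma tendsto_ceil_div_min {x T : ℝ≥0} (hx : x ≤ T) :
    Tendsto (fun n : ℕ => min ((⌈((n : ℝ≥0) + 1) * x⌉₊ : ℝ≥0) / ((n : ℝ≥0) + 1)) T) atTop
      (nhds x) := by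
  have h1 : Tendsto (fun n : ℕ => (⌈((n : ℝ≥0) + 1) * x⌉₊ : ℝ≥0) / ((n : ℝ≥0) + 1)) atTop
      (nhds x) := by
    have hup : Tendsto (fun n : ℕ => x + 1 / ((n : ℝ≥0) + 1)) atTop (nhds (x + 0)) := by
      refine tendsto_const_nhds.add ?_
      rw [← NNReal.tendsto_coe]
      simpa using tendsto_one_div_add_atTop_nhds_zero_nat (𝕜 := ℝ)
    rw [add_zero] at hup
    refine tendsto_of_tendsto_of_tendsto_of_le_of_le tendsto_const_nhds hup (fun n => ?_)
      fun n => ?_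
    · rw [le_div_iff₀ (by positivity), mul_comm]
      exact Nat.le_ceil _
    · have hn : (0 : ℝ≥0) < (n : ℝ≥0) + 1 := by positivity
      rw [div_le_iff₀ hn, add_mul x, div_mul_cancel₀ _ hn.ne', mul_comm x]
      exact (Nat.ceil_lt_add_one (by positivity)).le
  simpa [hx] using h1.min (tendsto_const_nhds (x := T))

lemma integral_mul_eq_of_condExp_ae_eq {Ω : Type*} {m' m : MeasurableSpace Ω} {P : Measure Ω}
    [IsProbabilityMeasure P] (hm : m' ≤ m) {f g ξ : Ω → ℝ} (hf : Integrable f P)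
    (hg : g =ᵐ[P] P[f|m']) (hξ : StronglyMeasurable[m'] ξ) {C : ℝ} (hξb : ∀ ω, |ξ ω| ≤ C) :
    ∫ ω, ξ ω * g ω ∂P = ∫ ω, ξ ω * f ω ∂P := by
  have hint : Integrable (ξ * f) P :=
    hf.bdd_mul (hξ.mono hm).aestronglyMeasurable (.of_forall hξb)
  calc ∫ ω, ξ ω * g ω ∂P = ∫ ω, (P[ξ * f|m']) ω ∂P := by
        refine integral_congr_ae ?_
        filter_upwards [hg, condExp_mul_of_stronglyMeasurable_left hξ hint hf] with ω h1 h2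
        rw [h2, Pi.mul_apply, h1]
    _ = ∫ ω, ξ ω * f ω ∂P := integral_condExp hm

/-- Optional sampling for a continuous martingale at a bounded stopping time `τ ≥ s`. -/
lemma integral_mul_stopped_eq {Ω : Type*} {m : MeasurableSpace Ω} {P : Measure Ω}
    [IsProbabilityMeasure P] {ℱ : Filtration ℝ≥0 m} {X : ℝ≥0 → Ω → ℝ} (hX : Martingale X ℱ P)
    (hc : ∀ ω, Continuous fun t => X t ω) {τ : Ω → ℝ≥0}
    (hτ : ∀ t, MeasurableSet[ℱ t] {ω | τ ω ≤ t}) {s T : ℝ≥0} (hs : ∀ ω, s ≤ τ ω)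
    (hT : ∀ ω, τ ω ≤ T) {ξ : Ω → ℝ} (hξ : StronglyMeasurable[ℱ s] ξ) {C : ℝ}
    (hξb : ∀ ω, |ξ ω| ≤ C) :
    ∫ ω, ξ ω * X (τ ω) ω ∂P = ∫ ω, ξ ω * X s ω ∂P := by
  set σ : ℕ → Ω → ℝ≥0 := fun n ω =>
    min ((⌈((n : ℝ≥0) + 1) * τ ω⌉₊ : ℝ≥0) / ((n : ℝ≥0) + 1)) T with hσ
  have hσst : ∀ n, IsStoppingTime ℱ (fun ω => ((σ n ω : ℝ≥0) : WithTop ℝ≥0)) := fun n t => by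
    simpa only [WithTop.coe_le_coe] using measurableSet_ceil_div_min_le hτ T n t
  have hσT : ∀ n ω, ((σ n ω : ℝ≥0) : WithTop ℝ≥0) ≤ (T : WithTop ℝ≥0) := fun n ω =>
    WithTop.coe_le_coe.2 (min_le_right _ _)
  have hσs : ∀ n ω, ((s : ℝ≥0) : WithTop ℝ≥0) ≤ ((σ n ω : ℝ≥0) : WithTop ℝ≥0) := fun n ω => by
    refine WithTop.coe_le_coe.2 (le_min ?_ ((hs ω).trans (hT ω)))
    rw [le_div_iff₀ (by positivity), mul_comm]
    exact le_trans (by gcongr; exact hs ω) (Nat.le_ceil _)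
  have hσrange : ∀ n, (range fun ω => ((σ n ω : ℝ≥0) : WithTop ℝ≥0)).Countable := fun n => by
    refine (countable_range fun k : ℕ =>
      ((min ((k : ℝ≥0) / ((n : ℝ≥0) + 1)) T : ℝ≥0) : WithTop ℝ≥0)).mono ?_
    rintro _ ⟨ω, rfl⟩
    exact ⟨_, rfl⟩
  have hopt : ∀ n, (fun ω => X (σ n ω) ω) =ᵐ[P] P[X T | (hσst n).measurableSpace] := fun n =>
    hX.stoppedValue_ae_eq_condExp_of_le_const_of_countable_range (hσst n) (hσT n) (hσrange n)
  have hT' : s ≤ T := by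
    obtain ⟨ω⟩ : Nonempty Ω := nonempty_of_isProbabilityMeasure P
    exact (hs ω).trans (hT ω)
  have hval : ∀ n, ∫ ω, ξ ω * X (σ n ω) ω ∂P = ∫ ω, ξ ω * X s ω ∂P := fun n => by
    exact (integral_mul_eq_of_condExp_ae_eq (hσst n).measurableSpace_le (hX.integrable T) (hopt n)
        (hξ.mono ((hσst n).le_measurableSpace_of_const_le (hσs n))) hξb).trans
      (integral_mul_eq_of_condExp_ae_eq (ℱ.le s) (hX.integrable T) (hX.2 s T hT').symm
        hξ hξb).symm
  have hUI : UniformIntegrable (fun n ω => X (σ n ω) ω) 1 P :=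
    (uniformIntegrable_congr_ae hopt).2
      ((hX.integrable T).uniformIntegrable_condExp fun n => (hσst n).measurableSpace_le)
  have hlim : ∀ᵐ ω ∂P, Tendsto (fun n => X (σ n ω) ω) atTop (nhds (X (τ ω) ω)) :=
    .of_forall fun ω => ((hc ω).tendsto _).comp (tendsto_ceil_div_min (hT ω))
  have hmem := hUI.memLp_of_ae_tendsto hlim
  have hL1 := tendsto_Lp_finite_of_tendsto_ae le_rfl (by simp) hUI.1 hmem hUI.2.1 hlim
  have hξm : AEStronglyMeasurable ξ P := (hξ.mono (ℱ.le s)).aestronglyMeasurable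
  have hconv : Tendsto (fun n => ∫ ω, ξ ω * X (σ n ω) ω ∂P) atTop
      (nhds (∫ ω, ξ ω * X (τ ω) ω ∂P)) := by
    refine tendsto_integral_of_L1 _ (hξm.mul hmem.1) (.of_forall fun n => ?_) ?_
    · exact (memLp_one_iff_integrable.1 (hUI.memLp n)).bdd_mul hξm (.of_forall hξb)
    · have h0 := ENNReal.Tendsto.const_mul hL1 (a := ENNReal.ofReal C) (.inr (by simp))
      rw [mul_zero] at h0
      refine tendsto_of_tendsto_of_tendsto_of_le_of_le tendsto_const_nhds h0
        (fun n => zero_le) fun n => ?_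
      simp only [eLpNorm_one_eq_lintegral_enorm]
      rw [← lintegral_const_mul' _ _ (by simp)]
      refine lintegral_mono fun ω => ?_
      simp only [Pi.sub_apply, Pi.mul_apply]
      rw [← mul_sub, enorm_mul]
      gcongr
      rw [Real.enorm_eq_ofReal_abs]
      exact ENNReal.ofReal_le_ofReal (hξb ω)
  simp only [hval] at hconv
  exact tendsto_nhds_unique hconv tendsto_const_nhds

/-- A continuous path is at most `1` at the first time after `s` at which it reaches `1`. -/
lemma apply_sInf_le_one {f : ℝ≥0 → ℝ} (hf : Continuous f) {s T : ℝ≥0} (hfs : f s ≤ 1) :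
    f (sInf {r | s ≤ r ∧ (1 ≤ f r ∨ T ≤ r)}) ≤ 1 := by
  set S : Set ℝ≥0 := {r | s ≤ r ∧ (1 ≤ f r ∨ T ≤ r)} with hS
  have hne : S.Nonempty := ⟨max s T, le_max_left _ _, .inr (le_max_right _ _)⟩
  have hsle : s ≤ sInf S := le_csInf hne fun r hr => hr.1
  rcases hsle.eq_or_lt with h | h
  · rwa [← h]
  · have hlt : ∀ r ∈ Ico s (sInf S), f r ≤ 1 := fun r hr => by
      by_contra hcon
      exact notMem_of_lt_csInf hr.2 (OrderBot.bddBelow S) ⟨hr.1, .inl (not_le.1 hcon).le⟩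
    have hcl : sInf S ∈ closure (Ico s (sInf S)) := by
      rw [closure_Ico h.ne]; exact right_mem_Icc.2 hsle
    exact closure_minimal (fun r hr => hlt r hr) (isClosed_le hf continuous_const) hcl

lemma isClosed_setOf_le_and {f : ℝ≥0 → ℝ} (hf : Continuous f) (s T : ℝ≥0) :
    IsClosed {r | s ≤ r ∧ (1 ≤ f r ∨ T ≤ r)} :=
  isClosed_Ici.inter ((isClosed_le continuous_const hf).union isClosed_Ici)

/-- The conditional Doob maximal identity for a nonnegative continuous martingale vanishing at
infinity: the conditional probability given `ℱ s` of reaching `1` after `s` is `X s`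
where `X s ≤ 1`. -/
lemma integral_mul_indicator_exists_one_le {Ω : Type*} {m : MeasurableSpace Ω} {P : Measure Ω}
    [IsProbabilityMeasure P] {ℱ : Filtration ℝ≥0 m} {X : ℝ≥0 → Ω → ℝ} (hX : Martingale X ℱ P)
    (hnonneg : ∀ t ω, 0 ≤ X t ω) (hc : ∀ ω, Continuous fun t => X t ω)
    (hlim : ∀ᵐ ω ∂P, Tendsto (fun t => X t ω) atTop (nhds (0 : ℝ)))
    {s : ℝ≥0} {ξ : Ω → ℝ} (hξ : StronglyMeasurable[ℱ s] ξ) {C : ℝ} (hξb : ∀ ω, |ξ ω| ≤ C)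
    (hξX : ∀ᵐ ω ∂P, ξ ω ≠ 0 → X s ω ≤ 1) :
    ∫ ω, ξ ω * {ω | ∃ r, s ≤ r ∧ 1 ≤ X r ω}.indicator 1 ω ∂P = ∫ ω, ξ ω * X s ω ∂P := by
  set S : ℕ → Ω → Set ℝ≥0 := fun N ω => {r | s ≤ r ∧ (1 ≤ X r ω ∨ s + N ≤ r)} with hS
  set τ : ℕ → Ω → ℝ≥0 := fun N ω => sInf (S N ω) with hτ
  have hmemT : ∀ N ω, s + (N : ℝ≥0) ∈ S N ω := fun N ω => ⟨by simp, .inr le_rfl⟩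
  have hmem : ∀ N ω, τ N ω ∈ S N ω := fun N ω =>
    (isClosed_setOf_le_and (hc ω) s _).csInf_mem ⟨_, hmemT N ω⟩ (OrderBot.bddBelow _)
  have hle : ∀ N ω r, r ∈ S N ω → τ N ω ≤ r := fun N ω r hr => csInf_le (OrderBot.bddBelow _) hr
  have hτst : ∀ N t, MeasurableSet[ℱ t] {ω | τ N ω ≤ t} := fun N t => by
    have : {ω | τ N ω ≤ t} = {ω | ∃ r ∈ Icc s t, 1 ≤ X r ω} ∪ {_ω | s + (N : ℝ≥0) ≤ t} := by
      ext ω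
      simp only [mem_ofPred_eq, mem_union]
      constructor
      · intro h
        rcases (hmem N ω).2 with h1 | h1
        · exact .inl ⟨_, ⟨(hmem N ω).1, h⟩, h1⟩
        · exact .inr (h1.trans h)
      · rintro (⟨r, hr, h1⟩ | h)
        · exact (hle N ω r ⟨hr.1, .inl h1⟩).trans hr.2
        · exact (hle N ω _ (hmemT N ω)).trans h
    rw [this]
    exact (measurableSet_exists_mem_Icc_le hX.1 hc s t 1).union (MeasurableSet.const _)
  have hval : ∀ N, ∫ ω, ξ ω * X (τ N ω) ω ∂P = ∫ ω, ξ ω * X s ω ∂P := fun N =>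
    integral_mul_stopped_eq hX hc (hτst N) (fun ω => (hmem N ω).1)
      (fun ω => hle N ω _ (hmemT N ω)) hξ hξb
  have hXm : ∀ N, Measurable fun ω => X (τ N ω) ω := fun N => by
    have hu : Measurable (Function.uncurry X) :=
      (stronglyMeasurable_uncurry_of_continuous_of_stronglyMeasurable hc
        fun t => (hX.1 t).mono (ℱ.le t)).measurable
    have hτm : Measurable (τ N) := measurable_of_Iic fun t => ℱ.le t _ (hτst N t)
    exact hu.comp (hτm.prodMk measurable_id)
  have hξm : AEStronglyMeasurable ξ P := (hξ.mono (ℱ.le s)).aestronglyMeasurable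
  have hconv : Tendsto (fun N => ∫ ω, ξ ω * X (τ N ω) ω ∂P) atTop
      (nhds (∫ ω, ξ ω * {ω | ∃ r, s ≤ r ∧ 1 ≤ X r ω}.indicator 1 ω ∂P)) := by
    refine tendsto_integral_of_dominated_convergence (fun _ => C)
      (fun N => hξm.mul (hXm N).aestronglyMeasurable) (integrable_const _) (fun N => ?_) ?_
    · filter_upwards [hξX] with ω hω
      by_cases h0 : ξ ω = 0
      · simpa [h0] using (abs_nonneg _).trans (hξb ω)
      · rw [norm_mul, Real.norm_eq_abs, Real.norm_eq_abs, abs_of_nonneg (hnonneg _ ω)]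
        calc |ξ ω| * X (τ N ω) ω ≤ |ξ ω| * 1 := by
              gcongr
              exact apply_sInf_le_one (hc ω) (hω h0)
          _ ≤ C := by simpa using hξb ω
    · filter_upwards [hξX, hlim] with ω hω hl
      by_cases h0 : ξ ω = 0
      · simp [h0]
      refine Tendsto.const_mul _ ?_
      by_cases hE : ω ∈ {ω | ∃ r, s ≤ r ∧ 1 ≤ X r ω}
      · rw [indicator_of_mem hE]
        refine tendsto_const_nhds.congr' ?_
        obtain ⟨r, hr, hr1⟩ := hE
        obtain ⟨N₀, hN₀⟩ := exists_nat_gt r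
        filter_upwards [eventually_ge_atTop N₀] with N hN
        refine le_antisymm ?_ (apply_sInf_le_one (hc ω) (hω h0))
        rcases (hmem N ω).2 with h1 | h1
        · exact h1
        · exfalso
          have h2 := h1.trans (hle N ω r ⟨hr, .inl hr1⟩)
          have h3 : (N₀ : ℝ≥0) ≤ s + N := le_add_left (Nat.cast_le.2 hN)
          exact absurd (hN₀.trans_le (h3.trans h2)) (lt_irrefl _)
      · rw [indicator_of_notMem hE]
        have hτeq : ∀ N, τ N ω = s + N := fun N => by
          refine le_antisymm (hle N ω _ (hmemT N ω)) ?_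
          rcases (hmem N ω).2 with h1 | h1
          · exact absurd ⟨_, (hmem N ω).1, h1⟩ hE
          · exact h1
        simp only [hτeq]
        have hs : Tendsto (fun N : ℕ => s + (N : ℝ≥0)) atTop atTop :=
          tendsto_atTop_mono (fun N => le_add_self) (tendsto_natCast_atTop_atTop (R := ℝ≥0))
        exact hl.comp hs
  simp only [hval] at hconv
  exact tendsto_nhds_unique tendsto_const_nhds hconv |>.symm

lemma Finset.sum_range_ite_lt_sub (g : ℕ → ℝ) (N L : ℕ) :
    ∑ j ∈ Finset.range N, (if j < L then g (j + 1) - g j else 0) = g (min N L) - g 0 := by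
  induction N with
  | zero => simp
  | succ N ih =>
    rw [Finset.sum_range_succ, ih]
    rcases lt_or_ge N L with h | h
    · rw [if_pos h, min_eq_left h.le, min_eq_left (Nat.succ_le_of_lt h)]
      ring
    · rw [if_neg h.not_gt, min_eq_right h, min_eq_right (h.trans N.le_succ)]
      ring

/-- Sampling a left-continuous function on a grid strictly before `x` recovers its value at `x`. -/
lemma tendsto_apply_grid_of_leftCont {v : ℝ≥0 → ℝ} {x : ℝ≥0}
    (hv : ContinuousWithinAt v (Iic x) x) :
    Tendsto (fun n : ℕ => v ((min ((n + 1) ^ 2) (⌈((n : ℝ≥0) + 1) * x⌉₊ - 1) : ℕ) /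
      ((n : ℝ≥0) + 1))) atTop (nhds (v x)) := by
  have hle : ∀ n : ℕ, ((min ((n + 1) ^ 2) (⌈((n : ℝ≥0) + 1) * x⌉₊ - 1) : ℕ) : ℝ≥0) /
      ((n : ℝ≥0) + 1) ≤ x := fun n => by
    have hn : (0 : ℝ≥0) < (n : ℝ≥0) + 1 := by positivity
    rw [div_le_iff₀ hn, mul_comm x]
    refine (Nat.cast_le.2 (min_le_right _ _)).trans ?_
    rcases Nat.eq_zero_or_pos ⌈((n : ℝ≥0) + 1) * x⌉₊ with h | h
    · simp [h]
    · exact (Nat.lt_ceil.1 (Nat.sub_lt h one_pos)).le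
  refine Tendsto.comp hv (tendsto_nhdsWithin_iff.2 ⟨?_, .of_forall hle⟩)
  have hlow : Tendsto (fun n : ℕ => x - 1 / ((n : ℝ≥0) + 1)) atTop (nhds (x - 0)) := by
    refine tendsto_const_nhds.sub ?_
    rw [← NNReal.tendsto_coe]
    simpa using tendsto_one_div_add_atTop_nhds_zero_nat (𝕜 := ℝ)
  rw [tsub_zero] at hlow
  refine tendsto_of_tendsto_of_tendsto_of_le_of_le' hlow tendsto_const_nhds ?_ (.of_forall hle)
  obtain ⟨N, hN⟩ := exists_nat_ge x
  filter_upwards [eventually_ge_atTop N] with n hn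
  have hn0 : (0 : ℝ≥0) < (n : ℝ≥0) + 1 := by positivity
  have hxn : x ≤ (n : ℝ≥0) + 1 := hN.trans ((Nat.cast_le.2 hn).trans le_self_add)
  have hceil : ⌈((n : ℝ≥0) + 1) * x⌉₊ ≤ (n + 1) ^ 2 := by
    rw [Nat.ceil_le, pow_two]
    push_cast
    gcongr
  rw [min_eq_right ((Nat.sub_le _ _).trans hceil), tsub_le_iff_right, ← add_div, le_div_iff₀ hn0,
    mul_comm x]
  refine (Nat.le_ceil _).trans ?_
  have : ⌈((n : ℝ≥0) + 1) * x⌉₊ ≤ ⌈((n : ℝ≥0) + 1) * x⌉₊ - 1 + 1 := by omega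
  exact_mod_cast this

/-- The event that `a * X` reaches the level `1`. -/
def hitEvent {Ω : Type*} (X : ℝ≥0 → Ω → ℝ) (a : ℝ) : Set Ω := {ω | ∃ t, 1 ≤ a * X t ω}

/-- The first time at which `a * X` reaches the level `1`. -/
noncomputable def hitTime {Ω : Type*} (X : ℝ≥0 → Ω → ℝ) (a : ℝ) (ω : Ω) : ℝ≥0 :=
  sInf {t | 1 ≤ a * X t ω}

lemma one_le_mul_hitTime {Ω : Type*} {X : ℝ≥0 → Ω → ℝ} {a : ℝ} {ω : Ω}
    (hc : Continuous fun t => X t ω) (h : ω ∈ hitEvent X a) : 1 ≤ a * X (hitTime X a ω) ω :=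
  (isClosed_le continuous_const (continuous_const.mul hc)).csInf_mem h (OrderBot.bddBelow _)

lemma hitTime_le {Ω : Type*} {X : ℝ≥0 → Ω → ℝ} {a : ℝ} {ω : Ω} {t : ℝ≥0}
    (h : 1 ≤ a * X t ω) : hitTime X a ω ≤ t :=
  csInf_le (OrderBot.bddBelow _) h

lemma lt_hitTime_iff {Ω : Type*} {X : ℝ≥0 → Ω → ℝ} {a : ℝ} {ω : Ω}
    (hc : Continuous fun t => X t ω) (h : ω ∈ hitEvent X a) (s : ℝ≥0) :
    s < hitTime X a ω ↔ ¬ ∃ r ∈ Icc 0 s, 1 ≤ a * X r ω := by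
  rw [← not_le, not_iff_not]
  exact ⟨fun hs => ⟨_, ⟨zero_le, hs⟩, one_le_mul_hitTime hc h⟩,
    fun ⟨r, hr, h1⟩ => (hitTime_le h1).trans hr.2⟩

lemma hitEvent_mono {Ω : Type*} {X : ℝ≥0 → Ω → ℝ} (hnonneg : ∀ t ω, 0 ≤ X t ω) {a b : ℝ}
    (hba : b ≤ a) : hitEvent X b ⊆ hitEvent X a := fun ω ⟨t, ht⟩ =>
  ⟨t, ht.trans (mul_le_mul_of_nonneg_right hba (hnonneg t ω))⟩

lemma measurableSet_hitEvent {Ω : Type*} {m : MeasurableSpace Ω} {ℱ : Filtration ℝ≥0 m}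
    {X : ℝ≥0 → Ω → ℝ} (hX : StronglyAdapted ℱ X) (hc : ∀ ω, Continuous fun t => X t ω) (a : ℝ) :
    MeasurableSet (hitEvent X a) := by
  have : hitEvent X a = ⋃ N : ℕ, {ω | ∃ r ∈ Icc (0 : ℝ≥0) N, 1 ≤ a * X r ω} := by
    ext ω
    simp only [hitEvent, mem_iUnion, mem_ofPred_eq]
    constructor
    · rintro ⟨t, ht⟩
      obtain ⟨N, hN⟩ := exists_nat_ge t
      exact ⟨N, t, ⟨zero_le, hN⟩, ht⟩
    · rintro ⟨N, t, -, ht⟩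
      exact ⟨t, ht⟩
  rw [this]
  exact MeasurableSet.iUnion fun N => ℱ.le N _ (measurableSet_exists_mem_Icc_le
    (X := fun t ω => a * X t ω) (fun t => (hX t).const_mul a)
    (fun ω => continuous_const.mul (hc ω)) 0 N 1)

/-- Conditionally on what happened up to `s`, before `a * X` has reached `1`, the event
`hitEvent X b` has probability `b * X s`. -/
lemma integral_mul_indicator_hitEvent {Ω : Type*} {m : MeasurableSpace Ω} {P : Measure Ω}
    [IsProbabilityMeasure P] {ℱ : Filtration ℝ≥0 m} {X : ℝ≥0 → Ω → ℝ} (hX : Martingale X ℱ P)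
    (hnonneg : ∀ t ω, 0 ≤ X t ω) (hc : ∀ ω, Continuous fun t => X t ω)
    (hlim : ∀ᵐ ω ∂P, Tendsto (fun t => X t ω) atTop (nhds (0 : ℝ))) {b : ℝ} (hb : 0 ≤ b)
    {s : ℝ≥0} {ξ : Ω → ℝ} (hξ : StronglyMeasurable[ℱ s] ξ) {C : ℝ} (hξb : ∀ ω, |ξ ω| ≤ C)
    (hξX : ∀ᵐ ω ∂P, ξ ω ≠ 0 → b * X s ω ≤ 1)
    (hξs : ∀ ω, ξ ω ≠ 0 → ∀ r < s, b * X r ω < 1) :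
    ∫ ω, ξ ω * (hitEvent X b).indicator 1 ω ∂P = b * ∫ ω, ξ ω * X s ω ∂P := by
  have h := integral_mul_indicator_exists_one_le (X := b • X) (hX.smul b)
    (fun t ω => mul_nonneg hb (hnonneg t ω)) (fun ω => continuous_const.mul (hc ω))
    (by
      filter_upwards [hlim] with ω hω
      simpa using hω.const_mul b) hξ hξb hξX
  simp only [Pi.smul_apply, smul_eq_mul] at h
  rw [← integral_const_mul]
  calc _ = _ := by
        refine integral_congr_ae (.of_forall fun ω => ?_)
        by_cases h0 : ξ ω = 0
        · simp [h0]
        have : ω ∈ hitEvent X b ↔ ω ∈ {ω | ∃ r, s ≤ r ∧ 1 ≤ b * X r ω} := by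
          refine ⟨fun ⟨t, ht⟩ => ⟨t, ?_, ht⟩, fun ⟨t, _, ht⟩ => ⟨t, ht⟩⟩
          by_contra hcon
          exact (hξs ω h0 t (not_le.1 hcon)).not_ge ht
        by_cases hω : ω ∈ hitEvent X b
        · simp only [indicator_of_mem hω, indicator_of_mem (this.1 hω)]
        · simp only [indicator_of_notMem hω, indicator_of_notMem (mt this.2 hω)]
    _ = _ := h
    _ = _ := by simp only [mul_left_comm]

/-- Knowing the path up to the first time `a * X` reaches `1`, the conditional probability that
`b * X` also reaches `1` is `b / a`, tested against a left-continuous adapted process. -/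
lemma integral_indicator_hitEvent_apply_hitTime {Ω : Type*} {m : MeasurableSpace Ω}
    {P : Measure Ω} [IsProbabilityMeasure P] {ℱ : Filtration ℝ≥0 m} {X : ℝ≥0 → Ω → ℝ}
    (hX : Martingale X ℱ P) (hnonneg : ∀ t ω, 0 ≤ X t ω) (hc : ∀ ω, Continuous fun t => X t ω)
    (hX0 : ∀ᵐ ω ∂P, X 0 ω = 1)
    (hlim : ∀ᵐ ω ∂P, Tendsto (fun t => X t ω) atTop (nhds (0 : ℝ)))
    {V : ℝ≥0 → Ω → ℝ} {C : ℝ} (hVb : ∀ t ω, |V t ω| ≤ C) (hV : Adapted ℱ V)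
    (hVc : ∀ ω, ∀ t : ℝ≥0, ContinuousWithinAt (fun s => V s ω) (Set.Iic t) t)
    {a b : ℝ} (ha1 : a ≤ 1) (hb : 0 ≤ b) (hba : b ≤ a) :
    AEStronglyMeasurable ((hitEvent X a).indicator fun ω => V (hitTime X a ω) ω) P ∧
    a * ∫ ω, (hitEvent X b).indicator (fun ω => V (hitTime X a ω) ω) ω ∂P
      = b * ∫ ω, (hitEvent X a).indicator (fun ω => V (hitTime X a ω) ω) ω ∂P := by
  have hC : 0 ≤ C := by
    obtain ⟨ω⟩ : Nonempty Ω := nonempty_of_isProbabilityMeasure P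
    exact (abs_nonneg _).trans (hVb 0 ω)
  have ha : 0 ≤ a := hb.trans hba
  have hEm : ∀ c, MeasurableSet (hitEvent X c) := measurableSet_hitEvent hX.1 hc
  have hsub : hitEvent X b ⊆ hitEvent X a := hitEvent_mono hnonneg hba
  have hVm : ∀ t, Measurable (V t) := fun t => (hV t).mono (ℱ.le t) le_rfl
  set A : ℝ≥0 → Set Ω := fun s => {ω | ∃ r ∈ Icc 0 s, 1 ≤ a * X r ω}ᶜ with hA
  have hAm : ∀ s, MeasurableSet[ℱ s] (A s) := fun s => (measurableSet_exists_mem_Icc_le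
    (X := fun t ω => a * X t ω) (fun t => (hX.1 t).const_mul a)
    (fun ω => continuous_const.mul (hc ω)) 0 s 1).compl
  set Z : Ω → ℝ := fun ω =>
    a * (hitEvent X b).indicator 1 ω - b * (hitEvent X a).indicator 1 ω with hZ
  have hZm : Measurable Z := ((measurable_one.indicator (hEm b)).const_mul a).sub
    ((measurable_one.indicator (hEm a)).const_mul b)
  have hind : ∀ c ω, |(hitEvent X c).indicator (1 : Ω → ℝ) ω| ≤ 1 := fun c ω => by
    by_cases h : ω ∈ hitEvent X c <;> simp [h]
  have hZb : ∀ ω, |Z ω| ≤ 2 := fun ω => by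
    have h1 := hind a ω
    have h2 := hind b ω
    have h3 := abs_sub (a * (hitEvent X b).indicator (1 : Ω → ℝ) ω)
      (b * (hitEvent X a).indicator 1 ω)
    rw [abs_mul, abs_mul, abs_of_nonneg ha, abs_of_nonneg hb] at h3
    have h4 := mul_le_mul (ha1) h2 (abs_nonneg _) zero_le_one
    have h5 := mul_le_mul (hba.trans ha1) h1 (abs_nonneg _) zero_le_one
    simp only [hZ]
    linarith
  have hZ0 : ∀ ω ∉ hitEvent X a, Z ω = 0 := fun ω hω => by
    simp [hZ, hω, notMem_subset hsub hω]
  have hintmul : ∀ {ζ : Ω → ℝ} {D : ℝ}, Measurable ζ → (∀ ω, |ζ ω| ≤ D) →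
      Integrable (fun ω => ζ ω * Z ω) P := fun {ζ D} hm hD =>
    Integrable.of_bound (hm.mul hZm).aestronglyMeasurable (D * 2) (.of_forall fun ω => by
      rw [norm_mul]
      exact mul_le_mul (hD ω) (hZb ω) (norm_nonneg _) ((abs_nonneg _).trans (hD ω)))
  have hzero : ∀ {s : ℝ≥0} {ξ : Ω → ℝ} {D : ℝ}, StronglyMeasurable[ℱ s] ξ →
      (∀ ω, |ξ ω| ≤ D) → (∀ᵐ ω ∂P, ξ ω ≠ 0 → a * X s ω ≤ 1) →
      (∀ ω, ξ ω ≠ 0 → ∀ r < s, a * X r ω < 1) → ∫ ω, ξ ω * Z ω ∂P = 0 := by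
    intro s ξ D hξ hξb h1 h2
    have hξm : Measurable ξ := (hξ.mono (ℱ.le s)).measurable
    have hi : ∀ c d, Integrable (fun ω => d * (ξ ω * (hitEvent X c).indicator 1 ω)) P :=
      fun c d => by
        refine (Integrable.of_bound (hξm.mul (measurable_one.indicator
          (hEm c))).aestronglyMeasurable (D * 1) (.of_forall fun ω => ?_)).const_mul d
        rw [Pi.mul_apply, norm_mul]
        exact mul_le_mul (hξb ω) (hind c ω) (norm_nonneg _) ((abs_nonneg _).trans (hξb ω))
    have hle : ∀ r ω, b * X r ω ≤ a * X r ω := fun r ω =>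
      mul_le_mul_of_nonneg_right hba (hnonneg r ω)
    calc ∫ ω, ξ ω * Z ω ∂P = ∫ ω, (a * (ξ ω * (hitEvent X b).indicator 1 ω)
          - b * (ξ ω * (hitEvent X a).indicator 1 ω)) ∂P := by
          congr 1; ext ω; simp only [hZ]; ring
      _ = 0 := by
          rw [integral_sub (hi b a) (hi a b), integral_const_mul, integral_const_mul,
            integral_mul_indicator_hitEvent hX hnonneg hc hlim ha hξ hξb h1 h2,
            integral_mul_indicator_hitEvent hX hnonneg hc hlim hb hξ hξb
              (h1.mono fun ω h h0 => (hle s ω).trans (h h0))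
              (fun ω h0 r hr => (hle r ω).trans_lt (h2 ω h0 r hr))]
          ring
  set g : ℕ → ℕ → ℝ≥0 := fun n j => (j : ℝ≥0) / ((n : ℝ≥0) + 1) with hg
  set ζ : ℕ → ℕ → Ω → ℝ := fun n j =>
    (A (g n (j + 1))).indicator fun ω => V (g n (j + 1)) ω - V (g n j) ω with hζ
  have hgmono : ∀ n j, g n j ≤ g n (j + 1) := fun n j => by
    simp only [hg]; gcongr; exact j.le_succ
  have hζm : ∀ n j, StronglyMeasurable[ℱ (g n (j + 1))] (ζ n j) := fun n j =>
    ((((hV _).sub ((hV _).mono (ℱ.mono (hgmono n j)) le_rfl))).stronglyMeasurable).indicator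
      (hAm _)
  have hζb : ∀ n j ω, |ζ n j ω| ≤ 2 * C := fun n j ω => by
    by_cases h : ω ∈ A (g n (j + 1))
    · simp only [hζ, indicator_of_mem h]
      refine (abs_sub _ _).trans ?_
      linarith [hVb (g n (j + 1)) ω, hVb (g n j) ω]
    · simp only [hζ, indicator_of_notMem h, abs_zero]; positivity
  have hA_lt : ∀ {s ω}, ω ∈ A s → ∀ r ≤ s, a * X r ω < 1 := fun {s ω} h r hr => by
    by_contra hcon
    exact h ⟨r, ⟨zero_le, hr⟩, not_lt.1 hcon⟩
  have hζA : ∀ n j ω, ζ n j ω ≠ 0 → ω ∈ A (g n (j + 1)) := fun n j ω =>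
    mem_of_indicator_ne_zero
  have hζZ : ∀ n j, ∫ ω, ζ n j ω * Z ω ∂P = 0 := fun n j =>
    hzero (hζm n j) (hζb n j) (.of_forall fun ω h => (hA_lt (hζA n j ω h) _ le_rfl).le)
      (fun ω h r hr => hA_lt (hζA n j ω h) r hr.le)
  set W : ℕ → Ω → ℝ := fun n ω => V 0 ω + ∑ j ∈ Finset.range ((n + 1) ^ 2), ζ n j ω with hW
  have hWm : ∀ n, Measurable (W n) := fun n =>
    (hVm 0).add (Finset.measurable_fun_sum _ fun j _ => ((hζm n j).mono (ℱ.le _)).measurable)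
  have hWZ : ∀ n, ∫ ω, W n ω * Z ω ∂P = 0 := fun n => by
    simp only [hW, add_mul, Finset.sum_mul]
    rw [integral_add (hintmul (hVm 0) (hVb 0)) (integrable_finsetSum _ fun j _ =>
      hintmul ((hζm n j).mono (ℱ.le _)).measurable (hζb n j)), integral_finsetSum _ fun j _ =>
      hintmul ((hζm n j).mono (ℱ.le _)).measurable (hζb n j)]
    simp only [hζZ, Finset.sum_const_zero, add_zero]
    refine hzero (hV 0).stronglyMeasurable (hVb 0) ?_ fun ω _ r hr => absurd hr not_lt_zero
    filter_upwards [hX0] with ω h _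
    rw [h, mul_one]; exact ha1
  have hWV : ∀ n, ∀ ω ∈ hitEvent X a, W n ω = V ((min ((n + 1) ^ 2)
      (⌈((n : ℝ≥0) + 1) * hitTime X a ω⌉₊ - 1) : ℕ) / ((n : ℝ≥0) + 1)) ω := fun n ω hω => by
    have hn : (0 : ℝ≥0) < (n : ℝ≥0) + 1 := by positivity
    have h1 : ∀ j, ζ n j ω = if j < ⌈((n : ℝ≥0) + 1) * hitTime X a ω⌉₊ - 1 then
        V (g n (j + 1)) ω - V (g n j) ω else 0 := fun j => by
      have h2 : ω ∈ A (g n (j + 1)) ↔ j < ⌈((n : ℝ≥0) + 1) * hitTime X a ω⌉₊ - 1 := by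
        rw [lt_tsub_iff_right, Nat.lt_ceil, mul_comm, ← div_lt_iff₀ hn]
        exact (lt_hitTime_iff (hc ω) hω _).symm
      simp only [hζ, indicator, h2]
    simp only [hW, h1]
    rw [Finset.sum_range_ite_lt_sub (fun j => V (g n j) ω)]
    simp [hg]
  have hWlim : ∀ ω ∈ hitEvent X a,
      Tendsto (fun n => W n ω) atTop (nhds (V (hitTime X a ω) ω)) := fun ω hω => by
    simp only [hWV _ ω hω]
    exact tendsto_apply_grid_of_leftCont (hVc ω _)
  have hmeas : AEStronglyMeasurable ((hitEvent X a).indicator fun ω => V (hitTime X a ω) ω) P := by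
    refine aestronglyMeasurable_of_tendsto_ae atTop (f := fun n => (hitEvent X a).indicator (W n))
      (fun n => ((hWm n).indicator (hEm a)).aestronglyMeasurable) (.of_forall fun ω => ?_)
    by_cases hω : ω ∈ hitEvent X a
    · simpa only [indicator_of_mem hω] using hWlim ω hω
    · simp only [indicator_of_notMem hω]; exact tendsto_const_nhds
  refine ⟨hmeas, ?_⟩
  have hconv : Tendsto (fun n => ∫ ω, W n ω * Z ω ∂P) atTop
      (nhds (∫ ω, V (hitTime X a ω) ω * Z ω ∂P)) := by
    refine tendsto_integral_of_dominated_convergence (fun _ => C * 2)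
      (fun n => ((hWm n).mul hZm).aestronglyMeasurable) (integrable_const _)
      (fun n => .of_forall fun ω => ?_) (.of_forall fun ω => ?_)
    · by_cases hω : ω ∈ hitEvent X a
      · rw [norm_mul, hWV n ω hω]
        exact mul_le_mul (hVb _ ω) (hZb ω) (norm_nonneg _) hC
      · rw [hZ0 ω hω]; simpa using hC
    · by_cases hω : ω ∈ hitEvent X a
      · exact (hWlim ω hω).mul_const _
      · simp only [hZ0 ω hω, mul_zero]; exact tendsto_const_nhds
  simp only [hWZ] at hconv
  have hVZ := tendsto_nhds_unique hconv tendsto_const_nhds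
  have hint : Integrable ((hitEvent X a).indicator fun ω => V (hitTime X a ω) ω) P :=
    Integrable.of_bound hmeas C (.of_forall fun ω => by
      by_cases hω : ω ∈ hitEvent X a
      · rw [indicator_of_mem hω]; exact hVb _ ω
      · rw [indicator_of_notMem hω]; simpa using hC)
  have hint' : Integrable ((hitEvent X b).indicator fun ω => V (hitTime X a ω) ω) P := by
    have := hint.indicator (hEm b)
    rwa [indicator_indicator, inter_eq_self_of_subset_left hsub] at this
  rw [← integral_const_mul, ← integral_const_mul, ← sub_eq_zero,
    ← integral_sub (hint'.const_mul a) (hint.const_mul b), ← hVZ]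
  refine integral_congr_ae (.of_forall fun ω => ?_)
  by_cases h1 : ω ∈ hitEvent X a <;> by_cases h2 : ω ∈ hitEvent X b <;> simp [hZ, h1, h2] <;> ring

/-- The process `V` sampled at the hitting times of lower levels converges to its value at the
hitting time. -/
lemma tendsto_apply_hitTime {Ω : Type*} {X V : ℝ≥0 → Ω → ℝ} (hnonneg : ∀ t ω, 0 ≤ X t ω)
    {ω : Ω} (hc : Continuous fun t => X t ω)
    (hVc : ∀ t : ℝ≥0, ContinuousWithinAt (fun s => V s ω) (Set.Iic t) t)
    {a : ℝ} {α : ℕ → ℝ} (hα : Tendsto α atTop (nhds a)) (hle : ∀ n, a ≤ α n)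
    (h : ω ∈ hitEvent X a) :
    Tendsto (fun n => V (hitTime X (α n) ω) ω) atTop (nhds (V (hitTime X a ω) ω)) := by
  have hmem : ∀ n, ω ∈ hitEvent X (α n) := fun n => hitEvent_mono hnonneg (hle n) h
  have hup : ∀ n, hitTime X (α n) ω ≤ hitTime X a ω := fun n =>
    hitTime_le ((one_le_mul_hitTime hc h).trans
      (mul_le_mul_of_nonneg_right (hle n) (hnonneg _ ω)))
  have ha : 0 ≤ a := by
    obtain ⟨t, ht⟩ := h
    by_contra hneg
    have := mul_nonpos_of_nonpos_of_nonneg (not_le.1 hneg).le (hnonneg t ω)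
    linarith
  refine Tendsto.comp (hVc _) (tendsto_nhdsWithin_iff.2 ⟨?_, .of_forall hup⟩)
  refine tendsto_order.2 ⟨fun t ht => ?_, fun t ht => .of_forall fun n => (hup n).trans_lt ht⟩
  obtain ⟨r, hr, hmax⟩ := isCompact_Icc.exists_isMaxOn (nonempty_Icc.2 (zero_le (a := t)))
    hc.continuousOn
  have hr1 : a * X r ω < 1 := by
    by_contra hcon
    exact (lt_hitTime_iff hc h t).1 ht ⟨r, hr, not_lt.1 hcon⟩
  filter_upwards [(hα.mul_const (X r ω)).eventually_lt_const hr1] with n hn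
  rw [lt_hitTime_iff hc (hmem n)]
  rintro ⟨q, hq, hq1⟩
  have hqr : α n * X q ω ≤ α n * X r ω := mul_le_mul_of_nonneg_left (hmax hq) (ha.trans (hle n))
  linarith

/-- A continuous path started at `1` and vanishing at infinity attains its maximum. -/
lemma exists_forall_apply_le_of_tendsto_zero {f : ℝ≥0 → ℝ} (hf : Continuous f) (h0 : f 0 = 1)
    (hlim : Tendsto f atTop (nhds 0)) : ∃ t, 1 ≤ f t ∧ ∀ r, f r ≤ f t := by
  obtain ⟨T, hT⟩ := eventually_atTop.1 (hlim.eventually_lt_const one_pos)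
  obtain ⟨t, ht, hmax⟩ := isCompact_Icc.exists_isMaxOn (nonempty_Icc.2 (zero_le (a := T)))
    hf.continuousOn
  have h1 : 1 ≤ f t := h0 ▸ hmax (left_mem_Icc.2 zero_le)
  refine ⟨t, h1, fun r => ?_⟩
  rcases le_total r T with h | h
  · exact hmax ⟨zero_le, h⟩
  · exact (hT r h).le.trans h1

/-- For a path started at `1`, reaching a level above `1` is the same as hitting it exactly. -/
lemma indicator_exists_eq_apply_sInf {Ω : Type*} {X V : ℝ≥0 → Ω → ℝ} {ω : Ω}
    (hc : Continuous fun t => X t ω) (h0 : X 0 ω = 1) {u : ℝ} (hu : u ∈ Ico (0 : ℝ) 1) :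
    {ω' | ∃ t : ℝ≥0, X t ω' = 1 / (1 - u)}.indicator
        (fun ω' => V (sInf {t : ℝ≥0 | X t ω' = 1 / (1 - u)}) ω') ω
      = (hitEvent X (1 - u)).indicator (fun ω' => V (hitTime X (1 - u) ω') ω') ω := by
  have hu1 : 0 < 1 - u := sub_pos.2 hu.2
  have hge : ∀ x, 1 ≤ (1 - u) * x ↔ 1 / (1 - u) ≤ x := fun x => (div_le_iff₀' hu1).symm
  have hy : X 0 ω ≤ 1 / (1 - u) := by
    rw [h0, le_div_iff₀ hu1]
    linarith [hu.1]
  have hivt : ∀ t, 1 / (1 - u) ≤ X t ω → ∃ r ≤ t, X r ω = 1 / (1 - u) := fun t ht => by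
    obtain ⟨r, hr, h⟩ := intermediate_value_Icc (zero_le (a := t)) hc.continuousOn ⟨hy, ht⟩
    exact ⟨r, hr.2, h⟩
  by_cases hω : ω ∈ hitEvent X (1 - u)
  · obtain ⟨t, ht⟩ := id hω
    obtain ⟨r, -, hr⟩ := hivt t ((hge _).1 ht)
    have hωr : ω ∈ {ω' | ∃ t : ℝ≥0, X t ω' = 1 / (1 - u)} := ⟨r, hr⟩
    rw [indicator_of_mem hω, indicator_of_mem hωr]
    have : sInf {t : ℝ≥0 | X t ω = 1 / (1 - u)} = hitTime X (1 - u) ω := by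
      refine le_antisymm (le_csInf ⟨t, ht⟩ fun q hq => ?_)
        (le_csInf ⟨r, hr⟩ fun q hq => hitTime_le ((hge _).2 (ge_of_eq hq)))
      obtain ⟨q', hq', h⟩ := hivt q ((hge _).1 hq)
      exact (csInf_le (s := {t : ℝ≥0 | X t ω = 1 / (1 - u)}) (OrderBot.bddBelow _) h).trans hq'
    rw [this]
  · rw [indicator_of_notMem hω, indicator_of_notMem]
    rintro ⟨t, ht⟩
    exact hω ⟨t, (hge _).2 (ge_of_eq ht)⟩

lemma tendsto_floor_mul_div {u : ℝ} (hu : 0 ≤ u) :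
    Tendsto (fun n : ℕ => (⌊u * ((n : ℝ) + 1)⌋₊ : ℝ) / ((n : ℝ) + 1)) atTop (nhds u) :=
  (tendsto_nat_floor_mul_div_atTop hu).comp
    (tendsto_atTop_add_const_right _ _ tendsto_natCast_atTop_atTop)

lemma floor_mul_div_le {u : ℝ} (hu : 0 ≤ u) (n : ℕ) :
    (⌊u * ((n : ℝ) + 1)⌋₊ : ℝ) / ((n : ℝ) + 1) ≤ u := by
  rw [div_le_iff₀ (by positivity)]
  exact Nat.floor_le (by positivity)

/-- The integral over `[0, 1)` of a step function on the uniform grid. -/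
lemma setIntegral_Ico_floor (c : ℕ → ℝ) (n : ℕ) :
    ∫ u in Ico (0 : ℝ) 1, c ⌊u * ((n : ℝ) + 1)⌋₊
      = ∑ k ∈ Finset.range (n + 1), 1 / ((n : ℝ) + 1) * c k := by
  have hn : (0 : ℝ) < (n : ℝ) + 1 := by positivity
  set I : ℕ → Set ℝ := fun k => Ico ((k : ℝ) / ((n : ℝ) + 1)) (((k : ℝ) + 1) / ((n : ℝ) + 1))
  have hI : ∀ k, ∀ u, 0 ≤ u → (u ∈ I k ↔ ⌊u * ((n : ℝ) + 1)⌋₊ = k) := fun k u hu => by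
    rw [Nat.floor_eq_iff (by positivity), mem_Ico, div_le_iff₀ hn, lt_div_iff₀ hn]
  calc ∫ u in Ico (0 : ℝ) 1, c ⌊u * ((n : ℝ) + 1)⌋₊
      = ∫ u in Ico (0 : ℝ) 1, ∑ k ∈ Finset.range (n + 1), (I k).indicator (fun _ => c k) u := by
        refine setIntegral_congr_fun measurableSet_Ico fun u hu => ?_
        have hlt : ⌊u * ((n : ℝ) + 1)⌋₊ < n + 1 := by
          rw [Nat.floor_lt (mul_nonneg hu.1 hn.le)]
          push_cast
          exact mul_lt_of_lt_one_left hn hu.2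
        rw [Finset.sum_eq_single_of_mem _ (Finset.mem_range.2 hlt), indicator_of_mem]
        · exact (hI _ u hu.1).2 rfl
        · intro k _ hk
          exact indicator_of_notMem (fun h => hk ((hI k u hu.1).1 h).symm) _
    _ = ∑ k ∈ Finset.range (n + 1), 1 / ((n : ℝ) + 1) * c k := by
        rw [integral_finsetSum _ fun k _ => (integrable_const _).indicator measurableSet_Ico]
        refine Finset.sum_congr rfl fun k hk => ?_
        have hk' : (k : ℝ) + 1 ≤ (n : ℝ) + 1 := by
          exact_mod_cast Nat.succ_le_of_lt (Finset.mem_range.1 hk)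
        have hsub : I k ⊆ Ico 0 1 := Ico_subset_Ico (by positivity) ((div_le_one hn).2 hk')
        rw [integral_indicator measurableSet_Ico, Measure.restrict_restrict measurableSet_Ico,
          inter_eq_self_of_subset_left hsub, setIntegral_const, Real.volume_real_Ico,
          smul_eq_mul, ← sub_div, add_sub_cancel_left, max_eq_left (by positivity)]

lemma abs_integral_indicator_hitEvent_le {Ω : Type*} {m : MeasurableSpace Ω} {P : Measure Ω}
    [IsProbabilityMeasure P] {ℱ : Filtration ℝ≥0 m} {X : ℝ≥0 → Ω → ℝ} (hX : Martingale X ℱ P)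
    (hnonneg : ∀ t ω, 0 ≤ X t ω) (hc : ∀ ω, Continuous fun t => X t ω)
    (hX0 : ∀ᵐ ω ∂P, X 0 ω = 1)
    (hlim : ∀ᵐ ω ∂P, Tendsto (fun t => X t ω) atTop (nhds (0 : ℝ)))
    {f : Ω → ℝ} {C : ℝ} (hf : ∀ ω, |f ω| ≤ C) {a : ℝ} (ha : 0 ≤ a) (ha1 : a ≤ 1) :
    |∫ ω, (hitEvent X a).indicator f ω ∂P| ≤ C * a := by
  have hprob := integral_mul_indicator_hitEvent hX hnonneg hc hlim ha (s := 0)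
    (ξ := fun _ => 1) stronglyMeasurable_const (C := 1) (by simp)
    (by filter_upwards [hX0] with ω h _; rwa [h, mul_one])
    (fun ω _ r hr => absurd hr not_lt_zero)
  simp only [one_mul] at hprob
  rw [integral_congr_ae hX0, integral_const, probReal_univ, one_smul, mul_one] at hprob
  have hint : Integrable (fun ω => C * (hitEvent X a).indicator (fun _ => (1 : ℝ)) ω) P :=
    ((integrable_const (μ := P) (1 : ℝ)).indicator (measurableSet_hitEvent hX.1 hc a)).const_mul C
  have hbound : ∀ ω, ‖(hitEvent X a).indicator f ω‖
      ≤ C * (hitEvent X a).indicator (fun _ => (1 : ℝ)) ω := fun ω => by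
    by_cases h : ω ∈ hitEvent X a
    · simpa [h] using hf ω
    · simp [h]
  exact (norm_integral_le_of_norm_le hint (.of_forall hbound)).trans_eq
    ((integral_const_mul _ _).trans (congrArg (C * ·) hprob))

/-- The expectation of `V` at the hitting time of `1` by `a * X` is right-continuous in `a`. -/
lemma tendsto_integral_indicator_hitEvent {Ω : Type*} {m : MeasurableSpace Ω} {P : Measure Ω}
    [IsProbabilityMeasure P] {X V : ℝ≥0 → Ω → ℝ} (hnonneg : ∀ t ω, 0 ≤ X t ω)
    (hc : ∀ ω, Continuous fun t => X t ω) (hX0 : ∀ᵐ ω ∂P, X 0 ω = 1)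
    (hlim : ∀ᵐ ω ∂P, Tendsto (fun t => X t ω) atTop (nhds (0 : ℝ)))
    {C : ℝ} (hVb : ∀ t ω, |V t ω| ≤ C)
    (hVc : ∀ ω, ∀ t : ℝ≥0, ContinuousWithinAt (fun s => V s ω) (Set.Iic t) t)
    {a : ℝ} {α : ℕ → ℝ} (ha : 0 ≤ a) (hα : Tendsto α atTop (nhds a)) (hle : ∀ n, a ≤ α n)
    (hmeas : ∀ n, AEStronglyMeasurable
      ((hitEvent X (α n)).indicator fun ω => V (hitTime X (α n) ω) ω) P) :
    Tendsto (fun n => ∫ ω, (hitEvent X (α n)).indicator (fun ω => V (hitTime X (α n) ω) ω) ω ∂P)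
      atTop (nhds (∫ ω, (hitEvent X a).indicator (fun ω => V (hitTime X a ω) ω) ω ∂P)) := by
  refine tendsto_integral_of_dominated_convergence (fun _ => C) hmeas (integrable_const _)
    (fun n => .of_forall fun ω => (norm_indicator_le_norm_self _ ω).trans (hVb _ ω)) ?_
  filter_upwards [hX0, hlim] with ω h0 hl
  by_cases hω : ω ∈ hitEvent X a
  · have hωn : ∀ n, ω ∈ hitEvent X (α n) := fun n => hitEvent_mono hnonneg (hle n) hω
    simp only [indicator_of_mem hω, indicator_of_mem (hωn _)]
    exact tendsto_apply_hitTime hnonneg (hc ω) (hVc ω) hα hle hω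
  · obtain ⟨t, -, hmax⟩ := exists_forall_apply_le_of_tendsto_zero (hc ω) h0 hl
    have ht : a * X t ω < 1 := by
      by_contra hcon
      exact hω ⟨t, not_lt.1 hcon⟩
    rw [indicator_of_notMem hω]
    refine tendsto_const_nhds.congr' ?_
    filter_upwards [(hα.mul_const (X t ω)).eventually_lt_const ht] with n hn
    refine (indicator_of_notMem ?_ _).symm
    rintro ⟨r, hr⟩
    have := mul_le_mul_of_nonneg_left (hmax r) (ha.trans (hle n))
    linarith

/-- Sampling `V` along the hitting times of a grid of levels, at the last level reached, recovers
in the limit the value of `V` at the time of the maximum. -/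
lemma tendsto_sum_indicator_hitEvent_sub {Ω : Type*} {X V : ℝ≥0 → Ω → ℝ}
    (hnonneg : ∀ t ω, 0 ≤ X t ω) {ω : Ω} (hc : Continuous fun t => X t ω) (h0 : X 0 ω = 1)
    (hlim : Tendsto (fun t => X t ω) atTop (nhds (0 : ℝ)))
    (hVc : ∀ t : ℝ≥0, ContinuousWithinAt (fun s => V s ω) (Set.Iic t) t) {α : ℕ → ℕ → ℝ}
    (hα : ∀ n k, α n k = 1 - (k : ℝ) / ((n : ℝ) + 1)) :
    (∀ n : ℕ, ∃ t, ∑ k ∈ Finset.range (n + 1),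
      ((hitEvent X (α n k)).indicator (fun ω => V (hitTime X (α n k) ω) ω) ω
        - (hitEvent X (α n (k + 1))).indicator (fun ω => V (hitTime X (α n k) ω) ω) ω) = V t ω) ∧
    Tendsto (fun n : ℕ => ∑ k ∈ Finset.range (n + 1),
      ((hitEvent X (α n k)).indicator (fun ω => V (hitTime X (α n k) ω) ω) ω
        - (hitEvent X (α n (k + 1))).indicator (fun ω => V (hitTime X (α n k) ω) ω) ω))
      atTop (nhds (V (sInf {t | X t ω = ⨆ r, X r ω}) ω)) := by
  obtain ⟨t, ht1, hmax⟩ := exists_forall_apply_le_of_tendsto_zero hc h0 hlim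
  have htpos : 0 < X t ω := one_pos.trans_le ht1
  have hsup : ⨆ r, X r ω = X t ω :=
    le_antisymm (ciSup_le hmax) (le_ciSup ⟨X t ω, forall_mem_range.2 hmax⟩ t)
  set U : ℝ := 1 - 1 / X t ω with hU
  have hU0 : 0 ≤ U := sub_nonneg.2 ((div_le_one htpos).2 ht1)
  have hU1 : U < 1 := sub_lt_self _ (by positivity)
  have hUa : 1 - U = 1 / X t ω := by rw [hU]; ring
  have hρ : sInf {t | X t ω = ⨆ r, X r ω} = hitTime X (1 - U) ω := by
    rw [hsup, hitTime, hUa]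
    congr 1
    ext r
    simp only [mem_ofPred_eq]
    rw [one_div, ← div_eq_inv_mul, one_le_div htpos]
    exact ⟨fun h => h.ge, fun h => le_antisymm (hmax r) h⟩
  have hmemU : ω ∈ hitEvent X (1 - U) := ⟨t, by rw [hUa, one_div_mul_cancel htpos.ne']⟩
  have hmem : ∀ n k, k ≤ n + 1 → (ω ∈ hitEvent X (α n k) ↔ k ≤ ⌊U * ((n : ℝ) + 1)⌋₊) := by
    intro n k hk
    have hn : (0 : ℝ) < (n : ℝ) + 1 := by positivity
    have hα0 : 0 ≤ α n k := by
      rw [hα, sub_nonneg, div_le_one hn]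
      exact_mod_cast hk
    rw [Nat.le_floor_iff (by positivity), ← div_le_iff₀ hn]
    have h1 : ω ∈ hitEvent X (α n k) ↔ 1 ≤ α n k * X t ω :=
      ⟨fun ⟨r, hr⟩ => hr.trans (mul_le_mul_of_nonneg_left (hmax r) hα0), fun h => ⟨t, h⟩⟩
    rw [h1, ← div_le_iff₀ htpos, hα, hU]
    constructor <;> intro h <;> linarith
  have hsum : ∀ n : ℕ, ∑ k ∈ Finset.range (n + 1),
      ((hitEvent X (α n k)).indicator (fun ω => V (hitTime X (α n k) ω) ω) ω
        - (hitEvent X (α n (k + 1))).indicator (fun ω => V (hitTime X (α n k) ω) ω) ω)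
      = V (hitTime X (1 - (⌊U * ((n : ℝ) + 1)⌋₊ : ℝ) / ((n : ℝ) + 1)) ω) ω := fun n => by
    have hlt : ⌊U * ((n : ℝ) + 1)⌋₊ < n + 1 := by
      rw [Nat.floor_lt (by positivity)]
      push_cast
      exact mul_lt_of_lt_one_left (by positivity) hU1
    rw [← hα, Finset.sum_eq_single_of_mem _ (Finset.mem_range.2 hlt)]
    · rw [indicator_of_mem ((hmem n _ hlt.le).2 le_rfl),
        indicator_of_notMem (mt (hmem n _ hlt).1 (by simp)), sub_zero]
    · intro k hk hne
      have hkn := Finset.mem_range.1 hk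
      rcases lt_or_gt_of_ne hne with h | h
      · rw [indicator_of_mem ((hmem n k hkn.le).2 h.le),
          indicator_of_mem ((hmem n (k + 1) hkn).2 h), sub_self]
      · rw [indicator_of_notMem (mt (hmem n k hkn.le).1 h.not_ge),
          indicator_of_notMem (mt (hmem n (k + 1) hkn).1 (by omega)), sub_zero]
  refine ⟨fun n => ⟨_, hsum n⟩, ?_⟩
  simp only [hsum, hρ]
  exact tendsto_apply_hitTime hnonneg hc hVc (tendsto_const_nhds.sub (tendsto_floor_mul_div hU0))
    (fun n => sub_le_sub_left (floor_mul_div_le hU0 n) 1) hmemU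

/-- **second identity of Lemma 3.1.** Let `M` be a nonnegative continuous
martingale with `M 0 = 1` a.s. and `M t → 0` a.s. as `t → ∞`, let
`ρ := inf {t | M t = M*_∞}` be the (a.s. unique and a.s. finite) time of the overall maximum
of `M`, and for `u ∈ [0,1)` let `η_u := inf {t | M t = 1/(1−u)}` (on the event
`{η_u < ∞} = {ω | ∃ t, M t ω = 1/(1−u)}`). Let `V` be a bounded adapted process with
left-continuous sample paths. Then
`E[V ρ] = ∫_{[0,1)} (1/(1−u)) E[V_{η_u} 1_{{η_u < ∞}}] du`. -/
theorem expectation_at_time_of_maximum_via_hitting_times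
    {Ω : Type*} {m : MeasurableSpace Ω} {P : Measure Ω} [IsProbabilityMeasure P]
    (ℱ : Filtration ℝ≥0 m) (M : ℝ≥0 → Ω → ℝ)
    (hMmart : Martingale M ℱ P)
    (hMnonneg : ∀ t ω, 0 ≤ M t ω)
    (hMcont : ∀ ω, Continuous fun t => M t ω)
    (hM0 : ∀ᵐ ω ∂P, M 0 ω = 1)
    (hMlim : ∀ᵐ ω ∂P, Tendsto (fun t => M t ω) atTop (nhds (0 : ℝ)))
    (ρ : Ω → ℝ≥0) (hρ : ∀ ω, ρ ω = sInf {u : ℝ≥0 | M u ω = ⨆ v, M v ω})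
    (V : ℝ≥0 → Ω → ℝ) (C : ℝ) (hVbdd : ∀ t ω, |V t ω| ≤ C)
    (hVadapted : Adapted ℱ V)
    (hVleftcont : ∀ ω, ∀ t : ℝ≥0, ContinuousWithinAt (fun s => V s ω) (Set.Iic t) t) :
    ∫ ω, V (ρ ω) ω ∂P
      = ∫ u in Set.Ico (0 : ℝ) 1,
          (1 / (1 - u)) *
            ∫ ω, Set.indicator {ω' | ∃ t : ℝ≥0, M t ω' = 1 / (1 - u)}
              (fun ω' => V (sInf {t : ℝ≥0 | M t ω' = 1 / (1 - u)}) ω') ω ∂P := by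
  set F : ℝ → ℝ := fun a => ∫ ω, (hitEvent M a).indicator (fun ω => V (hitTime M a ω) ω) ω ∂P
    with hF
  set α : ℕ → ℕ → ℝ := fun n k => 1 - (k : ℝ) / ((n : ℝ) + 1) with hα
  have hmeas : ∀ a, 0 ≤ a → a ≤ 1 →
      AEStronglyMeasurable ((hitEvent M a).indicator fun ω => V (hitTime M a ω) ω) P :=
    fun a ha ha1 => (integral_indicator_hitEvent_apply_hitTime hMmart hMnonneg hMcont hM0 hMlim
      hVbdd hVadapted hVleftcont ha1 ha le_rfl).1
  have hint : ∀ a b, 0 ≤ b → b ≤ a → a ≤ 1 →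
      Integrable ((hitEvent M b).indicator fun ω => V (hitTime M a ω) ω) P := by
    intro a b hb hba ha1
    have h1 : Integrable ((hitEvent M a).indicator fun ω => V (hitTime M a ω) ω) P :=
      .of_bound (hmeas a (hb.trans hba) ha1) C
        (.of_forall fun ω => (norm_indicator_le_norm_self _ ω).trans (hVbdd _ ω))
    have := h1.indicator (measurableSet_hitEvent hMmart.1 hMcont b)
    rwa [indicator_indicator, inter_eq_self_of_subset_left (hitEvent_mono hMnonneg hba)] at this
  have hα0 : ∀ n k, k ≤ n + 1 → 0 ≤ α n k := fun n k hk => by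
    rw [hα, sub_nonneg, div_le_one (by positivity)]
    exact_mod_cast hk
  have hα1 : ∀ n k, α n k ≤ 1 := fun n k => sub_le_self _ (by positivity)
  have hαsucc : ∀ n k, α n (k + 1) = α n k - 1 / ((n : ℝ) + 1) := fun n k => by
    simp only [hα]; push_cast; ring
  have hαpos : ∀ n k, k < n + 1 → 0 < α n k := fun n k hk => by
    have h1 := hα0 n (k + 1) hk
    rw [hαsucc] at h1
    have : (0 : ℝ) < 1 / ((n : ℝ) + 1) := by positivity
    linarith
  have hαle : ∀ n k, α n (k + 1) ≤ α n k := fun n k => by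
    rw [hαsucc]; exact sub_le_self _ (by positivity)
  have hstep : ∀ n : ℕ, ∫ ω, ∑ k ∈ Finset.range (n + 1),
      ((hitEvent M (α n k)).indicator (fun ω => V (hitTime M (α n k) ω) ω) ω
        - (hitEvent M (α n (k + 1))).indicator (fun ω => V (hitTime M (α n k) ω) ω) ω) ∂P
      = ∫ u in Ico (0 : ℝ) 1, 1 / α n ⌊u * ((n : ℝ) + 1)⌋₊ * F (α n ⌊u * ((n : ℝ) + 1)⌋₊) := by
    intro n
    have hi : ∀ k ∈ Finset.range (n + 1),
        Integrable ((hitEvent M (α n k)).indicator fun ω => V (hitTime M (α n k) ω) ω) P ∧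
        Integrable ((hitEvent M (α n (k + 1))).indicator fun ω => V (hitTime M (α n k) ω) ω) P :=
      fun k hk =>
        have hk' := Finset.mem_range.1 hk
        ⟨hint (α n k) (α n k) (hα0 n k hk'.le) le_rfl (hα1 n k),
          hint (α n k) (α n (k + 1)) (hα0 n (k + 1) hk') (hαle n k) (hα1 n k)⟩
    rw [setIntegral_Ico_floor (fun k => 1 / α n k * F (α n k))]
    refine (integral_finsetSum _ fun k hk => (hi k hk).1.sub (hi k hk).2).trans ?_
    refine Finset.sum_congr rfl fun k hk => ?_
    have hk' := Finset.mem_range.1 hk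
    have hpos := hαpos n k hk'
    have h1 := (integral_indicator_hitEvent_apply_hitTime hMmart hMnonneg hMcont hM0 hMlim
      hVbdd hVadapted hVleftcont (hα1 n k) (hα0 n (k + 1) hk') (hαle n k)).2
    refine (integral_sub (hi k hk).1 (hi k hk).2).trans (mul_left_cancel₀ hpos.ne' ?_)
    rw [mul_sub, h1, hαsucc n k, ← mul_sub_right_distrib, sub_sub_cancel, mul_left_comm,
      ← mul_assoc (α n k), mul_one_div_cancel hpos.ne', one_mul]
  have hL : Tendsto (fun n : ℕ => ∫ ω, ∑ k ∈ Finset.range (n + 1),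
      ((hitEvent M (α n k)).indicator (fun ω => V (hitTime M (α n k) ω) ω) ω
        - (hitEvent M (α n (k + 1))).indicator (fun ω => V (hitTime M (α n k) ω) ω) ω) ∂P) atTop
      (nhds (∫ ω, V (ρ ω) ω ∂P)) := by
    refine tendsto_integral_of_dominated_convergence (fun _ => C) (fun n => ?_)
      (integrable_const _) (fun n => ?_) ?_
    · refine (integrable_finsetSum _ fun k hk => ?_).aestronglyMeasurable
      have hk' := Finset.mem_range.1 hk
      exact (hint (α n k) (α n k) (hα0 n k hk'.le) le_rfl (hα1 n k)).sub
        (hint (α n k) (α n (k + 1)) (hα0 n (k + 1) hk') (hαle n k) (hα1 n k))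
    · filter_upwards [hM0, hMlim] with ω h0 hl
      obtain ⟨t, ht⟩ := (tendsto_sum_indicator_hitEvent_sub (α := α) hMnonneg (hMcont ω) h0 hl
        (hVleftcont ω) fun _ _ => rfl).1 n
      rw [ht]
      exact hVbdd t ω
    · filter_upwards [hM0, hMlim] with ω h0 hl
      rw [hρ]
      exact (tendsto_sum_indicator_hitEvent_sub (α := α) hMnonneg (hMcont ω) h0 hl
        (hVleftcont ω) fun _ _ => rfl).2
  have hR : Tendsto (fun n : ℕ => ∫ u in Ico (0 : ℝ) 1,
      1 / α n ⌊u * ((n : ℝ) + 1)⌋₊ * F (α n ⌊u * ((n : ℝ) + 1)⌋₊)) atTop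
      (nhds (∫ u in Ico (0 : ℝ) 1, 1 / (1 - u) * F (1 - u))) := by
    have hbelow : ∀ u ∈ Ico (0 : ℝ) 1, ∀ n : ℕ, 1 - u ≤ α n ⌊u * ((n : ℝ) + 1)⌋₊ := fun u hu n =>
      sub_le_sub_left (floor_mul_div_le hu.1 n) 1
    refine tendsto_integral_of_dominated_convergence (fun _ => C) (fun n => ?_)
      (integrable_const _) (fun n => ?_) ?_
    · have h1 : Measurable fun k : ℕ => 1 / α n k * F (α n k) := measurable_from_nat
      exact (h1.comp (Nat.measurable_floor.comp
        (measurable_id.mul_const ((n : ℝ) + 1)))).aestronglyMeasurable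
    · filter_upwards [ae_restrict_mem measurableSet_Ico] with u hu
      have hpos := (sub_pos.2 hu.2).trans_le (hbelow u hu n)
      rw [norm_mul, Real.norm_eq_abs, abs_of_pos (one_div_pos.2 hpos), one_div,
        ← div_eq_inv_mul, div_le_iff₀ hpos]
      exact abs_integral_indicator_hitEvent_le hMmart hMnonneg hMcont hM0 hMlim
        (fun ω => hVbdd _ ω) hpos.le (hα1 n _)
    · filter_upwards [ae_restrict_mem measurableSet_Ico] with u hu
      have hpos := sub_pos.2 hu.2
      have hlim : Tendsto (fun n : ℕ => α n ⌊u * ((n : ℝ) + 1)⌋₊) atTop (nhds (1 - u)) :=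
        tendsto_const_nhds.sub (tendsto_floor_mul_div hu.1)
      refine (tendsto_const_nhds.div hlim hpos.ne').mul ?_
      exact tendsto_integral_indicator_hitEvent hMnonneg hMcont hM0 hMlim hVbdd hVleftcont
        hpos.le hlim (hbelow u hu)
        fun n => hmeas _ (hpos.le.trans (hbelow u hu n)) (hα1 n _)
  simp only [hstep] at hL
  rw [tendsto_nhds_unique hL hR]
  refine setIntegral_congr_fun measurableSet_Ico fun u hu => ?_
  simp only [hF]
  congr 1
  refine integral_congr_ae ?_
  filter_upwards [hM0] with ω h0
  exact (indicator_exists_eq_apply_sInf (hMcont ω) h0 hu).symm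
end
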